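/- Let g be the finite-dimensional simple Lie algebra of type E₆ over ℂ. For every nonzero nilpotent element e of g, one has g_e = [g_e,g_e] if and only if dim g_e ∈ {56, 38, 24}. (These dimensions correspond to the three strongly reachable nilpotent orbits of E₆, with labels A₁, 3A₁, 2A₂+A₁, which are exactly the rigid orbits of E₆.) -/

import Mathlib

/-- The centralizer `g_e` of `e`, i.e. the kernel of `ad e`. -/
noncomputable def centralizer (e : LieAlgebra.e₆ ℂ) : Submodule ℂ (LieAlgebra.e₆ ℂ) :=
  LinearMap.ker (LieAlgebra.ad ℂ (LieAlgebra.e₆ ℂ) e)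

/-- The derived subalgebra `[g_e, g_e]` of the centralizer, as the linear span of all
brackets of pairs of elements of `g_e`. -/
noncomputable def derived (e : LieAlgebra.e₆ ℂ) : Submodule ℂ (LieAlgebra.e₆ ℂ) :=
  Submodule.span ℂ
    {z : LieAlgebra.e₆ ℂ | ∃ x ∈ centralizer e, ∃ y ∈ centralizer e, ⁅x, y⁆ = z}

namespace Sl2Module

variable {V : Type*} [AddCommGroup V] [Module ℂ V]
variable {e h f : Module.End ℂ V}

lemma pow_mul_comm (hh : h * e - e * h = 2 * e) (hef : e * f - f * e = h) (i : ℕ) :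
    e ^ (i + 1) * f = f * e ^ (i + 1) + ((i : Module.End ℂ V) + 1) * ((h - i) * e ^ i) := by
  have h1 : e * f = f * e + h := by rw [← hef]; abel
  have h2 : e * h = h * e - 2 * e := by rw [← hh]; abel
  induction i with
  | zero => simp [h1]
  | succ i ih =>
    rw [pow_succ' e (i + 1), mul_assoc, ih, mul_add, ← mul_assoc, h1]
    have hc : ∀ x : Module.End ℂ V, e * ((i : Module.End ℂ V) * x) = i * (e * x) := by
      intro x; rw [← mul_assoc, ← mul_assoc, (Nat.cast_commute i e).eq]
    have : e * (((i : Module.End ℂ V) + 1) * ((h - i) * e ^ i))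
        = ((i : Module.End ℂ V) + 1) * ((h - (i + 2)) * e ^ (i + 1)) := by
      have h3 : e * ((h - i) * e ^ i) = (h - (i + 2)) * e ^ (i + 1) := by
        rw [← mul_assoc, mul_sub, h2, ← (Nat.cast_commute i e).eq, pow_succ' e i, ← mul_assoc]
        congr 1; noncomm_ring
      rw [add_mul, mul_add, hc, one_mul, h3, add_mul, one_mul]
    rw [this]
    push_cast
    have hp : e * e ^ (i + 1) = e ^ (i + 2) := (pow_succ' e (i + 1)).symm
    have hp2 : (f * e + h) * e ^ (i + 1) = f * e ^ (i + 2) + h * e ^ (i + 1) := by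
      rw [add_mul, mul_assoc, hp]
    rw [hp2, add_assoc, hp]
    congr 1
    generalize e ^ (i + 1) = x
    rw [← mul_assoc, ← mul_assoc, ← add_mul]
    congr 1
    noncomm_ring

lemma h_e_apply (hh : h * e - e * h = 2 * e) (v : V) : e (h v) = h (e v) - (2 : ℂ) • e v := by
  have := LinearMap.congr_fun hh v
  simp only [LinearMap.sub_apply, Module.End.mul_apply] at this
  have h2 : ((2 : Module.End ℂ V)) (e v) = (2 : ℂ) • e v := by
    rw [two_smul]; exact LinearMap.congr_fun (one_add_one_eq_two (R := Module.End ℂ V)).symm (e v)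
  rw [h2] at this
  rw [← this]; abel

/-- Weights on `ker e ∩ im e^j` are integers at least `j`. -/
lemma mem_iSup_of_mem_ker (hh : h * e - e * h = 2 * e) (hef : e * f - f * e = h)
    {N : ℕ} (hN : e ^ N = 0) (j : ℕ) {v : V} (hv : e v = 0) (hr : v ∈ LinearMap.range (e ^ j)) :
    v ∈ ⨆ k : {k : ℕ // j ≤ k}, (h.eigenspace ((k : ℕ) : ℂ) ⊓ LinearMap.ker e) := by
  induction hd : N - j generalizing j v with
  | zero =>
    obtain ⟨w, rfl⟩ := hr
    have : e ^ j = 0 := pow_eq_zero_of_le (by omega) hN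
    simp [this]
  | succ d ih =>
    obtain ⟨w, rfl⟩ := hr
    set v := (e ^ j) w with hvdef
    have key : ((j : ℂ) + 1) • (h v - (j : ℂ) • v) = (e ^ (j + 1)) (f w) := by
      have := LinearMap.congr_fun (pow_mul_comm hh hef j) w
      have h1 : (e ^ (j + 1)) w = 0 := by rw [pow_succ']; exact hv
      simp only [Module.End.mul_apply, LinearMap.add_apply, LinearMap.sub_apply, h1, map_zero,
        zero_add, ← hvdef] at this
      rw [this]
      simp [Module.End.natCast_apply, add_smul, Nat.cast_smul_eq_nsmul]
    have hj : ((j : ℂ) + 1) ≠ 0 := by exact_mod_cast Nat.succ_ne_zero j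
    have hu : h v - (j : ℂ) • v ∈ LinearMap.range (e ^ (j + 1)) := by
      refine ⟨((j : ℂ) + 1)⁻¹ • f w, ?_⟩
      rw [map_smul, ← key, smul_smul, inv_mul_cancel₀ hj, one_smul]
    have hu0 : e (h v - (j : ℂ) • v) = 0 := by
      rw [map_sub, map_smul, h_e_apply hh, hv]; simp
    have hmem := ih (j + 1) hu0 hu (by omega)
    have hex : ∃ v' ∈ ⨆ k : {k : ℕ // j ≤ k}, (h.eigenspace ((k : ℕ) : ℂ) ⊓ LinearMap.ker e),
        e v' = 0 ∧ h v' - (j : ℂ) • v' = h v - (j : ℂ) • v := by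
      refine Submodule.iSup_induction (motive := fun u => ∃ v' ∈ ⨆ k : {k : ℕ // j ≤ k},
        (h.eigenspace ((k : ℕ) : ℂ) ⊓ LinearMap.ker e), e v' = 0 ∧ h v' - (j : ℂ) • v' = u) _ hmem
        ?_ ?_ ?_
      · rintro ⟨k, hk⟩ x ⟨hx1, hx2⟩
        have hx1' : h x = (k : ℂ) • x := Module.End.mem_eigenspace_iff.mp hx1
        have hne : ((k : ℂ) - j) ≠ 0 := by
          rw [sub_ne_zero]; intro hc; have : k = j := by exact_mod_cast hc
          omega
        refine ⟨((k : ℂ) - j)⁻¹ • x, ?_, ?_, ?_⟩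
        · exact Submodule.smul_mem _ _ (Submodule.mem_iSup_of_mem
            (⟨k, by omega⟩ : {k : ℕ // j ≤ k}) ⟨hx1, hx2⟩)
        · rw [map_smul, LinearMap.mem_ker.mp hx2, smul_zero]
        · rw [map_smul, hx1', smul_comm (j : ℂ), ← smul_sub, ← sub_smul, smul_smul,
            inv_mul_cancel₀ hne, one_smul]
      · exact ⟨0, Submodule.zero_mem _, by simp, by simp⟩
      · rintro x y ⟨a, ha, ha0, ha'⟩ ⟨b, hb, hb0, hb'⟩
        refine ⟨a + b, Submodule.add_mem _ ha hb, by simp [ha0, hb0], ?_⟩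
        rw [← ha', ← hb', map_add, smul_add]; abel
    obtain ⟨v', hv', hv0, heq⟩ := hex
    have : v = v' + (v - v') := by abel
    rw [this]
    refine Submodule.add_mem _ hv' (Submodule.mem_iSup_of_mem (⟨j, le_rfl⟩ : {k : ℕ // j ≤ k}) ?_)
    refine ⟨Module.End.mem_eigenspace_iff.mpr ?_, ?_⟩
    · rw [map_sub, smul_sub, sub_eq_sub_iff_sub_eq_sub, heq]
    · exact LinearMap.mem_ker.mpr (by rw [map_sub, hv, hv0, sub_zero])

lemma ker_le_iSup (hh : h * e - e * h = 2 * e) (hef : e * f - f * e = h) (he : IsNilpotent e) :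
    LinearMap.ker e ≤ ⨆ k : ℕ, h.eigenspace (k : ℂ) := by
  obtain ⟨N, hN⟩ := he
  intro v hv
  have := mem_iSup_of_mem_ker hh hef hN 0 hv (by simp)
  refine (iSup_le fun k => ?_ : (_ : Submodule ℂ V) ≤ _) this
  exact inf_le_left.trans (le_iSup (fun k : ℕ => h.eigenspace (k : ℂ)) k)

/-- A vector killed by `e` which is an `h`-eigenvector has natural weight. -/
lemma exists_nat_of_ker (hh : h * e - e * h = 2 * e) (hef : e * f - f * e = h)
    (he : IsNilpotent e) {v : V} (hv : e v = 0) (hv0 : v ≠ 0) {μ : ℂ} (hμ : h v = μ • v) :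
    ∃ k : ℕ, μ = k := by
  by_contra! hcon
  have h1 := ker_le_iSup hh hef he hv
  have hd := (Module.End.eigenspaces_iSupIndep h) μ
  refine hv0 (Submodule.disjoint_def.mp hd v (Module.End.mem_eigenspace_iff.mpr hμ) ?_)
  refine (iSup_le fun k => ?_ : (_ : Submodule ℂ V) ≤ _) h1
  exact le_iSup₂_of_le (k : ℂ) (hcon k).symm le_rfl

/-- `h` acts diagonalisably with integer eigenvalues. -/
theorem iSup_eigenspace (hh : h * e - e * h = 2 * e) (hf : h * f - f * h = -(2 * f))
    (hef : e * f - f * e = h) (he : IsNilpotent e) :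
    ⨆ k : ℤ, h.eigenspace (k : ℂ) = ⊤ := by
  obtain ⟨N, hN⟩ := he
  set W := ⨆ k : ℤ, h.eigenspace (k : ℂ) with hW
  have hfE : ∀ (k : ℤ) (v : V), h v = (k : ℂ) • v → ∀ i : ℕ,
      h ((f ^ i) v) = ((k - 2 * i : ℤ) : ℂ) • (f ^ i) v := by
    intro k v hv i
    induction i with
    | zero => simpa using hv
    | succ i ih =>
      have := LinearMap.congr_fun hf ((f ^ i) v)
      have h2 : ((2 : Module.End ℂ V)) (f ((f ^ i) v)) = (2 : ℂ) • f ((f ^ i) v) := by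
        rw [two_smul]
        exact LinearMap.congr_fun (one_add_one_eq_two (R := Module.End ℂ V)).symm _
      simp only [LinearMap.sub_apply, Module.End.mul_apply, LinearMap.neg_apply, h2, ih,
        map_smul] at this
      rw [pow_succ', Module.End.mul_apply, sub_eq_iff_eq_add.mp this, ← neg_smul, ← add_smul]
      congr 1; push_cast; ring
  have hef' : ∀ (k : ℤ) (v : V), h v = (k : ℂ) • v → e v = 0 → ∀ i : ℕ,
      e ((f ^ (i + 1)) v) = (((i + 1) * (k - i) : ℤ) : ℂ) • (f ^ i) v := by
    intro k v hv hv0 i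
    have step : ∀ x, e (f x) = f (e x) + h x := fun x => by
      have := LinearMap.congr_fun hef x
      simp only [LinearMap.sub_apply, Module.End.mul_apply] at this
      rw [← this]; abel
    induction i with
    | zero => simp [step, hv0, hv]
    | succ i ih =>
      rw [pow_succ', Module.End.mul_apply, step, ih, hfE k v hv, map_smul]
      rw [← Module.End.mul_apply, ← pow_succ', ← add_smul]
      congr 1; push_cast; ring
  have hpow : ∀ (k : ℤ) (v : V), h v = (k : ℂ) • v → e v = 0 → ∀ m : ℕ, (m : ℤ) ≤ k →
      ∃ c : ℂ, c ≠ 0 ∧ (e ^ m) ((f ^ m) v) = c • v := by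
    intro k v hv hv0 m
    induction m with
    | zero => intro _; exact ⟨1, one_ne_zero, by simp⟩
    | succ m ih =>
      intro hm
      obtain ⟨c, hc, hc'⟩ := ih (by push_cast at hm; omega)
      refine ⟨(((m + 1) * (k - m) : ℤ) : ℂ) * c, mul_ne_zero ?_ hc, ?_⟩
      · rw [Int.cast_ne_zero]; push_cast at hm
        exact mul_ne_zero (by omega) (by omega)
      · rw [pow_succ e, Module.End.mul_apply, hef' k v hv hv0, map_smul, hc', smul_smul]
  have main : ∀ m : ℕ, ∀ v : V, (e ^ m) v = 0 → v ∈ W := by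
    intro m
    induction m with
    | zero => intro v hv; simp at hv; simp [hv]
    | succ m ih =>
      intro v hv
      have h1 := mem_iSup_of_mem_ker hh hef hN m (v := (e ^ m) v)
        (by rw [← Module.End.mul_apply, ← pow_succ']; exact hv) ⟨v, rfl⟩
      have h2 : (e ^ m) v ∈ W.map (e ^ m) := by
        refine (iSup_le fun k => ?_ : (_ : Submodule ℂ V) ≤ _) h1
        rintro x ⟨hx1, hx2⟩
        have hx1' : h x = (((k : ℕ) : ℤ) : ℂ) • x := by
          simpa using Module.End.mem_eigenspace_iff.mp hx1
        obtain ⟨c, hc, hc'⟩ := hpow _ x hx1' hx2 m (by exact_mod_cast k.2)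
        refine ⟨c⁻¹ • (f ^ m) x, Submodule.smul_mem _ _ ?_, ?_⟩
        · exact Submodule.mem_iSup_of_mem _ (Module.End.mem_eigenspace_iff.mpr (hfE _ x hx1' m))
        · rw [map_smul, hc', smul_smul, inv_mul_cancel₀ hc, one_smul]
      obtain ⟨w, hw, hwe⟩ := h2
      have := ih (v - w) (by rw [map_sub, hwe, sub_self])
      simpa using W.add_mem this hw
  rw [eq_top_iff]
  intro v _
  exact main N v (by simp [hN])

end Sl2Module

section NormedAlgebra

open NormedSpace

attribute [local instance] LieRing.ofAssociativeRing

variable {A : Type*} [NormedRing A] [NormedAlgebra ℂ A] [CompleteSpace A]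

lemma NormedSpace.exp_mul_exp_neg (y : A) : exp y * exp (-y) = 1 := by
  let := NormedAlgebra.restrictScalars ℚ ℂ A
  rw [← exp_add_of_commute (Commute.refl y).neg_right, add_neg_cancel, exp_zero]

lemma NormedSpace.exp_conj_hasSum (y x : A) :
    HasSum (fun k : ℕ => ((k.factorial : ℂ)⁻¹) • ((LieAlgebra.ad ℂ A y) ^ k) x)
      (exp y * x * exp (-y)) := by
  let := NormedAlgebra.restrictScalars ℚ ℂ (A →L[ℂ] A)
  let L : A →L[ℂ] A := ContinuousLinearMap.mul ℂ A y
  let R : A →L[ℂ] A := (ContinuousLinearMap.mul ℂ A).flip (-y)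
  have hE : ∀ (T : A →L[ℂ] A) (z : A),
      HasSum (fun k : ℕ => ((k.factorial : ℂ)⁻¹) • (T ^ k) z) (exp T z) := fun T z =>
    (exp_series_hasSum_exp' (𝕂 := ℂ) T).mapL (ContinuousLinearMap.apply ℂ _ z)
  have hL : ∀ z, exp L z = exp y * z := fun z => by
    have h1 := hE L z
    have h2 := (exp_series_hasSum_exp' (𝕂 := ℂ) y).mul_right z
    have hk : ∀ k : ℕ, (L ^ k) z = y ^ k * z := by
      intro k
      induction k with
      | zero => simp
      | succ k ih => rw [pow_succ', pow_succ', mul_apply_eq_comp, ih, mul_assoc]; rfl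
    simp only [hk] at h1
    simp only [smul_mul_assoc] at h2
    exact h1.unique h2
  have hR : ∀ z, exp R z = z * exp (-y) := fun z => by
    have h1 := hE R z
    have h2 := (exp_series_hasSum_exp' (𝕂 := ℂ) (-y)).mul_left z
    have hk : ∀ k : ℕ, (R ^ k) z = z * (-y) ^ k := by
      intro k
      induction k with
      | zero => simp
      | succ k ih => rw [pow_succ', pow_succ, mul_apply_eq_comp, ih, ← mul_assoc]; rfl
    simp only [hk] at h1
    simp only [mul_smul_comm] at h2
    exact h1.unique h2
  have hc : Commute L R := by
    ext1 z
    simp [L, R, mul_assoc]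
  have h := hE (L + R) x
  have hk : ∀ k : ℕ, ((L + R) ^ k) x = ((LieAlgebra.ad ℂ A y) ^ k) x := by
    intro k
    induction k with
    | zero => simp
    | succ k ih =>
      rw [pow_succ', pow_succ', mul_apply_eq_comp, Module.End.mul_apply, ih]
      simp [L, R, Ring.lie_def, sub_eq_add_neg]
  rw [exp_add_of_commute hc, mul_apply_eq_comp, hL, hR, ← mul_assoc] at h
  simpa only [hk] using h

end NormedAlgebra

namespace MatLie

open NormedSpace Matrix

open scoped Matrix.Norms.L2Operator
attribute [local instance] LieRing.ofAssociativeRing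

variable {n : Type*} [Fintype n] [DecidableEq n]

lemma exp_conj_mem {N : Submodule ℂ (Matrix n n ℂ)} {y : Matrix n n ℂ}
    (hN : ∀ z ∈ N, ⁅y, z⁆ ∈ N) {x : Matrix n n ℂ} (hx : x ∈ N) :
    exp y * x * exp (-y) ∈ N := by
  have hk : ∀ k : ℕ, ((LieAlgebra.ad ℂ (Matrix n n ℂ) y) ^ k) x ∈ N := by
    intro k
    induction k with
    | zero => simpa
    | succ k ih => rw [pow_succ', Module.End.mul_apply]; exact hN _ ih
  exact (Submodule.closed_of_finiteDimensional N).mem_of_tendsto (exp_conj_hasSum y x)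
    (Filter.Eventually.of_forall fun s => N.sum_mem fun k _ => N.smul_mem _ (hk k))

lemma exp_conj_sub_mem {N : Submodule ℂ (Matrix n n ℂ)} {y : Matrix n n ℂ}
    (hN : ∀ z ∈ N, ⁅y, z⁆ ∈ N) {x : Matrix n n ℂ} (hx : ⁅y, ⁅y, x⁆⁆ ∈ N) :
    exp y * x * exp (-y) - (x + ⁅y, x⁆) ∈ N := by
  have hk : ∀ k : ℕ, ((LieAlgebra.ad ℂ (Matrix n n ℂ) y) ^ (k + 2)) x ∈ N := by
    intro k
    induction k with
    | zero => simpa [pow_succ]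
    | succ k ih =>
      rw [show k + 1 + 2 = k + 2 + 1 by ring, pow_succ', Module.End.mul_apply]; exact hN _ ih
  have h := (hasSum_nat_add_iff' 2).mpr (exp_conj_hasSum y x)
  simp only [Finset.sum_range_succ, Finset.sum_range_zero, zero_add, Nat.factorial_zero,
    Nat.cast_one, inv_one, pow_zero, Module.End.one_apply, one_smul, Nat.factorial_one,
    pow_one, LieAlgebra.ad_apply] at h
  exact (Submodule.closed_of_finiteDimensional N).mem_of_tendsto h
    (Filter.Eventually.of_forall fun s => N.sum_mem fun k _ => N.smul_mem _ (hk k))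

/-- `exp y` as a unit. -/
noncomputable def expUnit (y : Matrix n n ℂ) : (Matrix n n ℂ)ˣ where
  val := exp y
  inv := exp (-y)
  val_inv := exp_mul_exp_neg y
  inv_val := by simpa using exp_mul_exp_neg (-y)

variable (g : LieSubalgebra ℂ (Matrix n n ℂ))

/-- Invertible matrices normalising `g`. -/
def autGroup : Subgroup (Matrix n n ℂ)ˣ where
  carrier := {u | ∀ x, (u : Matrix n n ℂ) * x * (↑u⁻¹ : Matrix n n ℂ) ∈ g ↔ x ∈ g}
  mul_mem' := by
    intro u v hu hv x
    have := hu (v * x * (↑v⁻¹ : Matrix n n ℂ))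
    rw [hv] at this
    rw [← this]
    simp [mul_assoc]
  one_mem' := by intro x; simp
  inv_mem' := by
    intro u hu x
    have := hu ((↑u⁻¹ : Matrix n n ℂ) * x * u)
    rw [inv_inv, ← this]
    simp [mul_assoc]

variable {g}

lemma expUnit_mem {y : Matrix n n ℂ} (hy : y ∈ g) : expUnit y ∈ autGroup g := by
  intro x
  constructor
  · intro h
    have h1 : exp (-y) * (exp y * x * exp (-y)) * exp (- -y) ∈ g.toSubmodule :=
      exp_conj_mem (N := g.toSubmodule) (fun z hz => g.lie_mem (g.neg_mem hy) hz) h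
    have h2 : exp (-y) * exp y = 1 := (expUnit y).inv_val
    rw [neg_neg] at h1
    have h3 : exp (-y) * (exp y * x * exp (-y)) * exp y = x := by
      calc _ = (exp (-y) * exp y) * x * (exp (-y) * exp y) := by simp only [mul_assoc]
        _ = x := by rw [h2, one_mul, mul_one]
    rwa [h3] at h1
  · intro h
    exact exp_conj_mem (N := g.toSubmodule) (fun z hz => g.lie_mem hy hz) h

/-- Conjugation by a unit. -/
def cj (u : (Matrix n n ℂ)ˣ) (x : Matrix n n ℂ) : Matrix n n ℂ := u * x * (↑u⁻¹ : Matrix n n ℂ)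

lemma cj_mem {u : (Matrix n n ℂ)ˣ} (hu : u ∈ autGroup g) {x : Matrix n n ℂ} :
    cj u x ∈ g ↔ x ∈ g := hu x

lemma cj_mul_cj (u v : (Matrix n n ℂ)ˣ) (x : Matrix n n ℂ) : cj (u * v) x = cj u (cj v x) := by
  simp [cj, mul_assoc]

@[simp] lemma cj_one (x : Matrix n n ℂ) : cj 1 x = x := by simp [cj]

@[simp] lemma cj_inv_cj (u : (Matrix n n ℂ)ˣ) (x : Matrix n n ℂ) : cj u⁻¹ (cj u x) = x := by
  rw [← cj_mul_cj]; simp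

@[simp] lemma cj_cj_inv (u : (Matrix n n ℂ)ˣ) (x : Matrix n n ℂ) : cj u (cj u⁻¹ x) = x := by
  rw [← cj_mul_cj]; simp

lemma cj_mul (u : (Matrix n n ℂ)ˣ) (x y : Matrix n n ℂ) : cj u (x * y) = cj u x * cj u y := by
  simp [cj, mul_assoc]

@[simp] lemma cj_one_right (u : (Matrix n n ℂ)ˣ) : cj u 1 = 1 := by simp [cj]

lemma cj_add (u : (Matrix n n ℂ)ˣ) (x y : Matrix n n ℂ) : cj u (x + y) = cj u x + cj u y := by
  simp [cj, mul_add, add_mul]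

lemma cj_sub (u : (Matrix n n ℂ)ˣ) (x y : Matrix n n ℂ) : cj u (x - y) = cj u x - cj u y := by
  simp [cj, mul_sub, sub_mul]

lemma cj_smul (u : (Matrix n n ℂ)ˣ) (a : ℂ) (x : Matrix n n ℂ) : cj u (a • x) = a • cj u x := by
  simp [cj]

@[simp] lemma cj_zero (u : (Matrix n n ℂ)ˣ) : cj u 0 = 0 := by simp [cj]

lemma cj_lie (u : (Matrix n n ℂ)ˣ) (x y : Matrix n n ℂ) : cj u ⁅x, y⁆ = ⁅cj u x, cj u y⁆ := by
  simp only [Ring.lie_def, cj_sub, cj_mul]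

lemma cj_pow (u : (Matrix n n ℂ)ˣ) (x : Matrix n n ℂ) (k : ℕ) : cj u (x ^ k) = cj u x ^ k := by
  induction k with
  | zero => simp
  | succ k ih => rw [pow_succ, cj_mul, ih, pow_succ]

end MatLie

namespace MatLie

open Matrix

attribute [local instance] LieRing.ofAssociativeRing

/-- If `a` is nilpotent and `[a, [a, b]] = 0`, then `ab` is nilpotent. -/
lemma isNilpotent_mul_of_lie_lie {A : Type*} [Ring A] [Algebra ℚ A] {a b : A} (ha : IsNilpotent a)
    (h : a * (a * b - b * a) = (a * b - b * a) * a) : IsNilpotent (a * b) := by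
  obtain ⟨N, hN⟩ := ha
  set c := a * b - b * a with hc
  have hac : Commute a c := h
  have hab : ∀ i : ℕ, a ^ (i + 1) * b = b * a ^ (i + 1) + (i + 1 : ℕ) • (c * a ^ i) := by
    intro i
    induction i with
    | zero => simp [hc]
    | succ i ih =>
      have h1 : a * b = b * a + c := by rw [hc]; abel
      rw [pow_succ' a (i + 1), mul_assoc, ih, mul_add, ← mul_assoc, h1, add_mul, mul_smul_comm,
        ← mul_assoc a c, hac.eq, mul_assoc c a, ← pow_succ', mul_assoc b a, add_assoc,
        succ_nsmul (c * a ^ (i + 1)) (i + 1), add_comm (_ • _)]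
  have hcn : ∀ j m : ℕ, a ^ j * c ^ m = 0 → IsNilpotent c := by
    intro j
    induction j with
    | zero => intro m hm; exact ⟨m, by simpa using hm⟩
    | succ j ih =>
      intro m hm
      refine ih (2 * m + 1) ?_
      have hm' : c ^ m * a ^ (j + 1) = 0 := by rw [← (hac.pow_pow (j + 1) m).eq]; exact hm
      have h1 : c ^ m * (a ^ (j + 1) * b) * c ^ m = 0 := by
        rw [← mul_assoc, hm', zero_mul, zero_mul]
      rw [hab, mul_add, add_mul, mul_assoc (c ^ m), mul_assoc b, hm, mul_zero, mul_zero, zero_add,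
        mul_smul_comm, smul_mul_assoc] at h1
      have h2 : c ^ m * (c * a ^ j) * c ^ m = a ^ j * c ^ (2 * m + 1) := by
        rw [← mul_assoc, ← pow_succ, ← (hac.pow_pow j (m + 1)).eq, mul_assoc, ← pow_add]
        congr 2; ring
      rw [h2] at h1
      have hq : ((j + 1 : ℕ) : ℚ) • (a ^ j * c ^ (2 * m + 1)) = 0 := by
        rw [Nat.cast_smul_eq_nsmul]; exact h1
      rcases smul_eq_zero.mp hq with h0 | h0
      · exact absurd h0 (by positivity)
      · exact h0
  obtain ⟨m, hm⟩ := hcn N 0 (by simp [hN])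
  have hstep : ∀ (i : ℕ) (x : A), a ^ (i + 1) * x = 0 → a ^ (i + 1) * (a * b * x) = 0 ∧
      a ^ i * (a * b * x) = (i + 1 : ℕ) • (c * (a ^ i * x)) := by
    intro i x hx
    have h2 : a ^ i * (a * b * x) = (i + 1 : ℕ) • (c * (a ^ i * x)) := by
      rw [← mul_assoc, ← mul_assoc, ← pow_succ, hab, add_mul, mul_assoc, hx, mul_zero, zero_add,
        smul_mul_assoc, mul_assoc]
    refine ⟨?_, h2⟩
    rw [pow_succ', mul_assoc, h2, mul_smul_comm, ← mul_assoc, hac.eq, mul_assoc, ← mul_assoc a,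
      ← pow_succ', hx, mul_zero, smul_zero]
  have hstep' : ∀ (i : ℕ) (x : A), a ^ (i + 1) * x = 0 → ∀ k : ℕ,
      a ^ (i + 1) * ((a * b) ^ k * x) = 0 ∧
      a ^ i * ((a * b) ^ k * x) = ((i + 1 : ℕ) ^ k) • (c ^ k * (a ^ i * x)) := by
    intro i x hx k
    induction k with
    | zero => simpa using hx
    | succ k ih =>
      have h3 := hstep i _ ih.1
      rw [pow_succ' (a * b), mul_assoc (a * b)]
      refine ⟨h3.1, ?_⟩
      rw [h3.2, ih.2, mul_smul_comm, smul_smul, ← mul_assoc, ← pow_succ', ← pow_succ']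
  have hfin : ∀ (i : ℕ) (x : A), a ^ i * x = 0 → ∃ k : ℕ, (a * b) ^ k * x = 0 := by
    intro i
    induction i with
    | zero => intro x hx; exact ⟨0, by simpa using hx⟩
    | succ i ih =>
      intro x hx
      obtain ⟨k, hk⟩ := ih ((a * b) ^ m * x) (by rw [(hstep' i x hx m).2, hm, zero_mul, smul_zero])
      exact ⟨k + m, by rw [pow_add, mul_assoc]; exact hk⟩
  obtain ⟨k, hk⟩ := hfin N 1 (by simp [hN])
  exact ⟨k, by simpa using hk⟩

variable {n : Type*} [Fintype n] [DecidableEq n] {g : LieSubalgebra ℂ (Matrix n n ℂ)}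

lemma eq_zero_of_trace {g : LieSubalgebra ℂ (Matrix n n ℂ)} (hs : ∀ x ∈ g, xᴴ ∈ g)
    {x : Matrix n n ℂ} (hx : x ∈ g) (h : ∀ y ∈ g, (x * y).trace = 0) : x = 0 := by
  open ComplexOrder in
  exact trace_mul_conjTranspose_self_eq_zero_iff.mp (h _ (hs x hx))

/-- Range criterion through the trace form. -/
lemma mem_range_of_trace (hs : ∀ x ∈ g, xᴴ ∈ g) (T T' : Matrix n n ℂ →ₗ[ℂ] Matrix n n ℂ)
    (hT : ∀ x ∈ g, T x ∈ g) (hT' : ∀ x ∈ g, T' x ∈ g)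
    (hadj : ∀ x y, (T x * y).trace = (x * T' y).trace) {z : Matrix n n ℂ} (hz : z ∈ g)
    (h : ∀ w ∈ g, T' w = 0 → (z * w).trace = 0) : ∃ x ∈ g, T x = z := by
  let B : g →ₗ[ℂ] Module.Dual ℂ g :=
    LinearMap.mk₂ ℂ (fun x y : g => ((x : Matrix n n ℂ) * y).trace)
      (by intros; simp [add_mul]) (by intros; simp) (by intros; simp [mul_add]) (by intros; simp)
  have hB : ∀ x y : g, B x y = ((x : Matrix n n ℂ) * y).trace := fun _ _ => rfl
  have hinj : Function.Injective B := by
    rw [injective_iff_map_eq_zero]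
    intro x hx
    refine Subtype.ext (eq_zero_of_trace hs x.2 fun y hy => ?_)
    exact LinearMap.congr_fun hx ⟨y, hy⟩
  have hsurj : Function.Surjective B :=
    (LinearMap.injective_iff_surjective_of_finrank_eq_finrank
      (Subspace.dual_finrank_eq (K := ℂ) (V := g)).symm).mp hinj
  let Tg : g →ₗ[ℂ] g := (T.domRestrict g.toSubmodule).codRestrict g.toSubmodule
    fun x => hT x x.2
  by_contra hcon
  have hnot : (⟨z, hz⟩ : g) ∉ LinearMap.range Tg := by
    rintro ⟨x, hx⟩
    exact hcon ⟨x, x.2, congrArg Subtype.val hx⟩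
  obtain ⟨φ, hφ, hle⟩ := Submodule.exists_le_ker_of_notMem hnot
  obtain ⟨w, rfl⟩ := hsurj φ
  refine hφ ?_
  rw [hB, trace_mul_comm]
  refine h w w.2 (eq_zero_of_trace hs (hT' _ w.2) fun y hy => ?_)
  have := LinearMap.mem_ker.mp (hle ⟨⟨y, hy⟩, rfl⟩)
  rw [hB, trace_mul_comm] at this
  rw [trace_mul_comm, ← hadj]
  exact this

lemma trace_lie_mul (e x y : Matrix n n ℂ) : (⁅e, x⁆ * y).trace = -(x * ⁅e, y⁆).trace := by
  simp only [Ring.lie_def, sub_mul, mul_sub, trace_sub, ← mul_assoc]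
  rw [trace_mul_comm (e * x) y, ← mul_assoc, trace_mul_comm (y * e) x, ← mul_assoc]
  ring

/-- The image of `ad e` is the orthogonal of its kernel. -/
lemma mem_range_ad (hs : ∀ x ∈ g, xᴴ ∈ g) {e z : Matrix n n ℂ} (he : e ∈ g) (hz : z ∈ g)
    (h : ∀ w ∈ g, ⁅e, w⁆ = 0 → (z * w).trace = 0) : ∃ x ∈ g, ⁅e, x⁆ = z := by
  refine mem_range_of_trace hs (LieAlgebra.ad ℂ (Matrix n n ℂ) e)
    (-(LieAlgebra.ad ℂ (Matrix n n ℂ) e)) (fun x hx => g.lie_mem he hx)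
    (fun x hx => g.neg_mem (g.lie_mem he hx)) ?_ hz ?_
  · intro x y
    rw [LieAlgebra.ad_apply, trace_lie_mul, LinearMap.neg_apply, LieAlgebra.ad_apply, mul_neg,
      trace_neg]
  · intro w hw hw0
    exact h w hw (neg_eq_zero.mp hw0)

/-- A triple `(e, h, f)` satisfying the `sl₂` relations inside `g`. -/
structure Triple (g : LieSubalgebra ℂ (Matrix n n ℂ)) (e h f : Matrix n n ℂ) : Prop where
  e_mem : e ∈ g
  h_mem : h ∈ g
  f_mem : f ∈ g
  nil : IsNilpotent e
  lie_he : ⁅h, e⁆ = (2 : ℂ) • e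
  lie_hf : ⁅h, f⁆ = -((2 : ℂ) • f)
  lie_ef : ⁅e, f⁆ = h

lemma two_mul_end {V : Type*} [AddCommGroup V] [Module ℂ V] (x : Module.End ℂ V) :
    2 * x = (2 : ℂ) • x := by
  rw [two_mul, two_smul]

lemma ad_nil {e : Matrix n n ℂ} (he : e ∈ g) (hnil : IsNilpotent e) :
    IsNilpotent (LieAlgebra.ad ℂ g ⟨e, he⟩) :=
  LieAlgebra.isNilpotent_ad_of_isNilpotent (L := g) (x := ⟨e, he⟩) hnil

theorem exists_triple (hs : ∀ x ∈ g, xᴴ ∈ g) {e : Matrix n n ℂ} (he : e ∈ g)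
    (hnil : IsNilpotent e) : ∃ h f, Triple g e h f := by
  have h1 : ∃ y ∈ g, ((LieAlgebra.ad ℂ (Matrix n n ℂ) e) * (LieAlgebra.ad ℂ _ e)) y = e := by
    refine mem_range_of_trace hs _ ((LieAlgebra.ad ℂ (Matrix n n ℂ) e) * (LieAlgebra.ad ℂ _ e))
      (fun x hx => g.lie_mem he (g.lie_mem he hx)) (fun x hx => g.lie_mem he (g.lie_mem he hx))
      ?_ he ?_
    · intro x y
      simp [trace_lie_mul]
    · intro w hw hw0
      refine (Matrix.isNilpotent_trace_of_isNilpotent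
        (isNilpotent_mul_of_lie_lie hnil ?_)).eq_zero
      have : ⁅e, ⁅e, w⁆⁆ = 0 := hw0
      rwa [Ring.lie_def e ⁅e, w⁆, Ring.lie_def e w, sub_eq_zero] at this
  obtain ⟨y, hy, hye⟩ := h1
  have hye' : ⁅e, ⁅e, y⁆⁆ = e := hye
  obtain ⟨h, hh⟩ : ∃ h, h = (-2 : ℂ) • ⁅e, y⁆ := ⟨_, rfl⟩
  have hhg : h ∈ g := hh ▸ g.smul_mem _ (g.lie_mem he hy)
  have hhe : ⁅h, e⁆ = (2 : ℂ) • e := by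
    rw [hh, smul_lie, ← lie_skew, hye', smul_neg, neg_smul, neg_neg]
  obtain ⟨f₁, hf₁⟩ : ∃ f₁, f₁ = (-2 : ℂ) • y := ⟨_, rfl⟩
  have hf₁g : f₁ ∈ g := hf₁ ▸ g.smul_mem _ hy
  have hef₁ : ⁅e, f₁⁆ = h := by rw [hf₁, lie_smul, hh]
  set E : Module.End ℂ g := LieAlgebra.ad ℂ g ⟨e, he⟩
  set H : Module.End ℂ g := LieAlgebra.ad ℂ g ⟨h, hhg⟩
  set F : Module.End ℂ g := LieAlgebra.ad ℂ g ⟨f₁, hf₁g⟩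
  have r1 : H * E - E * H = 2 * E := by
    have : ⁅H, E⁆ = (2 : ℂ) • E := by
      rw [← LieHom.map_lie, ← map_smul]
      congr 1
      exact Subtype.ext hhe
    rw [two_mul_end, ← this]; rfl
  have r2 : E * F - F * E = H := by
    have : ⁅E, F⁆ = H := by
      rw [← LieHom.map_lie]
      congr 1
      exact Subtype.ext hef₁
    rw [← this]; rfl
  have hEn : IsNilpotent E := ad_nil he hnil
  -- correct `f₁` by an element of the centraliser
  have hw : ⁅e, ⁅h, f₁⁆ + (2 : ℂ) • f₁⁆ = 0 := by
    rw [lie_add, lie_smul, leibniz_lie, hef₁, lie_self, add_zero, ← lie_skew e h, hhe, neg_lie,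
      smul_lie, hef₁, neg_add_cancel]
  have hsub := Sl2Module.mem_iSup_of_mem_ker (h := H) r1 r2 hEn.choose_spec 0
    (v := ⟨⁅h, f₁⁆ + (2 : ℂ) • f₁, g.add_mem (g.lie_mem hhg hf₁g) (g.smul_mem _ hf₁g)⟩)
    (Subtype.ext hw) (by simp)
  have hex : ∃ w : g, E w = 0 ∧ H w + (2 : ℂ) • w =
      ⟨⁅h, f₁⁆ + (2 : ℂ) • f₁, g.add_mem (g.lie_mem hhg hf₁g) (g.smul_mem _ hf₁g)⟩ := by
    refine Submodule.iSup_induction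
      (motive := fun u => ∃ w : g, E w = 0 ∧ H w + (2 : ℂ) • w = u) _ hsub ?_ ?_ ?_
    · rintro ⟨k, hk⟩ x ⟨hx1, hx2⟩
      have hx1' : H x = (k : ℂ) • x := Module.End.mem_eigenspace_iff.mp hx1
      have hne : (k : ℂ) + 2 ≠ 0 := by exact_mod_cast (by omega : k + 2 ≠ 0)
      refine ⟨((k : ℂ) + 2)⁻¹ • x, ?_, ?_⟩
      · rw [map_smul, LinearMap.mem_ker.mp hx2, smul_zero]
      · rw [map_smul, hx1', smul_comm (2 : ℂ), ← smul_add, ← add_smul, smul_smul,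
          inv_mul_cancel₀ hne, one_smul]
    · exact ⟨0, by simp, by simp⟩
    · rintro x y ⟨a, ha, ha'⟩ ⟨b, hb, hb'⟩
      refine ⟨a + b, by simp [ha, hb], ?_⟩
      rw [← ha', ← hb', map_add, smul_add]; abel
  obtain ⟨w, hw0, hw1⟩ := hex
  have hw0' : ⁅e, (w : Matrix n n ℂ)⁆ = 0 := congrArg Subtype.val hw0
  have hw1' : ⁅h, (w : Matrix n n ℂ)⁆ + (2 : ℂ) • (w : Matrix n n ℂ) = ⁅h, f₁⁆ + (2 : ℂ) • f₁ :=
    congrArg Subtype.val hw1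
  refine ⟨h, f₁ - w, he, hhg, g.sub_mem hf₁g w.2, hnil, hhe, ?_, ?_⟩
  · rw [lie_sub, smul_sub, neg_sub, sub_eq_sub_iff_add_eq_add, ← hw1']; abel
  · rw [lie_sub, hef₁, hw0', sub_zero]

end MatLie

namespace MatLie

open Matrix NormedSpace

attribute [local instance] LieRing.ofAssociativeRing

variable {n : Type*} [Fintype n] [DecidableEq n]

section Grading

/-- The `k`-eigenspace of `ad h` in `g`. -/
def gr (g : LieSubalgebra ℂ (Matrix n n ℂ)) (h : Matrix n n ℂ) (k : ℤ) :
    Submodule ℂ (Matrix n n ℂ) where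
  carrier := {x | x ∈ g ∧ ⁅h, x⁆ = (k : ℂ) • x}
  add_mem' := fun hx hy => ⟨g.add_mem hx.1 hy.1, by rw [lie_add, hx.2, hy.2, smul_add]⟩
  zero_mem' := ⟨g.zero_mem, by simp⟩
  smul_mem' := fun c x hx => ⟨g.smul_mem c hx.1, by rw [lie_smul, hx.2, smul_comm]⟩

/-- The sum of the `ad h`-eigenspaces with eigenvalue satisfying `P`. -/
def grSum (g : LieSubalgebra ℂ (Matrix n n ℂ)) (h : Matrix n n ℂ) (P : ℤ → Prop) :
    Submodule ℂ (Matrix n n ℂ) :=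
  ⨆ k : {k : ℤ // P k}, gr g h k

variable {g : LieSubalgebra ℂ (Matrix n n ℂ)} {e h f : Matrix n n ℂ}

lemma gr_le_grSum {P : ℤ → Prop} {k : ℤ} (hk : P k) : gr g h k ≤ grSum g h P :=
  le_iSup (fun k : {k : ℤ // P k} => gr g h k) ⟨k, hk⟩

lemma grSum_le_iff {P : ℤ → Prop} {N : Submodule ℂ (Matrix n n ℂ)} :
    grSum g h P ≤ N ↔ ∀ k, P k → gr g h k ≤ N := by
  simp [grSum]

lemma grSum_mono {P Q : ℤ → Prop} (hPQ : ∀ k, P k → Q k) : grSum g h P ≤ grSum g h Q :=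
  grSum_le_iff.mpr fun k hk => gr_le_grSum (hPQ k hk)

lemma grSum_le (P : ℤ → Prop) : grSum g h P ≤ g.toSubmodule :=
  grSum_le_iff.mpr fun _ _ _ hx => hx.1

lemma lie_mem_gr {k l : ℤ} {x y : Matrix n n ℂ} (hx : x ∈ gr g h k) (hy : y ∈ gr g h l) :
    ⁅x, y⁆ ∈ gr g h (k + l) := by
  refine ⟨g.lie_mem hx.1 hy.1, ?_⟩
  rw [leibniz_lie, hx.2, hy.2, smul_lie, lie_smul, ← add_smul]
  push_cast; rfl

lemma lie_mem_grSum {P Q R : ℤ → Prop} (hPQ : ∀ k l, P k → Q l → R (k + l))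
    {x y : Matrix n n ℂ} (hx : x ∈ grSum g h P) (hy : y ∈ grSum g h Q) : ⁅x, y⁆ ∈ grSum g h R := by
  have h1 : ∀ k, P k → ∀ x ∈ gr g h k, ⁅x, y⁆ ∈ grSum g h R := by
    intro k hk x hx
    have : grSum g h Q ≤ (grSum g h R).comap (LieAlgebra.ad ℂ (Matrix n n ℂ) x) :=
      grSum_le_iff.mpr fun l hl z hz => gr_le_grSum (hPQ k l hk hl) (lie_mem_gr hx hz)
    exact this hy
  have h2 : grSum g h P ≤ (grSum g h R).comap (LieAlgebra.ad ℂ (Matrix n n ℂ) y) :=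
    grSum_le_iff.mpr fun k hk z hz => by
      rw [Submodule.mem_comap, LieAlgebra.ad_apply, ← lie_skew]
      exact Submodule.neg_mem _ (h1 k hk z hz)
  have := h2 hx
  rw [Submodule.mem_comap, LieAlgebra.ad_apply, ← lie_skew] at this
  exact (Submodule.neg_mem_iff _).mp this

lemma lie_h_mem {P : ℤ → Prop} {x : Matrix n n ℂ} (hx : x ∈ grSum g h P) :
    ⁅h, x⁆ ∈ grSum g h (fun k => P k ∧ k ≠ 0) := by
  have : grSum g h P ≤ (grSum g h (fun k => P k ∧ k ≠ 0)).comap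
      (LieAlgebra.ad ℂ (Matrix n n ℂ) h) := grSum_le_iff.mpr fun k hk z hz => by
    rw [Submodule.mem_comap, LieAlgebra.ad_apply, hz.2]
    by_cases h0 : k = 0
    · simp [h0]
    · exact Submodule.smul_mem _ _ (gr_le_grSum (P := fun k => P k ∧ k ≠ 0) ⟨hk, h0⟩ hz)
  exact this hx

lemma trace_gr {k l : ℤ} (hkl : k + l ≠ 0) {x y : Matrix n n ℂ} (hx : x ∈ gr g h k)
    (hy : y ∈ gr g h l) : (x * y).trace = 0 := by
  have h1 := trace_lie_mul h x y
  rw [hx.2, hy.2, smul_mul_assoc, mul_smul_comm, trace_smul, trace_smul, smul_eq_mul,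
    smul_eq_mul, eq_neg_iff_add_eq_zero, ← add_mul] at h1
  exact (mul_eq_zero.mp h1).resolve_left (by exact_mod_cast hkl)

lemma trace_grSum {P Q : ℤ → Prop} (hPQ : ∀ k l, P k → Q l → k + l ≠ 0) {x y : Matrix n n ℂ}
    (hx : x ∈ grSum g h P) (hy : y ∈ grSum g h Q) : (x * y).trace = 0 := by
  have h1 : ∀ k, P k → ∀ x ∈ gr g h k, (x * y).trace = 0 := by
    intro k hk x hx
    have : grSum g h Q ≤ LinearMap.ker
        (traceLinearMap n ℂ ℂ ∘ₗ LinearMap.mulLeft ℂ x) :=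
      grSum_le_iff.mpr fun l hl z hz => trace_gr (hPQ k l hk hl) hx hz
    exact this hy
  have h2 : grSum g h P ≤ LinearMap.ker (traceLinearMap n ℂ ℂ ∘ₗ LinearMap.mulRight ℂ y) :=
    grSum_le_iff.mpr fun k hk z hz => h1 k hk z hz
  exact h2 hx

lemma exists_add_of_mem_grSum {P Q R : ℤ → Prop} (hPQR : ∀ k, P k → Q k ∨ R k)
    {x : Matrix n n ℂ} (hx : x ∈ grSum g h P) :
    ∃ a ∈ grSum g h Q, ∃ b ∈ grSum g h R, a + b = x := by
  rw [← Submodule.mem_sup]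
  refine (grSum_le_iff.mpr fun k hk => ?_ : grSum g h P ≤ _) hx
  rcases hPQR k hk with hk | hk
  · exact (gr_le_grSum hk).trans le_sup_left
  · exact (gr_le_grSum hk).trans le_sup_right

lemma grSum_eq (k : ℤ) : grSum g h (fun l => l = k) = gr g h k :=
  le_antisymm (grSum_le_iff.mpr fun _ hl => hl ▸ le_rfl) (gr_le_grSum (P := fun l => l = k) rfl)

lemma gr_eq_bot (g : LieSubalgebra ℂ (Matrix n n ℂ)) (h : Matrix n n ℂ) :
    ∃ N : ℕ, ∀ k : ℤ, N < |k| → gr g h k = ⊥ := by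
  have hfin := Module.End.finite_hasEigenvalue (LieAlgebra.ad ℂ (Matrix n n ℂ) h)
  obtain ⟨r, hr⟩ := hfin.isBounded.exists_norm_le
  obtain ⟨N, hN⟩ := exists_nat_ge r
  refine ⟨N, fun k hk => (Submodule.eq_bot_iff _).mpr fun x hx => ?_⟩
  by_contra hx0
  have := hr (k : ℂ) (Module.End.hasEigenvalue_of_hasEigenvector
    (Module.End.hasEigenvector_iff.mpr ⟨Module.End.mem_eigenspace_iff.mpr hx.2, hx0⟩))
  rw [Complex.norm_intCast] at this
  have h2 : ((|k| : ℤ) : ℝ) ≤ N := by push_cast; linarith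
  have h3 : |k| ≤ (N : ℤ) := by exact_mod_cast h2
  omega

/-- Adding strictly positive terms to `h` does not change its conjugacy class. -/
lemma exists_conj_eq {m : ℕ} (hm : 0 < m) {z : Matrix n n ℂ}
    (hz : z ∈ grSum g h (fun k => (m : ℤ) ≤ k)) : ∃ u ∈ autGroup g, cj u (h + z) = h := by
  obtain ⟨N, hN⟩ := gr_eq_bot g h
  induction hd : N + 1 - m generalizing m z with
  | zero =>
    have : grSum g h (fun k => (m : ℤ) ≤ k) ≤ ⊥ := grSum_le_iff.mpr fun k hk =>
      (hN k (by have := le_abs_self k; omega)).le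
    have hz0 : z = 0 := (Submodule.mem_bot ℂ).mp (this hz)
    exact ⟨1, Subgroup.one_mem _, by simp [hz0]⟩
  | succ d ih =>
    obtain ⟨a, ha, b, hb, rfl⟩ := exists_add_of_mem_grSum (Q := fun k => k = (m : ℤ))
      (R := fun k => ((m + 1 : ℕ) : ℤ) ≤ k) (fun k hk => by omega) hz
    rw [grSum_eq] at ha
    have hm0 : (m : ℂ) ≠ 0 := by exact_mod_cast hm.ne'
    set y := (m : ℂ)⁻¹ • a with hy
    have hyg : y ∈ gr g h m := Submodule.smul_mem _ _ ha
    have hyP : y ∈ grSum g h (fun k => (m : ℤ) ≤ k) := gr_le_grSum le_rfl hyg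
    have hyh : ⁅y, h⁆ = -a := by
      rw [← lie_skew, hyg.2, hy, smul_smul]
      simp [hm0]
    have hyz : ⁅y, a + b⁆ ∈ grSum g h (fun k => ((m + 1 : ℕ) : ℤ) ≤ k) :=
      lie_mem_grSum (P := fun k => (m : ℤ) ≤ k) (Q := fun k => (m : ℤ) ≤ k)
        (fun k l hk hl => by push_cast; omega) hyP hz
    have hyN : ∀ w ∈ grSum g h (fun k => ((m + 1 : ℕ) : ℤ) ≤ k),
        ⁅y, w⁆ ∈ grSum g h (fun k => ((m + 1 : ℕ) : ℤ) ≤ k) := fun w hw =>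
      lie_mem_grSum (P := fun k => (m : ℤ) ≤ k) (fun k l hk hl => by push_cast at *; omega) hyP hw
    have hya : ⁅y, -a⁆ = 0 := by simp [hy]
    have h1 := exp_conj_sub_mem hyN (x := h + (a + b))
      (by rw [lie_add y h, lie_add, hyh, hya, zero_add]; exact hyN _ hyz)
    have h2 : exp y * (h + (a + b)) * exp (-y) - h ∈
        grSum g h (fun k => ((m + 1 : ℕ) : ℤ) ≤ k) := by
      have : exp y * (h + (a + b)) * exp (-y) - h =
        (exp y * (h + (a + b)) * exp (-y) - (h + (a + b) + ⁅y, h + (a + b)⁆)) +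
          (b + ⁅y, a + b⁆) := by rw [lie_add y h, hyh]; abel
      rw [this]
      exact Submodule.add_mem _ h1 (Submodule.add_mem _ hb hyz)
    obtain ⟨u, hu, hu'⟩ := ih (by omega) h2 (by omega)
    refine ⟨u * expUnit y, Subgroup.mul_mem _ hu (expUnit_mem hyg.1), ?_⟩
    have h3 : cj (expUnit y) (h + (a + b)) = h + (exp y * (h + (a + b)) * exp (-y) - h) := by
      rw [add_sub_cancel]; rfl
    rw [cj_mul_cj, h3, hu']

end Grading

variable {g : LieSubalgebra ℂ (Matrix n n ℂ)} {e h f : Matrix n n ℂ}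

lemma Triple.cj (T : Triple g e h f) {u : (Matrix n n ℂ)ˣ} (hu : u ∈ autGroup g) :
    Triple g (cj u e) (cj u h) (cj u f) where
  e_mem := (cj_mem hu).mpr T.e_mem
  h_mem := (cj_mem hu).mpr T.h_mem
  f_mem := (cj_mem hu).mpr T.f_mem
  nil := by
    obtain ⟨N, hN⟩ := T.nil
    exact ⟨N, by rw [← cj_pow, hN, cj_zero]⟩
  lie_he := by rw [← cj_lie, T.lie_he, cj_smul]
  lie_hf := by rw [← cj_lie, T.lie_hf, ← neg_smul, ← neg_smul, cj_smul]
  lie_ef := by rw [← cj_lie, T.lie_ef]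

namespace Triple

lemma adE_nil (T : Triple g e h f) : IsNilpotent (LieAlgebra.ad ℂ g ⟨e, T.e_mem⟩) :=
  ad_nil T.e_mem T.nil

lemma ad_he (T : Triple g e h f) :
    LieAlgebra.ad ℂ g ⟨h, T.h_mem⟩ * LieAlgebra.ad ℂ g ⟨e, T.e_mem⟩ -
      LieAlgebra.ad ℂ g ⟨e, T.e_mem⟩ * LieAlgebra.ad ℂ g ⟨h, T.h_mem⟩ =
      2 * LieAlgebra.ad ℂ g ⟨e, T.e_mem⟩ := by
  rw [two_mul_end, ← map_smul, ← Ring.lie_def, ← LieHom.map_lie]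
  exact congrArg _ (Subtype.ext T.lie_he)

lemma ad_hf (T : Triple g e h f) :
    LieAlgebra.ad ℂ g ⟨h, T.h_mem⟩ * LieAlgebra.ad ℂ g ⟨f, T.f_mem⟩ -
      LieAlgebra.ad ℂ g ⟨f, T.f_mem⟩ * LieAlgebra.ad ℂ g ⟨h, T.h_mem⟩ =
      -(2 * LieAlgebra.ad ℂ g ⟨f, T.f_mem⟩) := by
  rw [two_mul_end, ← map_smul, ← Ring.lie_def, ← LieHom.map_lie, ← map_neg]
  exact congrArg _ (Subtype.ext T.lie_hf)

lemma ad_ef (T : Triple g e h f) :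
    LieAlgebra.ad ℂ g ⟨e, T.e_mem⟩ * LieAlgebra.ad ℂ g ⟨f, T.f_mem⟩ -
      LieAlgebra.ad ℂ g ⟨f, T.f_mem⟩ * LieAlgebra.ad ℂ g ⟨e, T.e_mem⟩ =
      LieAlgebra.ad ℂ g ⟨h, T.h_mem⟩ := by
  rw [← Ring.lie_def, ← LieHom.map_lie]
  exact congrArg _ (Subtype.ext T.lie_ef)

lemma iSup_eigenspace_vec (T : Triple g e h f) :
    ⨆ k : ℤ, Module.End.eigenspace (toLin' h) (k : ℂ) = ⊤ := by
  refine Sl2Module.iSup_eigenspace (e := toLin' e) (f := toLin' f) ?_ ?_ ?_ ?_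
  · have := T.lie_he
    rw [Ring.lie_def] at this
    rw [two_mul_end, ← map_smul, ← this, map_sub, toLin'_mul, toLin'_mul]; rfl
  · have := T.lie_hf
    rw [Ring.lie_def] at this
    rw [two_mul_end, ← map_smul, ← map_neg, ← this, map_sub, toLin'_mul, toLin'_mul]; rfl
  · have := T.lie_ef
    rw [Ring.lie_def] at this
    rw [← this, map_sub, toLin'_mul, toLin'_mul]; rfl
  · obtain ⟨N, hN⟩ := T.nil
    exact ⟨N, by rw [← toLin'_pow, hN, map_zero]⟩

lemma iSup_gr (T : Triple g e h f) : grSum g h (fun _ => True) = g.toSubmodule := by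
  refine le_antisymm (grSum_le _) fun x hx => ?_
  have h1 := Sl2Module.iSup_eigenspace T.ad_he T.ad_hf T.ad_ef T.adE_nil
  have h2 : (⟨x, hx⟩ : g) ∈ ⨆ k : ℤ, (LieAlgebra.ad ℂ g ⟨h, T.h_mem⟩).eigenspace (k : ℂ) := by
    rw [h1]; trivial
  have h3 : ⨆ k : ℤ, (LieAlgebra.ad ℂ g ⟨h, T.h_mem⟩).eigenspace (k : ℂ) ≤
      (grSum g h (fun _ => True)).comap g.toSubmodule.subtype :=
    iSup_le fun k y hy => gr_le_grSum (k := k) trivial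
      ⟨y.2, congrArg Subtype.val (Module.End.mem_eigenspace_iff.mp hy)⟩
  exact h3 h2

lemma exists_conj_hermitian (T : Triple g e h f) (hs : ∀ x ∈ g, xᴴ ∈ g) :
    ∃ u ∈ autGroup g, (MatLie.cj u h).IsHermitian := by
  open ComplexOrder in
  set N := grSum g h (fun k => 1 ≤ k) with hN
  set P := grSum g h (fun k => 0 ≤ k) with hP
  have hP0 : ∀ x ∈ g, (∀ z ∈ N, (x * z).trace = 0) → x ∈ P := by
    intro x hx hxz
    have hx' : x ∈ grSum g h (fun _ => True) := by rw [T.iSup_gr]; exact hx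
    obtain ⟨a, ha, b, hb, rfl⟩ := exists_add_of_mem_grSum (Q := fun k => k < 0)
      (R := fun k => 0 ≤ k) (fun k _ => lt_or_ge k 0) hx'
    suffices a = 0 by rw [this, zero_add]; exact hb
    refine eq_zero_of_trace hs (grSum_le _ ha) fun y hy => ?_
    have hy' : y ∈ grSum g h (fun _ => True) := by rw [T.iSup_gr]; exact hy
    obtain ⟨c, hc, d, hd, rfl⟩ := exists_add_of_mem_grSum (Q := fun k => k < 1)
      (R := fun k => 1 ≤ k) (fun k _ => lt_or_ge k 1) hy'
    have h1 := hxz d hd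
    rw [add_mul, trace_add, trace_grSum (fun k l hk hl => by omega) hb hd, add_zero] at h1
    rw [mul_add, trace_add, h1, trace_grSum (fun k l hk hl => by omega) ha hc, add_zero]
  obtain ⟨m, hm, hmz⟩ : ∃ m ∈ N, ∀ z ∈ N, ((h + m)ᴴ * z).trace = 0 := by
    let N' : Submodule ℂ (Matrix n n ℂ) :=
      { carrier := {x | xᴴ ∈ N}
        add_mem' := fun hx hy => by
          simp only [Set.mem_ofPred_eq, conjTranspose_add]; exact N.add_mem hx hy
        zero_mem' := by simp
        smul_mem' := fun c x hx => by
          simp only [Set.mem_ofPred_eq, conjTranspose_smul]; exact N.smul_mem _ hx }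
    let B : N →ₗ[ℂ] N' →ₗ[ℂ] ℂ :=
      LinearMap.mk₂ ℂ (fun x y => ((x : Matrix n n ℂ) * y).trace)
        (by intros; simp [add_mul]) (by intros; simp) (by intros; simp [mul_add]) (by intros; simp)
    have hB : ∀ x y, B x y = ((x : Matrix n n ℂ) * y).trace := fun _ _ => rfl
    have hi1 : Function.Injective B := by
      rw [injective_iff_map_eq_zero]
      intro x hx
      refine Subtype.ext (trace_mul_conjTranspose_self_eq_zero_iff.mp ?_)
      exact LinearMap.congr_fun hx ⟨(x : Matrix n n ℂ)ᴴ, by simp [N']⟩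
    have hi2 : Function.Injective B.flip := by
      rw [injective_iff_map_eq_zero]
      intro x hx
      refine Subtype.ext (trace_conjTranspose_mul_self_eq_zero_iff.mp ?_)
      exact LinearMap.congr_fun hx ⟨(x : Matrix n n ℂ)ᴴ, x.2⟩
    have hp : B.IsPerfPair := LinearMap.IsPerfPair.of_injective hi1 hi2
    let φ : N' →ₗ[ℂ] ℂ := traceLinearMap n ℂ ℂ ∘ₗ LinearMap.mulLeft ℂ (-h) ∘ₗ N'.subtype
    obtain ⟨m, hm⟩ := hp.bijective_left.2 φ
    refine ⟨m, m.2, fun z hz => ?_⟩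
    have h1 := LinearMap.congr_fun hm ⟨zᴴ, by simpa [N'] using hz⟩
    have h2 : ((m : Matrix n n ℂ) * zᴴ).trace = (-h * zᴴ).trace := h1
    have h3 : ((h + m) * zᴴ).trace = 0 := by
      rw [add_mul, trace_add, h2, neg_mul, trace_neg, add_neg_cancel]
    have h4 : ((h + (m : Matrix n n ℂ))ᴴ * z).trace = star (((h + m) * zᴴ).trace) := by
      rw [← trace_conjTranspose, conjTranspose_mul, conjTranspose_conjTranspose, trace_mul_comm]
    rw [h4, h3, star_zero]
  set h' := h + m with hh'
  have hmg : m ∈ g := grSum_le _ hm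
  have hh'g : h' ∈ g := g.add_mem T.h_mem hmg
  have hstarP : h'ᴴ ∈ P := hP0 _ (hs _ hh'g) hmz
  have hzN : ⁅h', h'ᴴ⁆ ∈ N := by
    rw [hh', add_lie]
    refine N.add_mem ?_ (lie_mem_grSum (fun k l hk hl => by omega) hm hstarP)
    exact grSum_mono (fun k hk => by omega) (lie_h_mem hstarP)
  have hnormal : ⁅h', h'ᴴ⁆ = 0 := by
    refine trace_mul_conjTranspose_self_eq_zero_iff.mp ?_
    have : (⁅h', h'ᴴ⁆)ᴴ = ⁅h', h'ᴴ⁆ := by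
      rw [Ring.lie_def, conjTranspose_sub, conjTranspose_mul, conjTranspose_mul,
        conjTranspose_conjTranspose]
    rw [this]
    exact trace_grSum (fun k l hk hl => by omega) hzN hzN
  obtain ⟨u, hu, huh⟩ := exists_conj_eq one_pos
    (by rw [hN] at hm; exact_mod_cast hm)
  refine ⟨u⁻¹, Subgroup.inv_mem _ hu, ?_⟩
  have hcj : MatLie.cj u⁻¹ h = h' := by
    have := congrArg (MatLie.cj u⁻¹) huh
    rw [cj_inv_cj] at this
    exact this.symm
  have hsp := (T.cj (Subgroup.inv_mem _ hu)).iSup_eigenspace_vec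
  rw [hcj] at hsp ⊢
  have key : ∀ v, h'ᴴ *ᵥ v = h' *ᵥ v := by
    intro v
    have hv : v ∈ ⨆ k : ℤ, Module.End.eigenspace (toLin' h') (k : ℂ) := by rw [hsp]; trivial
    refine Submodule.iSup_induction (motive := fun v => h'ᴴ *ᵥ v = h' *ᵥ v) _ hv ?_ (by simp) ?_
    · intro k v hv
      have hv' : h' *ᵥ v = (k : ℂ) • v := Module.End.mem_eigenspace_iff.mp hv
      have hc : h' * h'ᴴ = h'ᴴ * h' := sub_eq_zero.mp hnormal
      set A := h' - (k : ℂ) • (1 : Matrix n n ℂ) with hA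
      have hAh : Aᴴ = h'ᴴ - (k : ℂ) • (1 : Matrix n n ℂ) := by simp [hA]
      have h1 : A *ᵥ v = 0 := by simp [hA, sub_mulVec, smul_mulVec, hv']
      have h2 : A * Aᴴ = Aᴴ * A := by
        rw [hAh, hA]; simp only [sub_mul, mul_sub, hc]; simp; abel
      have h3 : Aᴴ *ᵥ v = 0 := by
        rw [← self_mul_conjTranspose_mulVec_eq_zero, h2, ← mulVec_mulVec, h1, mulVec_zero]
      rw [hAh, sub_mulVec, smul_mulVec, one_mulVec, sub_eq_zero] at h3
      rw [h3, hv']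
    · intro x y hx hy
      rw [mulVec_add, mulVec_add, hx, hy]
  exact Matrix.ext_of_mulVec_single fun i => key _

end Triple

end MatLie

namespace MatLie

open Matrix NormedSpace

open scoped Matrix.Norms.L2Operator
attribute [local instance] LieRing.ofAssociativeRing

variable {n : Type*} [Fintype n] [DecidableEq n]

/-- Unitary matrices normalising `g`. -/
def unitaryAut (g : LieSubalgebra ℂ (Matrix n n ℂ)) : Set (Matrix n n ℂ) :=
  {k | kᴴ * k = 1 ∧ ∀ x ∈ g, k * x * kᴴ ∈ g ∧ kᴴ * x * k ∈ g}

variable {g : LieSubalgebra ℂ (Matrix n n ℂ)}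

lemma isCompact_unitaryAut (g : LieSubalgebra ℂ (Matrix n n ℂ)) : IsCompact (unitaryAut g) := by
  have : ProperSpace (Matrix n n ℂ) := FiniteDimensional.proper ℂ _
  refine Metric.isCompact_of_isClosed_isBounded ?_ ?_
  · have h1 : IsClosed {k : Matrix n n ℂ | kᴴ * k = 1} :=
      isClosed_eq (continuous_id.matrix_conjTranspose.matrix_mul continuous_id) continuous_const
    have h2 : ∀ x : Matrix n n ℂ, IsClosed {k : Matrix n n ℂ | k * x * kᴴ ∈ g} := fun x =>
      (Submodule.closed_of_finiteDimensional g.toSubmodule).preimage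
        (f := fun k : Matrix n n ℂ => k * x * kᴴ) ((continuous_id.matrix_mul
          continuous_const).matrix_mul
          continuous_id.matrix_conjTranspose)
    have h3 : ∀ x : Matrix n n ℂ, IsClosed {k : Matrix n n ℂ | kᴴ * x * k ∈ g} := fun x =>
      (Submodule.closed_of_finiteDimensional g.toSubmodule).preimage
        (f := fun k : Matrix n n ℂ => kᴴ * x * k)
        ((continuous_id.matrix_conjTranspose.matrix_mul continuous_const).matrix_mul
          continuous_id)
    have : unitaryAut g = {k : Matrix n n ℂ | kᴴ * k = 1} ∩
        ⋂ x ∈ g, ({k : Matrix n n ℂ | k * x * kᴴ ∈ g} ∩ {k : Matrix n n ℂ | kᴴ * x * k ∈ g}) := by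
      ext k; simp [unitaryAut]
    rw [this]
    exact h1.inter (isClosed_biInter fun x _ => (h2 x).inter (h3 x))
  · refine isBounded_iff_forall_norm_le.mpr ⟨‖(1 : Matrix n n ℂ)‖ + 1, fun k hk => ?_⟩
    have h1 := l2_opNorm_conjTranspose_mul_self k
    rw [hk.1] at h1
    nlinarith [norm_nonneg k]

lemma exp_mul_mem_unitaryAut {u k : Matrix n n ℂ} (hu : u ∈ g) (hsk : uᴴ = -u)
    (hk : k ∈ unitaryAut g) : exp u * k ∈ unitaryAut g := by
  have h1 : (exp u)ᴴ = exp (-u) := by rw [← exp_conjTranspose, hsk]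
  have h2 : exp (-u) * exp u = 1 := (expUnit u).inv_val
  refine ⟨?_, fun x hx => ⟨?_, ?_⟩⟩
  · rw [conjTranspose_mul, h1, mul_assoc, ← mul_assoc (exp (-u)), h2, one_mul, hk.1]
  · rw [conjTranspose_mul, h1, show exp u * k * x * (kᴴ * exp (-u)) =
      exp u * (k * x * kᴴ) * exp (-u) by simp only [mul_assoc]]
    exact (expUnit_mem hu _).mpr (hk.2 x hx).1
  · rw [conjTranspose_mul, h1, show kᴴ * exp (-u) * x * (exp u * k) =
      kᴴ * (exp (-u) * x * exp u) * k by simp only [mul_assoc]]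
    refine (hk.2 _ ?_).2
    have := (expUnit_mem (g.neg_mem hu) x).mpr hx
    simpa [expUnit] using this

lemma mul_mem_unitaryAut {v k : Matrix n n ℂ} (hv : v ∈ unitaryAut g) (hk : k ∈ unitaryAut g) :
    v * k ∈ unitaryAut g := by
  refine ⟨?_, fun x hx => ⟨?_, ?_⟩⟩
  · rw [conjTranspose_mul, mul_assoc, ← mul_assoc vᴴ, hv.1, one_mul, hk.1]
  · rw [conjTranspose_mul, show v * k * x * (kᴴ * vᴴ) = v * (k * x * kᴴ) * vᴴ by
      simp only [mul_assoc]]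
    exact (hv.2 _ (hk.2 x hx).1).1
  · rw [conjTranspose_mul, show kᴴ * vᴴ * x * (v * k) = kᴴ * (vᴴ * x * v) * k by
      simp only [mul_assoc]]
    exact (hk.2 _ (hv.2 x hx).2).2

/-- Two Hermitian elements of `g` commute after conjugating one of them so as to maximise
their trace pairing. -/
theorem exists_conj_commute {h D : Matrix n n ℂ} (hg : h ∈ g) (hD : D ∈ g)
    (hh : h.IsHermitian) (hDh : D.IsHermitian) : ∃ u ∈ autGroup g, ⁅cj u h, D⁆ = 0 ∧
    ∀ v ∈ unitaryAut g, ((v * cj u h * vᴴ * D).trace).re ≤ ((cj u h * D).trace).re := by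
  have hcont : ContinuousOn (fun k : Matrix n n ℂ => ((k * h * kᴴ * D).trace).re)
      (unitaryAut g) := by
    refine Continuous.continuousOn ?_
    refine Complex.continuous_re.comp ?_
    exact ((((continuous_id.matrix_mul continuous_const).matrix_mul
      continuous_id.matrix_conjTranspose).matrix_mul continuous_const).matrix_trace)
  obtain ⟨k, hk, hmax⟩ := (isCompact_unitaryAut g).exists_isMaxOn
    ⟨1, by simp, fun x hx => by simpa using hx⟩ hcont
  set x := k * h * kᴴ with hx
  have hxg : x ∈ g := (hk.2 h hg).1
  have hxh : xᴴ = x := by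
    rw [hx, conjTranspose_mul, conjTranspose_mul, conjTranspose_conjTranspose, hh.eq, mul_assoc]
  set u := ⁅x, D⁆ with hu
  have hug : u ∈ g := g.lie_mem hxg hD
  have hsk : uᴴ = -u := by
    rw [hu, Ring.lie_def, conjTranspose_sub, conjTranspose_mul x, conjTranspose_mul D, hxh,
      hDh.eq, neg_sub]
  have hder : HasDerivAt (fun t : ℝ => ((exp (t • u) * x * exp (t • -u) * D).trace).re)
      ((((u * x * 1 + 1 * x * -u) * D).trace).re) 0 := by
    have h1 := hasDerivAt_exp_smul_const (𝕂 := ℝ) u (0 : ℝ)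
    have h2 := hasDerivAt_exp_smul_const (𝕂 := ℝ) (-u) (0 : ℝ)
    have h3 := ((h1.mul_const x).mul h2).mul_const D
    simp only [zero_smul, exp_zero, one_mul] at h3
    let L : Matrix n n ℂ →L[ℝ] ℝ := LinearMap.toContinuousLinearMap
      (Complex.reLm ∘ₗ (traceLinearMap n ℝ ℂ))
    have h4 := L.hasFDerivAt.comp_hasDerivAt (0 : ℝ) h3
    simpa [L, Function.comp_def] using h4
  have hloc : IsLocalMax (fun t : ℝ => ((exp (t • u) * x * exp (t • -u) * D).trace).re) 0 := by
    refine Filter.Eventually.of_forall fun t => ?_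
    have hsk' : (t • u)ᴴ = -(t • u) := by
      rw [conjTranspose_smul, hsk, smul_neg]; simp
    have htu : t • u ∈ g := by
      rw [← Complex.coe_smul]; exact g.smul_mem _ hug
    have := hmax (exp_mul_mem_unitaryAut htu hsk' hk)
    have h1 : (exp (t • u))ᴴ = exp (t • -u) := by rw [← exp_conjTranspose, hsk', smul_neg]
    simp only [Set.mem_ofPred_eq] at this
    rw [conjTranspose_mul, h1, show exp (t • u) * k * h * (kᴴ * exp (t • -u)) =
      exp (t • u) * x * exp (t • -u) by rw [hx]; simp only [mul_assoc]] at this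
    simpa using this
  have h0 := hloc.hasDerivAt_eq_zero hder
  have h1 : ((u * x * 1 + 1 * x * -u) * D).trace = - (u * uᴴ).trace := by
    have h2 : u * x * 1 + 1 * x * -u = -⁅x, u⁆ := by rw [Ring.lie_def]; noncomm_ring
    rw [h2, neg_mul, trace_neg, trace_lie_mul, neg_neg, hsk, mul_neg, trace_neg, neg_neg, hu]
  rw [h1, Complex.neg_re, neg_eq_zero] at h0
  have h2 : (u * uᴴ).trace = 0 := by
    open ComplexOrder in
    have := (Complex.nonneg_iff.mp (posSemidef_self_mul_conjTranspose u).trace_nonneg).2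
    exact Complex.ext h0 this.symm
  have hu0 : u = 0 := by
    open ComplexOrder in
    exact trace_mul_conjTranspose_self_eq_zero_iff.mp h2
  have hkk : k * kᴴ = 1 := mul_eq_one_comm.mp hk.1
  refine ⟨⟨k, kᴴ, hkk, hk.1⟩, fun y => ⟨fun hy => ?_, fun hy => (hk.2 y hy).1⟩, hu0,
    fun v hv => ?_⟩
  swap
  · have := hmax (mul_mem_unitaryAut hv hk)
    simp only [Set.mem_ofPred_eq] at this
    rw [conjTranspose_mul, show v * k * h * (kᴴ * vᴴ) = v * x * vᴴ by
      rw [hx]; simp only [mul_assoc]] at this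
    exact this
  have h3 := (hk.2 _ hy).2
  have h4 : kᴴ * (k * y * kᴴ) * k = (kᴴ * k) * y * (kᴴ * k) := by simp only [mul_assoc]
  change kᴴ * (k * y * kᴴ) * k ∈ g at h3
  rwa [h4, hk.1, one_mul, mul_one] at h3

/-- Every nilpotent element of `g` is conjugate to the nilpositive element of a triple whose
neutral element commutes with a given Hermitian element and maximises the trace pairing with it. -/
theorem exists_triple_commute (hs : ∀ x ∈ g, xᴴ ∈ g) {e D : Matrix n n ℂ} (he : e ∈ g)
    (hnil : IsNilpotent e) (hD : D ∈ g) (hDh : D.IsHermitian) :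
    ∃ u ∈ autGroup g, ∃ h f, Triple g (cj u e) h f ∧ ⁅h, D⁆ = 0 ∧
      ∀ v ∈ unitaryAut g, ((v * h * vᴴ * D).trace).re ≤ ((h * D).trace).re := by
  obtain ⟨h, f, T⟩ := exists_triple hs he hnil
  obtain ⟨u, hu, huh⟩ := T.exists_conj_hermitian hs
  obtain ⟨v, hv, hvh, hmax⟩ := exists_conj_commute (T.cj hu).h_mem hD huh hDh
  refine ⟨v * u, Subgroup.mul_mem _ hv hu, _, _, T.cj (Subgroup.mul_mem _ hv hu), ?_⟩
  rw [cj_mul_cj]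
  exact ⟨hvh, hmax⟩

end MatLie

namespace MatLie

open Matrix NormedSpace Filter Topology

open scoped Matrix.Norms.L2Operator
attribute [local instance] LieRing.ofAssociativeRing

variable {n : Type*} [Fintype n] [DecidableEq n]
variable {g : LieSubalgebra ℂ (Matrix n n ℂ)} {e h f : Matrix n n ℂ}

lemma eq_zero_of_mem_gr_of_mem_grSum {P : ℤ → Prop} {k : ℤ} (hk : ¬ P k) {x : Matrix n n ℂ}
    (hx : x ∈ gr g h k) (hx' : x ∈ grSum g h P) : x = 0 := by
  have hd := (Module.End.eigenspaces_iSupIndep (LieAlgebra.ad ℂ (Matrix n n ℂ) h)) (k : ℂ)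
  refine Submodule.disjoint_def.mp hd x (Module.End.mem_eigenspace_iff.mpr hx.2) ?_
  refine (grSum_le_iff.mpr fun l hl y hy => ?_ : grSum g h P ≤ _) hx'
  refine le_iSup₂_of_le (f := fun (μ : ℂ) (_ : μ ≠ k) =>
    Module.End.eigenspace (LieAlgebra.ad ℂ (Matrix n n ℂ) h) μ) (l : ℂ) ?_ le_rfl
    (Module.End.mem_eigenspace_iff.mpr hy.2)
  rintro hlk
  have : l = k := by exact_mod_cast hlk
  exact hk (this ▸ hl)

namespace Triple

lemma e_mem_gr (T : Triple g e h f) : e ∈ gr g h 2 := ⟨T.e_mem, by rw [T.lie_he]; norm_num⟩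

lemma f_mem_gr (T : Triple g e h f) : f ∈ gr g h (-2) := ⟨T.f_mem, by rw [T.lie_hf]; simp⟩

lemma mem_grSum_of_ker (T : Triple g e h f) {w : Matrix n n ℂ} (hw : w ∈ g) (hew : ⁅e, w⁆ = 0) :
    w ∈ grSum g h (fun k => 0 ≤ k) := by
  have h1 := Sl2Module.ker_le_iSup T.ad_he T.ad_ef T.adE_nil
    (LinearMap.mem_ker.mpr (show LieAlgebra.ad ℂ g ⟨e, T.e_mem⟩ ⟨w, hw⟩ = 0 from Subtype.ext hew))
  have h3 : ⨆ k : ℕ, (LieAlgebra.ad ℂ g ⟨h, T.h_mem⟩).eigenspace (k : ℂ) ≤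
      (grSum g h (fun k => 0 ≤ k)).comap g.toSubmodule.subtype :=
    iSup_le fun k y hy => gr_le_grSum (k := (k : ℤ)) (P := fun k => 0 ≤ k) (by positivity)
      ⟨y.2, by
        have := congrArg Subtype.val (Module.End.mem_eigenspace_iff.mp hy)
        simpa using this⟩
  exact h3 h1

lemma eq_zero_of_lie_e (T : Triple g e h f) {k : ℤ} (hk : k < 0) {x : Matrix n n ℂ}
    (hx : x ∈ gr g h k) (hex : ⁅e, x⁆ = 0) : x = 0 :=
  eq_zero_of_mem_gr_of_mem_grSum (by omega) hx (T.mem_grSum_of_ker hx.1 hex)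

lemma exists_lie_e_eq (T : Triple g e h f) (hs : ∀ x ∈ g, xᴴ ∈ g) {k : ℤ} (hk : -1 ≤ k)
    {z : Matrix n n ℂ} (hz : z ∈ gr g h (k + 2)) : ∃ x ∈ gr g h k, ⁅e, x⁆ = z := by
  obtain ⟨x, hx, hxz⟩ := mem_range_ad hs T.e_mem hz.1 fun w hw hew =>
    trace_grSum (P := fun l => l = k + 2) (fun a b ha hb => by omega)
      (gr_le_grSum (P := fun l => l = k + 2) rfl hz) (T.mem_grSum_of_ker hw hew)
  have hx' : x ∈ grSum g h (fun _ => True) := by rw [T.iSup_gr]; exact hx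
  obtain ⟨a, ha, b, hb, rfl⟩ := exists_add_of_mem_grSum (Q := fun l => l = k)
    (R := fun l => l ≠ k) (fun l _ => eq_or_ne l k) hx'
  rw [grSum_eq] at ha
  refine ⟨a, ha, ?_⟩
  have h1 : ⁅e, b⁆ ∈ gr g h (k + 2) := by
    have : ⁅e, b⁆ = z - ⁅e, a⁆ := by rw [← hxz, lie_add]; abel
    rw [this, add_comm k]
    exact Submodule.sub_mem _ (add_comm k 2 ▸ hz) (lie_mem_gr T.e_mem_gr ha)
  have h2 : ⁅e, b⁆ ∈ grSum g h (fun l => l ≠ k + 2) :=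
    lie_mem_grSum (P := fun l => l = 2) (fun a b ha hb => by omega)
      (gr_le_grSum (P := fun l => l = 2) rfl T.e_mem_gr) hb
  rw [← hxz, lie_add, eq_zero_of_mem_gr_of_mem_grSum (by simp) h1 h2, add_zero]

end Triple

/-- The orbit of an element of weight `2` is open in the weight space if the infinitesimal
action is onto. -/
lemma eventually_conj {b : Matrix n n ℂ} (hb : b ∈ gr g h 2)
    (hsurj : ∀ z ∈ gr g h 2, ∃ y ∈ gr g h 0, ⁅y, b⁆ = z) :
    ∀ᶠ c : gr g h 2 in 𝓝 ⟨b, hb⟩, ∃ u ∈ autGroup g, cj u b = c := by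
  have hM : CompleteSpace (Matrix n n ℂ) := FiniteDimensional.complete ℂ _
  have h0 : CompleteSpace (gr g h 0) := FiniteDimensional.complete ℂ _
  have h2 : CompleteSpace (gr g h 2) := FiniteDimensional.complete ℂ _
  obtain ⟨p, hp⟩ := (gr g h 2).subtype.exists_leftInverse_of_injective (Submodule.ker_subtype _)
  let π : Matrix n n ℂ →L[ℂ] gr g h 2 := LinearMap.toContinuousLinearMap p
  have hπ : ∀ x : gr g h 2, π (x : Matrix n n ℂ) = x := fun x => LinearMap.congr_fun hp x
  have hmem : ∀ y : gr g h 0, exp (y : Matrix n n ℂ) * b * exp (-(y : Matrix n n ℂ)) ∈ gr g h 2 :=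
    fun y => exp_conj_mem (fun z hz => by simpa using lie_mem_gr y.2 hz) hb
  have hd1 : HasStrictFDerivAt (exp : Matrix n n ℂ → Matrix n n ℂ)
      (1 : Matrix n n ℂ →L[ℂ] Matrix n n ℂ) 0 := hasStrictFDerivAt_exp_zero
  have hι := (gr g h 0).subtypeL.hasStrictFDerivAt (x := 0)
  have hdp : HasStrictFDerivAt (fun y : gr g h 0 => exp (y : Matrix n n ℂ))
      ((1 : Matrix n n ℂ →L[ℂ] Matrix n n ℂ).comp (gr g h 0).subtypeL) 0 :=
    HasStrictFDerivAt.comp (0 : gr g h 0) (f := (gr g h 0).subtypeL) (by simpa using hd1) hι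
  have hdn : HasStrictFDerivAt (fun y : gr g h 0 => exp (-(y : Matrix n n ℂ)))
      ((1 : Matrix n n ℂ →L[ℂ] Matrix n n ℂ).comp (-(gr g h 0).subtypeL)) 0 :=
    HasStrictFDerivAt.comp (0 : gr g h 0) (f := fun y => -((gr g h 0).subtypeL y))
      (by simpa using hd1) hι.neg
  have hd := π.hasStrictFDerivAt.comp (0 : gr g h 0) ((hdp.mul_const' b).mul' hdn)
  have hmap := hd.map_nhds_eq_of_surj (LinearMap.range_eq_top.mpr fun z => by
    obtain ⟨y, hy, hyz⟩ := hsurj z z.2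
    refine ⟨⟨y, hy⟩, ?_⟩
    rw [← hπ z, ← hyz, Ring.lie_def]
    simp [sub_eq_neg_add])
  have hΦ0 : π (((fun y : gr g h 0 => exp (y : Matrix n n ℂ) * b) *
      fun y : gr g h 0 => exp (-(y : Matrix n n ℂ))) 0) = ⟨b, hb⟩ := by
    rw [← hπ ⟨b, hb⟩]
    simp
  rw [hΦ0] at hmap
  rw [← hmap, eventually_map]
  refine Eventually.of_forall fun y => ⟨expUnit y, expUnit_mem y.2.1, ?_⟩
  exact (congrArg Subtype.val (hπ ⟨_, hmem y⟩)).symm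

/-- Nilpositive elements of triples with the same neutral element are conjugate. -/
theorem exists_conj_of_triple (T : Triple g e h f) {e₀ f₀ : Matrix n n ℂ} (T₀ : Triple g e₀ h f₀)
    (hs : ∀ x ∈ g, xᴴ ∈ g) : ∃ u ∈ autGroup g, cj u e = e₀ := by
  let A : Matrix n n ℂ → (gr g h 0 →ₗ[ℂ] Matrix n n ℂ) := fun b =>
    -(LieAlgebra.ad ℂ (Matrix n n ℂ) b).comp (gr g h 0).subtype
  have hAb : ∀ b (y : gr g h 0), A b y = ⁅(y : Matrix n n ℂ), b⁆ := fun b y => lie_skew _ _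
  have hA2 : ∀ b ∈ gr g h 2, ∀ y, A b y ∈ gr g h 2 := fun b hb y => by
    rw [hAb]; simpa using lie_mem_gr y.2 hb
  let A2 : gr g h 2 → (gr g h 0 →ₗ[ℂ] gr g h 2) := fun b => (A b).codRestrict _ (hA2 b b.2)
  have hA2v : ∀ b y, ((A2 b y : gr g h 2) : Matrix n n ℂ) = ⁅(y : Matrix n n ℂ),
    (b : Matrix n n ℂ)⁆ :=
    fun b y => hAb b y
  have hsurj : ∀ {e f : Matrix n n ℂ} (T : Triple g e h f),
      Function.Surjective (A2 ⟨e, T.e_mem_gr⟩) := by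
    intro e f T z
    obtain ⟨x, hx, hxz⟩ := T.exists_lie_e_eq hs (k := 0) (by norm_num) (z := z) (by simp)
    refine ⟨-⟨x, hx⟩, Subtype.ext ?_⟩
    rw [hA2v, ← hxz, ← lie_skew]
    simp
  set b : gr g h 2 := ⟨e, T.e_mem_gr⟩ with hb
  set b₀ : gr g h 2 := ⟨e₀, T₀.e_mem_gr⟩ with hb₀
  let γ : ℂ → gr g h 2 := fun z => b + z • (b₀ - b)
  have hγ : Continuous γ := by fun_prop
  have hγA : ∀ z y, A2 (γ z) y = (1 - z) • A2 b y + z • A2 b₀ y := fun z y => Subtype.ext (by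
    simp only [Submodule.coe_add, Submodule.coe_smul, hA2v, γ, lie_add, lie_smul,
      AddSubgroupClass.coe_sub, lie_sub]
    module)
  obtain ⟨R, hR⟩ := (A2 b).exists_rightInverse_of_surjective (LinearMap.range_eq_top.mpr (hsurj T))
  have hR' : ∀ z, A2 b (R z) = z := fun z => LinearMap.congr_fun hR z
  have hne0 : ∀ z, ¬ Function.Surjective (A2 (γ z)) → z ≠ 0 := by
    rintro _ hz rfl
    exact hz (by simpa [γ] using hsurj T)
  have hbad : {z : ℂ | ¬ Function.Surjective (A2 (γ z))}.Finite := by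
    refine Set.Finite.of_injOn (f := fun z : ℂ => (z - 1) / z) (fun z hz => ?_)
      (fun z hz w hw hzw => ?_) (Module.End.finite_hasEigenvalue (A2 b₀ ∘ₗ R))
    · have hz0 := hne0 z hz
      by_contra hcon
      refine hz fun w => ?_
      have hinj : Function.Injective (A2 b₀ ∘ₗ R - ((z - 1) / z) • (1 : Module.End ℂ (gr g h
        2))) := by
        rw [← LinearMap.ker_eq_bot]
        rw [← Module.End.eigenspace_def]
        exact not_not.mp hcon
      obtain ⟨v, hv⟩ := LinearMap.injective_iff_surjective.mp hinj (z⁻¹ • w)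
      refine ⟨R v, ?_⟩
      have hv' : A2 b₀ (R v) - ((z - 1) / z) • v = z⁻¹ • w := hv
      rw [hγA, hR', ← smul_inv_smul₀ hz0 w, ← hv', smul_sub, smul_smul, mul_div_cancel₀ _ hz0]
      module
    · have hz0 := hne0 z hz
      have hw0 := hne0 w hw
      have : (z - 1) / z = (w - 1) / w := hzw
      field_simp at this
      linear_combination this
  have hconn := (hbad.countable.isPathConnected_compl_of_one_lt_rank
    (by rw [Complex.rank_real_complex]; norm_num)).isConnected.isPreconnected
  have key := hconn.induction₂ (fun z w => ∃ u ∈ autGroup g, cj u (γ z : Matrix n n ℂ) = γ w)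
    (fun z hz => ?_) (fun x y z _ _ _ => ?_) (fun x y _ _ => ?_) (x := 0) (y := 1) ?_ ?_
  · simpa [γ] using key
  · have hz' : Function.Surjective (A2 (γ z)) := by simpa using hz
    have := eventually_conj (γ z).2 (fun w hw => by
      obtain ⟨y, hy⟩ := hz' ⟨w, hw⟩
      exact ⟨y, y.2, by rw [← hA2v, hy]⟩)
    exact (hγ.continuousAt.eventually this).filter_mono nhdsWithin_le_nhds
  · rintro ⟨u, hu, hu'⟩ ⟨v, hv, hv'⟩
    exact ⟨v * u, mul_mem hv hu, by rw [cj_mul_cj, hu', hv']⟩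
  · rintro ⟨u, hu, hu'⟩
    exact ⟨u⁻¹, inv_mem hu, by rw [← hu', cj_inv_cj]⟩
  · simpa [γ] using hsurj T
  · simpa [γ] using hsurj T₀

end MatLie

attribute [local instance] LieRing.ofAssociativeRing

/-- Sparse integer matrices: lists of entries `(row, column, value)`. -/
abbrev Sparse (n : Type*) := List (n × n × ℤ)

namespace Sparse

variable {n : Type*} [DecidableEq n]

/-- Negation of a sparse matrix. -/
def neg (a : Sparse n) : Sparse n := a.map fun s => (s.1, s.2.1, -s.2.2)

/-- Integer multiple of a sparse matrix. -/
def smul (k : ℤ) (a : Sparse n) : Sparse n := a.map fun s => (s.1, s.2.1, k * s.2.2)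

/-- Transpose of a sparse matrix. -/
def tr (a : Sparse n) : Sparse n := a.map fun s => (s.2.1, s.1, s.2.2)

/-- Product of sparse matrices. -/
def mul (a b : Sparse n) : Sparse n :=
  a.flatMap fun s => b.filterMap fun t =>
    if s.2.1 = t.1 then some (s.1, t.2.1, s.2.2 * t.2.2) else none

/-- Commutator of sparse matrices. -/
def br (a b : Sparse n) : Sparse n := mul a b ++ neg (mul b a)

/-- Whether the represented matrix vanishes. -/
def isZero (a : Sparse n) : Bool :=
  a.all fun s => (a.map fun t => if t.1 = s.1 ∧ t.2.1 = s.2.1 then t.2.2 else 0).sum == 0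

/-- Whether two sparse matrices represent the same matrix. -/
def eqv (a b : Sparse n) : Bool := isZero (a ++ neg b)

/-- The complex matrix represented by a sparse matrix. -/
noncomputable def toM (a : Sparse n) : Matrix n n ℂ :=
  (a.map fun s => Matrix.single s.1 s.2.1 (s.2.2 : ℂ)).sum

@[simp] lemma toM_nil : toM ([] : Sparse n) = 0 := rfl

@[simp] lemma toM_cons (s : n × n × ℤ) (a : Sparse n) :
    toM (s :: a) = Matrix.single s.1 s.2.1 (s.2.2 : ℂ) + toM a := by simp [toM]

@[simp] lemma toM_append (a b : Sparse n) : toM (a ++ b) = toM a + toM b := by simp [toM]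

lemma toM_smul (k : ℤ) (a : Sparse n) : toM (smul k a) = (k : ℂ) • toM a := by
  induction a with
  | nil => simp [smul]
  | cons s a ih =>
    rw [toM_cons, smul_add, ← ih]
    simp [smul, Matrix.smul_single]

lemma toM_neg (a : Sparse n) : toM (neg a) = -toM a := by
  induction a with
  | nil => simp [neg]
  | cons s a ih =>
    rw [toM_cons, neg_add, ← ih]
    simp [neg, Matrix.single_neg]

lemma toM_tr (a : Sparse n) : toM (tr a) = (toM a).transpose := by
  induction a with
  | nil => simp [tr]
  | cons s a ih =>
    rw [toM_cons, Matrix.transpose_add, ← ih]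
    simp [tr, Matrix.transpose_single]

lemma toM_apply (a : Sparse n) (r c : n) :
    toM a r c = ((a.map fun t => if t.1 = r ∧ t.2.1 = c then t.2.2 else 0).sum : ℤ) := by
  induction a with
  | nil => simp
  | cons s a ih => simp [Matrix.single_apply, ih]

lemma toM_eq_zero {a : Sparse n} (h : a.isZero = true) : toM a = 0 := by
  ext r c
  rw [toM_apply, Matrix.zero_apply, Int.cast_eq_zero]
  by_cases hs : ∃ s ∈ a, s.1 = r ∧ s.2.1 = c
  · obtain ⟨s, hs, rfl, rfl⟩ := hs
    simpa using List.all_eq_true.mp h s hs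
  · push Not at hs
    refine List.sum_eq_zero fun x hx => ?_
    obtain ⟨t, ht, rfl⟩ := List.mem_map.mp hx
    exact if_neg fun h => hs t ht h.1 h.2

lemma toM_eq {a b : Sparse n} (h : eqv a b = true) : toM a = toM b := by
  have := toM_eq_zero h
  rwa [toM_append, toM_neg, ← sub_eq_add_neg, sub_eq_zero] at this

variable [Fintype n]

lemma toM_mul (a b : Sparse n) : toM (mul a b) = toM a * toM b := by
  have h1 : ∀ (s : n × n × ℤ), toM (b.filterMap fun t =>
      if s.2.1 = t.1 then some (s.1, t.2.1, s.2.2 * t.2.2) else none) =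
      Matrix.single s.1 s.2.1 (s.2.2 : ℂ) * toM b := by
    intro s
    induction b with
    | nil => simp
    | cons t b ih =>
      rw [toM_cons, mul_add, ← ih, List.filterMap_cons]
      by_cases h : s.2.1 = t.1
      · simp [h]
      · simp [h, Matrix.single_mul_single_of_ne]
  induction a with
  | nil => simp [mul]
  | cons s a ih =>
    rw [toM_cons, add_mul, ← ih, ← h1 s, ← toM_append]
    rfl

lemma toM_br (a b : Sparse n) : toM (br a b) = ⁅toM a, toM b⁆ := by
  rw [br, toM_append, toM_neg, toM_mul, toM_mul, Ring.lie_def, sub_eq_add_neg]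

end Sparse

namespace E6

/-- The positive roots of `E₆`, each written as a word in the simple roots all of whose nonempty
suffixes are again roots. -/
def wordTable : List (List (Fin 6)) := [
    [0], [1], [2], [3], [4], [5], [0, 2], [1, 3], [2, 3], [3, 4], [4, 5], [0, 2, 3], [1, 2, 3],
    [1, 3, 4], [2, 3, 4], [3, 4, 5], [0, 1, 2, 3], [0, 2, 3, 4], [1, 2, 3, 4], [1, 3, 4, 5],
    [2, 3, 4, 5], [0, 1, 2, 3, 4], [0, 2, 3, 4, 5], [3, 1, 2, 3, 4], [1, 2, 3, 4, 5],
    [0, 3, 1, 2, 3, 4], [0, 1, 2, 3, 4, 5], [3, 1, 2, 3, 4, 5], [2, 0, 3, 1, 2, 3, 4],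
    [0, 3, 1, 2, 3, 4, 5], [4, 3, 1, 2, 3, 4, 5], [2, 0, 3, 1, 2, 3, 4, 5],
    [0, 4, 3, 1, 2, 3, 4, 5], [2, 0, 4, 3, 1, 2, 3, 4, 5], [3, 2, 0, 4, 3, 1, 2, 3, 4, 5],
    [1, 3, 2, 0, 4, 3, 1, 2, 3, 4, 5]]

/-- The word of the `k`-th positive root. -/
def word (k : Fin 36) : List (Fin 6) := wordTable.getD k []

/-- Entry `(i, k)` is `0` if adding the `i`-th simple root to the `k`-th positive root does not
give a root, and otherwise `± (m + 1)` with `m` the index of the sum and `±` the structure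
constant. -/
def actTable : List (List ℤ) := [
  [0, 0, 7, 0, 0, 0, 0, 0, 12, 0, 0, 0, 17, 0, 18, 0, 0, 0, 22, 0, 23, 0, 0, 26, 27, 0, 0, 30, 0,
    0, 33, 0, 0, 0, 0, 0],
  [0, 0, 0, 8, 0, 0, 0, 0, 13, 14, 0, 17, 0, 0, 19, 20, 0, 22, 0, 0, 25, 0, 27, 0, 0, 0, 0, 0, 0,
    0, 0, 0, 0, 0, 36, 0],
  [-7, 0, 0, 9, 0, 0, 0, 13, 0, 15, 0, 0, 0, 19, 0, 21, 0, 0, 0, 25, 0, 0, 0, 0, 0, 29, 0, 0, 0,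
    32, 0, 0, 34, 0, 0, 0],
  [0, -8, -9, 0, 10, 0, -12, 0, 0, 0, 16, 0, 0, 0, 0, 0, 0, 0, 24, 0, 0, 26, 0, 0, 28, 0, 30, 0,
    0, 0, 0, 0, 0, 35, 0, 0],
  [0, 0, 0, -10, 0, 11, 0, -14, -15, 0, 0, -18, -19, 0, 0, 0, -22, 0, 0, 0, 0, 0, 0, 0, 0, 0, 0,
    31, 0, 33, 0, 34, 0, 0, 0, 0],
  [0, 0, 0, 0, -11, 0, 0, 0, 0, -16, 0, 0, 0, -20, -21, 0, 0, -23, -25, 0, 0, -27, 0, -28, 0, -30,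
    0, 0, -32, 0, 0, 0, 0, 0, 0, 0]]

/-- Signed entry of the table of structure constants. -/
def act (i : Fin 6) (k : Fin 36) : ℤ := (actTable.getD i []).getD k 0

/-- Structure constant of `⁅E i, x k⁆`. -/
def co (i : Fin 6) (k : Fin 36) : ℤ := (act i k).sign

/-- Index of the root vector proportional to `⁅E i, x k⁆`. -/
def tg (i : Fin 6) (k : Fin 36) : Fin 36 := Fin.ofNat 36 ((act i k).natAbs - 1)

section Generic

variable {L : Type*} [LieRing L] [LieAlgebra ℂ L]

/-- Iterated bracket along a word. -/
def wordLie (E : Fin 6 → L) : List (Fin 6) → L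
  | [] => 0
  | [i] => E i
  | i :: j :: w => ⁅E i, wordLie E (j :: w)⁆

omit [LieAlgebra ℂ L] in
lemma wordLie_cons (E : Fin 6 → L) (i : Fin 6) {w : List (Fin 6)} (hw : w ≠ []) :
    wordLie E (i :: w) = ⁅E i, wordLie E w⁆ := by
  cases w with
  | nil => exact absurd rfl hw
  | cons => rfl

lemma word_ne_nil : ∀ k, word k ≠ [] := by decide +kernel

/-- The Serre relations among the positive generators. -/
structure SerreRel (E : Fin 6 → L) : Prop where
  comm : ∀ i j, CartanMatrix.E₆ i j = 0 → ⁅E i, E j⁆ = 0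
  serre : ∀ i j, CartanMatrix.E₆ i j = -1 → ⁅E i, ⁅E i, E j⁆⁆ = 0

lemma word_simple (i : Fin 6) : word (Fin.castLE (by norm_num) i) = [i] := by
  revert i; decide +kernel

/-- The ways in which a structure constant is determined by those of lower roots. -/
def Step (i : Fin 6) (k : Fin 36) : Prop :=
  (co i k = 1 ∧ word (tg i k) = i :: word k) ∨
  (∃ j, word k = [j] ∧ (co i k = 0 ∧ (i = j ∨ CartanMatrix.E₆ i j = 0) ∨
    co i k = -1 ∧ word (tg i k) = [j, i])) ∨
  (∃ j, CartanMatrix.E₆ i j = -1 ∧ co i k = 0 ∧ (word k = [i, j] ∨ word k = [j, i])) ∨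
  (∃ j, ∃ l < k, CartanMatrix.E₆ i j = 0 ∧ tg j l = k ∧ co j l * co j l = 1 ∧
    co i k = co j l * co i l ∧ (co i k = 0 ∨ word (tg i k) = j :: word (tg i l))) ∨
  (∃ j, ∃ l < k, CartanMatrix.E₆ i j = -1 ∧ co i k = 0 ∧ co i l = 0 ∧ co j l * co j l = 1 ∧
    tg j l < k ∧ co i (tg j l) * co i (tg j l) = 1 ∧ tg i (tg j l) = k) ∨
  (∃ j, ∃ l < k, CartanMatrix.E₆ i j = -1 ∧ co i k = 0 ∧ co j l = 0 ∧ co i l * co i l = 1 ∧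
    tg i l < k ∧ co i (tg i l) = 0 ∧ co j (tg i l) * co j (tg i l) = 1 ∧ tg j (tg i l) = k)

instance (i : Fin 6) (k : Fin 36) : Decidable (Step i k) := by unfold Step; infer_instance

lemma step_all : ∀ i k, Step i k := by decide +kernel

omit [LieAlgebra ℂ L] in
lemma eq_smul_of_smul_eq {c : ℤ} {x y : L} (hc : c * c = 1) (h : x = c • y) : y = c • x := by
  rw [h, smul_smul, hc, one_smul]

/-- The action of the simple root vectors on the positive root vectors. -/
theorem lie_wordLie {E : Fin 6 → L} (hE : SerreRel E) (k : Fin 36) : ∀ i,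
    ⁅E i, wordLie E (word k)⁆ = co i k • wordLie E (word (tg i k)) := by
  induction k using WellFoundedLT.induction with | _ k ih
  intro i
  rcases step_all i k with ⟨h1, h2⟩ | ⟨j, hj, h⟩ | ⟨j, hij, h0, h⟩ |
    ⟨j, l, hl, hij, hk, hc, hco, h⟩ | ⟨j, l, hl, hij, h0, hil, hjl, hlt, hil', hk⟩ |
    ⟨j, l, hl, hij, h0, hjl, hil, hlt, hii, hji, hk⟩
  · rw [h1, h2, one_smul, wordLie_cons _ _ (word_ne_nil k)]
  · rw [hj]
    rcases h with ⟨h0, h⟩ | ⟨h1, h2⟩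
    · rw [h0, zero_smul]
      rcases h with rfl | h
      · exact lie_self _
      · exact hE.comm i j h
    · rw [h1, h2, neg_one_smul]
      exact (lie_skew _ _).symm
  · rw [h0, zero_smul]
    rcases h with h | h
    · rw [h]; exact hE.serre i j hij
    · rw [h, show wordLie E [j, i] = -⁅E i, E j⁆ from (lie_skew _ _).symm, lie_neg,
        hE.serre i j hij, neg_zero]
  · have h1 := eq_smul_of_smul_eq hc (ih l hl j)
    rw [hk] at h1
    rw [h1, lie_zsmul, leibniz_lie, hE.comm i j hij, zero_lie, zero_add, ih l hl i, lie_zsmul,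
      smul_smul, ← hco]
    rcases h with h | h
    · rw [h, zero_smul, zero_smul]
    · rw [h, wordLie_cons _ _ (word_ne_nil _)]
  · have h1 := eq_smul_of_smul_eq hil' (ih _ hlt i)
    have h2 := eq_smul_of_smul_eq hjl (ih l hl j)
    have h3 := ih l hl i
    rw [hil, zero_smul] at h3
    rw [hk] at h1
    rw [h1, h2, h0, zero_smul]
    simp only [lie_zsmul]
    have h4 : ⁅E i, ⁅E i, ⁅E j, wordLie E (word l)⁆⁆⁆ = 0 := by
      rw [leibniz_lie (E i) (E j), h3, lie_zero, add_zero, leibniz_lie, h3, lie_zero, add_zero,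
        hE.serre i j hij, zero_lie]
    rw [h4, smul_zero, smul_zero]
  · have h1 := eq_smul_of_smul_eq hji (ih _ hlt j)
    have h2 := eq_smul_of_smul_eq hil (ih l hl i)
    have h3 := ih l hl j
    have h4 := ih _ hlt i
    rw [hjl, zero_smul] at h3
    rw [hii, zero_smul, h2, lie_zsmul] at h4
    have h4' : ⁅E i, ⁅E i, wordLie E (word l)⁆⁆ = 0 := by
      have h5 := congrArg (fun x => co i l • x) h4
      simpa [smul_smul, hil] using h5
    rw [hk] at h1
    rw [h1, h2, h0, zero_smul]
    simp only [lie_zsmul]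
    set x := wordLie E (word l)
    have h5 : ⁅⁅E i, ⁅E i, E j⁆⁆, x⁆ = 0 := by rw [hE.serre i j hij, zero_lie]
    have h6 : ⁅E i, ⁅E j, ⁅E i, x⁆⁆⁆ = 0 := by
      rw [lie_lie, lie_lie, lie_lie, h3, h4'] at h5
      simp only [lie_neg, lie_zero, zero_sub, sub_zero] at h5
      have h7 : (2 : ℂ) • ⁅E i, ⁅E j, ⁅E i, x⁆⁆⁆ = 0 := by
        rw [two_smul]
        have h8 := congrArg Neg.neg h5
        rw [neg_zero] at h8
        rw [← h8]; abel
      exact (smul_eq_zero.mp h7).resolve_left two_ne_zero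
    rw [h6, smul_zero, smul_zero]

end Generic

end E6

namespace E6

section Generic

variable {L : Type*} [LieRing L] [LieAlgebra ℂ L]

/-- The relations needed to see that the span of `H` and the root vectors built from `F` is
stable under the Chevalley generators. -/
structure HalfRel (E F H : Fin 6 → L) : Prop where
  rel : SerreRel F
  hh : ∀ i j, ⁅H i, H j⁆ = 0
  hf : ∀ i j, ∃ c : ℂ, ⁅H i, F j⁆ = c • F j
  ef_ne : ∀ i j, i ≠ j → ⁅E i, F j⁆ = 0
  ef : ∀ i, ∃ c : ℂ, ⁅E i, F i⁆ = c • H i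

/-- The span of the `H i` and the root vectors built from `F`. -/
def borel (F H : Fin 6 → L) : Submodule ℂ L :=
  Submodule.span ℂ (Set.range H ∪ Set.range fun k => wordLie F (word k))

lemma mem_borel_H (F H : Fin 6 → L) (i : Fin 6) : H i ∈ borel F H :=
  Submodule.subset_span (Or.inl ⟨i, rfl⟩)

lemma mem_borel_word (F H : Fin 6 → L) (k : Fin 36) : wordLie F (word k) ∈ borel F H :=
  Submodule.subset_span (Or.inr ⟨k, rfl⟩)

lemma mem_borel (F H : Fin 6 → L) (i : Fin 6) : F i ∈ borel F H := by
  have := mem_borel_word F H (Fin.castLE (by norm_num) i)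
  rwa [word_simple] at this

lemma borel_stable {F H : Fin 6 → L} (S : Submodule ℂ L) (z : L) (h1 : ∀ i, ⁅z, H i⁆ ∈ S)
    (h2 : ∀ k, ⁅z, wordLie F (word k)⁆ ∈ S) {x : L} (hx : x ∈ borel F H) : ⁅z, x⁆ ∈ S := by
  have : borel F H ≤ S.comap (LieAlgebra.ad ℂ L z : L →ₗ[ℂ] L) := by
    refine Submodule.span_le.mpr ?_
    rintro _ (⟨i, rfl⟩ | ⟨k, rfl⟩)
    · exact h1 i
    · exact h2 k
  exact this hx

lemma lie_H_wordLie {E F H : Fin 6 → L} (h : HalfRel E F H) (i : Fin 6) (w : List (Fin 6)) :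
    ∃ c : ℂ, ⁅H i, wordLie F w⁆ = c • wordLie F w := by
  induction w with
  | nil => exact ⟨0, by simp [wordLie]⟩
  | cons j w ih =>
    by_cases hw : w = []
    · subst hw; exact h.hf i j
    · obtain ⟨c, hc⟩ := ih
      obtain ⟨c', hc'⟩ := h.hf i j
      refine ⟨c' + c, ?_⟩
      rw [wordLie_cons _ _ hw, leibniz_lie, hc, hc', smul_lie, lie_smul, add_smul]

lemma lie_F_mem_borel {E F H : Fin 6 → L} (h : HalfRel E F H) (i : Fin 6) {x : L}
    (hx : x ∈ borel F H) : ⁅F i, x⁆ ∈ borel F H := by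
  refine borel_stable _ _ (fun j => ?_) (fun k => ?_) hx
  · obtain ⟨c, hc⟩ := h.hf j i
    rw [← lie_skew, hc]
    exact Submodule.neg_mem _ (Submodule.smul_mem _ _ (mem_borel F H i))
  · rw [lie_wordLie h.rel]
    exact zsmul_mem (mem_borel_word F H _) _

lemma lie_H_mem_borel {E F H : Fin 6 → L} (h : HalfRel E F H) (i : Fin 6) {x : L}
    (hx : x ∈ borel F H) : ⁅H i, x⁆ ∈ borel F H := by
  refine borel_stable _ _ (fun j => ?_) (fun k => ?_) hx
  · rw [h.hh]; exact zero_mem _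
  · obtain ⟨c, hc⟩ := lie_H_wordLie h i (word k)
    rw [hc]; exact Submodule.smul_mem _ _ (mem_borel_word F H _)

lemma word_tail : ∀ k, (∃ j, word k = [j]) ∨ ∃ j, ∃ l < k, word k = j :: word l := by
  decide +kernel

lemma lie_E_word_mem_borel {E F H : Fin 6 → L} (h : HalfRel E F H) (i : Fin 6) (k : Fin 36) :
    ⁅E i, wordLie F (word k)⁆ ∈ borel F H := by
  have hEF : ∀ j, ∃ c : ℂ, ⁅E i, F j⁆ = c • H i := fun j => by
    by_cases hj : i = j
    · subst hj; exact h.ef i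
    · exact ⟨0, by rw [h.ef_ne i j hj, zero_smul]⟩
  induction k using WellFoundedLT.induction with | _ k ih
  rcases word_tail k with ⟨j, hj⟩ | ⟨j, l, hl, hw⟩
  · rw [hj]
    obtain ⟨c, hc⟩ := hEF j
    exact hc ▸ Submodule.smul_mem _ _ (mem_borel_H F H i)
  · rw [hw, wordLie_cons _ _ (word_ne_nil l), leibniz_lie]
    refine add_mem ?_ (lie_F_mem_borel h j (ih l hl))
    obtain ⟨c, hc⟩ := hEF j
    rw [hc, smul_lie]
    exact Submodule.smul_mem _ _ (lie_H_mem_borel h i (mem_borel_word F H l))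

/-- The span of the `H i` and all root vectors is stable under the Chevalley generators. -/
theorem lie_mem_sup_borel {E F H : Fin 6 → L} (h : HalfRel E F H) (h' : HalfRel F E H)
    (i : Fin 6) {x : L} (hx : x ∈ borel F H ⊔ borel E H) :
    ⁅E i, x⁆ ∈ borel F H ⊔ borel E H ∧ ⁅F i, x⁆ ∈ borel F H ⊔ borel E H ∧
      ⁅H i, x⁆ ∈ borel F H ⊔ borel E H := by
  have key : ∀ {E F : Fin 6 → L}, HalfRel E F H → HalfRel F E H → ∀ x ∈ borel F H,
      ⁅E i, x⁆ ∈ borel F H ⊔ borel E H := fun {E F} h h' x hx => by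
    refine borel_stable _ _ (fun j => ?_) (fun k => ?_) hx
    · exact Submodule.mem_sup_right (lie_F_mem_borel h' i (mem_borel_H E H j))
    · exact Submodule.mem_sup_left (lie_E_word_mem_borel h i k)
  obtain ⟨y, hy, z, hz, rfl⟩ := Submodule.mem_sup.mp hx
  simp only [lie_add]
  refine ⟨add_mem (key h h' y hy) (Submodule.mem_sup_right (lie_F_mem_borel h' i hz)),
    add_mem (Submodule.mem_sup_left (lie_F_mem_borel h i hy)) ?_,
    add_mem (Submodule.mem_sup_left (lie_H_mem_borel h i hy))
      (Submodule.mem_sup_right (lie_H_mem_borel h' i hz))⟩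
  rw [sup_comm]
  exact key h' h z hz

end Generic

section Presentation

open CartanMatrix CartanMatrix.Relations

/-- The image in `e₆` of an element of the free Lie algebra. -/
noncomputable def mk (x : FreeLieAlgebra ℂ (Generators (Fin 6))) : LieAlgebra.e₆ ℂ :=
  LieSubmodule.Quotient.mk (N := toIdeal ℂ CartanMatrix.E₆) x

lemma mk_lie (x y : FreeLieAlgebra ℂ (Generators (Fin 6))) : mk ⁅x, y⁆ = ⁅mk x, mk y⁆ := rfl

lemma mk_add (x y : FreeLieAlgebra ℂ (Generators (Fin 6))) : mk (x + y) = mk x + mk y := rfl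

lemma mk_sub (x y : FreeLieAlgebra ℂ (Generators (Fin 6))) : mk (x - y) = mk x - mk y := rfl

lemma mk_smul (c : ℂ) (x : FreeLieAlgebra ℂ (Generators (Fin 6))) : mk (c • x) = c • mk x := rfl

lemma mk_surjective : Function.Surjective mk := Quot.mk_surjective

lemma mk_eq_zero {x : FreeLieAlgebra ℂ (Generators (Fin 6))} (hx : x ∈ toSet ℂ CartanMatrix.E₆) :
    mk x = 0 :=
  (LieSubmodule.Quotient.mk_eq_zero' (N := toIdeal ℂ CartanMatrix.E₆)).mpr
    (LieSubmodule.subset_lieSpan hx)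

/-- The Chevalley generator `H i`. -/
noncomputable def genH (i : Fin 6) : LieAlgebra.e₆ ℂ := mk (FreeLieAlgebra.of ℂ (.H i))

/-- The Chevalley generator `E i`. -/
noncomputable def genE (i : Fin 6) : LieAlgebra.e₆ ℂ := mk (FreeLieAlgebra.of ℂ (.E i))

/-- The Chevalley generator `F i`. -/
noncomputable def genF (i : Fin 6) : LieAlgebra.e₆ ℂ := mk (FreeLieAlgebra.of ℂ (.F i))

lemma lie_genH_genH (i j : Fin 6) : ⁅genH i, genH j⁆ = 0 :=
  mk_eq_zero (x := HH ℂ (i, j)) (by simp [toSet])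

lemma lie_genE_genF (i : Fin 6) : ⁅genE i, genF i⁆ = genH i := by
  have := mk_eq_zero (x := EF ℂ (i, i)) (by simp [toSet])
  rw [EF, Function.uncurry_apply_pair, if_pos rfl, mk_sub, sub_eq_zero] at this
  exact this

lemma lie_genE_genF_ne {i j : Fin 6} (h : i ≠ j) : ⁅genE i, genF j⁆ = 0 := by
  have := mk_eq_zero (x := EF ℂ (i, j)) (by simp [toSet])
  rw [EF, Function.uncurry_apply_pair, if_neg h] at this
  exact this

lemma lie_genH_genE (i j : Fin 6) : ⁅genH i, genE j⁆ = (CartanMatrix.E₆ i j : ℂ) • genE j := by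
  have := mk_eq_zero (x := HE ℂ CartanMatrix.E₆ (i, j)) (by simp [toSet])
  rw [HE, Function.uncurry_apply_pair, mk_sub, sub_eq_zero, ← Int.cast_smul_eq_zsmul ℂ] at this
  exact this

lemma lie_genH_genF (i j : Fin 6) : ⁅genH i, genF j⁆ = -(CartanMatrix.E₆ i j : ℂ) • genF j := by
  have := mk_eq_zero (x := HF ℂ CartanMatrix.E₆ (i, j)) (by simp [toSet])
  rw [HF, Function.uncurry_apply_pair, mk_add, ← Int.cast_smul_eq_zsmul ℂ,
    ← eq_neg_iff_add_eq_zero, mk_smul, ← neg_smul] at this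
  exact this

lemma serreRel_genE : SerreRel genE := by
  constructor
  · intro i j h
    have := mk_eq_zero (x := adE ℂ CartanMatrix.E₆ (i, j)) (by simp [toSet])
    rw [adE, Function.uncurry_apply_pair, h] at this
    exact this
  · intro i j h
    have := mk_eq_zero (x := adE ℂ CartanMatrix.E₆ (i, j)) (by simp [toSet])
    rw [adE, Function.uncurry_apply_pair, h, show (-(-1 : ℤ)).toNat = 1 from rfl, pow_one] at this
    exact this

lemma serreRel_genF : SerreRel genF := by
  constructor
  · intro i j h
    have := mk_eq_zero (x := adF ℂ CartanMatrix.E₆ (i, j)) (by simp [toSet])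
    rw [adF, Function.uncurry_apply_pair, h] at this
    exact this
  · intro i j h
    have := mk_eq_zero (x := adF ℂ CartanMatrix.E₆ (i, j)) (by simp [toSet])
    rw [adF, Function.uncurry_apply_pair, h, show (-(-1 : ℤ)).toNat = 1 from rfl, pow_one] at this
    exact this

lemma halfRel_EF : HalfRel genE genF genH where
  rel := serreRel_genF
  hh := lie_genH_genH
  hf i j := ⟨_, lie_genH_genF i j⟩
  ef_ne _ _ h := lie_genE_genF_ne h
  ef i := ⟨1, by rw [one_smul, lie_genE_genF]⟩

lemma halfRel_FE : HalfRel genF genE genH where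
  rel := serreRel_genE
  hh := lie_genH_genH
  hf i j := ⟨_, lie_genH_genE i j⟩
  ef_ne i j h := by rw [← lie_skew, lie_genE_genF_ne h.symm, neg_zero]
  ef i := ⟨-1, by rw [← lie_skew, lie_genE_genF, neg_one_smul]⟩

lemma eq_top_of_generators (K : LieSubalgebra ℂ (LieAlgebra.e₆ ℂ)) (hE : ∀ i, genE i ∈ K)
    (hF : ∀ i, genF i ∈ K) (hH : ∀ i, genH i ∈ K) (x : LieAlgebra.e₆ ℂ) : x ∈ K := by
  let π : FreeLieAlgebra ℂ (Generators (Fin 6)) →ₗ⁅ℂ⁆ LieAlgebra.e₆ ℂ :=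
    { toFun := mk, map_add' := mk_add, map_smul' := mk_smul, map_lie' := mk_lie _ _ }
  have hg : ∀ s, π (FreeLieAlgebra.of ℂ s) ∈ K := by
    rintro (i | i | i)
    exacts [hH i, hE i, hF i]
  let ψ : FreeLieAlgebra ℂ (Generators (Fin 6)) →ₗ⁅ℂ⁆ K :=
    FreeLieAlgebra.lift ℂ fun s => ⟨π (FreeLieAlgebra.of ℂ s), hg s⟩
  have h : K.incl.comp ψ = π := by
    refine FreeLieAlgebra.hom_ext fun s => ?_
    simp [ψ]
  obtain ⟨y, rfl⟩ := mk_surjective x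
  have := congrArg (fun f => f y) h
  change _ = mk y at this
  rw [← this]
  exact (ψ y).2

/-- `e₆` is spanned by the `H i` and the root vectors. -/
theorem span_eq_top : borel genF genH ⊔ borel genE genH = ⊤ := by
  set S := borel genF genH ⊔ borel genE genH
  let K : LieSubalgebra ℂ (LieAlgebra.e₆ ℂ) :=
    { carrier := {x | ∀ y ∈ S, ⁅x, y⁆ ∈ S}
      add_mem' := fun ha hb y hy => by rw [add_lie]; exact add_mem (ha y hy) (hb y hy)
      zero_mem' := fun y _ => by rw [zero_lie]; exact zero_mem _
      smul_mem' := fun c x hx y hy => by rw [smul_lie]; exact S.smul_mem _ (hx y hy)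
      lie_mem' := fun {a b} ha hb y hy => by
        rw [lie_lie]; exact sub_mem (ha _ (hb y hy)) (hb _ (ha y hy)) }
  have hK := eq_top_of_generators K
    (fun i y hy => (lie_mem_sup_borel halfRel_EF halfRel_FE i hy).1)
    (fun i y hy => (lie_mem_sup_borel halfRel_EF halfRel_FE i hy).2.1)
    (fun i y hy => (lie_mem_sup_borel halfRel_EF halfRel_FE i hy).2.2)
  have hE : ∀ i, genE i ∈ S := fun i => Submodule.mem_sup_right (mem_borel genE genH i)
  have hF : ∀ i, genF i ∈ S := fun i => Submodule.mem_sup_left (mem_borel genF genH i)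
  let K' : LieSubalgebra ℂ (LieAlgebra.e₆ ℂ) :=
    { S with lie_mem' := fun {a b} _ hb => hK a b hb }
  exact Submodule.eq_top_iff'.mpr (eq_top_of_generators K' hE hF
    fun i => Submodule.mem_sup_left (mem_borel_H genF genH i))

end Presentation

end E6

namespace E6

/-- The nonzero entries of the positive root vectors in the `27`-dimensional representation. -/
def rootTable : List (Sparse (Fin 27)) := [
  [(0, 1, 1), (10, 12, 1), (13, 15, 1), (16, 17, 1), (18, 19, 1), (20, 21, 1)],
  [(3, 4, 1), (5, 6, 1), (7, 9, 1), (18, 20, 1), (19, 21, 1), (22, 23, 1)],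
  [(1, 2, 1), (8, 10, 1), (11, 13, 1), (14, 16, 1), (19, 22, 1), (21, 23, 1)],
  [(2, 3, 1), (6, 8, 1), (9, 11, 1), (16, 18, 1), (17, 19, 1), (23, 24, 1)],
  [(3, 5, 1), (4, 6, 1), (11, 14, 1), (13, 16, 1), (15, 17, 1), (24, 25, 1)],
  [(5, 7, 1), (6, 9, 1), (8, 11, 1), (10, 13, 1), (12, 15, 1), (25, 26, 1)],
  [(0, 2, 1), (8, 12, -1), (11, 15, -1), (14, 17, -1), (18, 22, 1), (20, 23, 1)],
  [(2, 4, -1), (5, 8, 1), (7, 11, 1), (16, 20, -1), (17, 21, -1), (22, 24, 1)],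
  [(1, 3, 1), (6, 10, -1), (9, 13, -1), (14, 18, 1), (17, 22, -1), (21, 24, 1)],
  [(2, 5, 1), (4, 8, -1), (9, 14, 1), (13, 18, -1), (15, 19, -1), (23, 25, 1)],
  [(3, 7, 1), (4, 9, 1), (8, 14, -1), (10, 16, -1), (12, 17, -1), (24, 26, 1)],
  [(0, 3, 1), (6, 12, 1), (9, 15, 1), (14, 19, -1), (16, 22, -1), (20, 24, 1)],
  [(1, 4, -1), (5, 10, -1), (7, 13, -1), (14, 20, -1), (17, 23, 1), (19, 24, 1)],
  [(2, 6, -1), (3, 8, -1), (7, 14, 1), (13, 20, 1), (15, 21, 1), (22, 25, 1)],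
  [(1, 5, 1), (4, 10, 1), (9, 16, -1), (11, 18, -1), (15, 22, 1), (21, 25, 1)],
  [(2, 7, 1), (4, 11, -1), (6, 14, -1), (10, 18, 1), (12, 19, 1), (23, 26, 1)],
  [(0, 4, -1), (5, 12, 1), (7, 15, 1), (14, 21, 1), (16, 23, 1), (18, 24, 1)],
  [(0, 5, 1), (4, 12, -1), (9, 17, 1), (11, 19, 1), (13, 22, 1), (20, 25, 1)],
  [(1, 6, -1), (3, 10, 1), (7, 16, -1), (11, 20, 1), (15, 23, -1), (19, 25, 1)],
  [(2, 9, -1), (3, 11, -1), (5, 14, -1), (10, 20, -1), (12, 21, -1), (22, 26, 1)],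
  [(1, 7, 1), (4, 13, 1), (6, 16, 1), (8, 18, 1), (12, 22, -1), (21, 26, 1)],
  [(0, 6, -1), (3, 12, -1), (7, 17, 1), (11, 21, -1), (13, 23, -1), (18, 25, 1)],
  [(0, 7, 1), (4, 15, -1), (6, 17, -1), (8, 19, -1), (10, 22, -1), (20, 26, 1)],
  [(1, 8, 1), (2, 10, 1), (7, 18, 1), (9, 20, 1), (15, 24, 1), (17, 25, 1)],
  [(1, 9, -1), (3, 13, 1), (5, 16, 1), (8, 20, -1), (12, 23, 1), (19, 26, 1)],
  [(0, 8, 1), (2, 12, -1), (7, 19, -1), (9, 21, -1), (13, 24, 1), (16, 25, 1)],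
  [(0, 9, -1), (3, 15, -1), (5, 17, -1), (8, 21, 1), (10, 23, 1), (18, 26, 1)],
  [(1, 11, 1), (2, 13, 1), (5, 18, -1), (6, 20, -1), (12, 24, -1), (17, 26, 1)],
  [(0, 10, -1), (1, 12, -1), (7, 22, 1), (9, 23, 1), (11, 24, 1), (14, 25, 1)],
  [(0, 11, 1), (2, 15, -1), (5, 19, 1), (6, 21, 1), (10, 24, -1), (16, 26, 1)],
  [(1, 14, -1), (2, 16, -1), (3, 18, -1), (4, 20, -1), (12, 25, 1), (15, 26, 1)],
  [(0, 13, -1), (1, 15, -1), (5, 22, -1), (6, 23, -1), (8, 24, -1), (14, 26, 1)],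
  [(0, 14, -1), (2, 17, 1), (3, 19, 1), (4, 21, 1), (10, 25, 1), (13, 26, 1)],
  [(0, 16, 1), (1, 17, 1), (3, 22, -1), (4, 23, -1), (8, 25, 1), (11, 26, 1)],
  [(0, 18, -1), (1, 19, -1), (2, 22, -1), (4, 24, 1), (6, 25, 1), (9, 26, 1)],
  [(0, 20, 1), (1, 21, 1), (2, 23, 1), (3, 24, 1), (5, 25, 1), (7, 26, 1)]]

/-- The positive root vectors as sparse matrices. -/
def rootS (k : Fin 36) : Sparse (Fin 27) := rootTable.getD k []

/-- Three times the coordinates of the weights of the `27`-dimensional representation in terms of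
simple roots. -/
def weightTable : List (List ℤ) := [
    [4, 3, 5, 6, 4, 2], [1, 3, 5, 6, 4, 2], [1, 3, 2, 6, 4, 2], [1, 3, 2, 3, 4, 2],
    [1, 0, 2, 3, 4, 2], [1, 3, 2, 3, 1, 2], [1, 0, 2, 3, 1, 2], [1, 3, 2, 3, 1, -1],
    [1, 0, 2, 0, 1, 2], [1, 0, 2, 3, 1, -1], [1, 0, -1, 0, 1, 2], [1, 0, 2, 0, 1, -1],
    [-2, 0, -1, 0, 1, 2], [1, 0, -1, 0, 1, -1], [1, 0, 2, 0, -2, -1], [-2, 0, -1, 0, 1, -1],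
    [1, 0, -1, 0, -2, -1], [-2, 0, -1, 0, -2, -1], [1, 0, -1, -3, -2, -1], [-2, 0, -1, -3, -2, -1],
    [1, -3, -1, -3, -2, -1], [-2, -3, -1, -3, -2, -1], [-2, 0, -4, -3, -2, -1],
    [-2, -3, -4, -3, -2, -1], [-2, -3, -4, -6, -2, -1], [-2, -3, -4, -6, -5, -1],
    [-2, -3, -4, -6, -5, -4]]

/-- Three times the `i`-th coordinate of the `c`-th weight. -/
def wt27 (c : Fin 27) (i : Fin 6) : ℤ := (weightTable.getD c []).getD i 0

/-- The inclusion of the simple roots into the positive roots. -/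
abbrev sim (i : Fin 6) : Fin 36 := Fin.castLE (by norm_num) i

/-- The simple coroots as sparse matrices. -/
def corootS (i : Fin 6) : Sparse (Fin 27) := Sparse.br (rootS (sim i)) (Sparse.tr (rootS (sim i)))

open Sparse

section Rep

open CartanMatrix CartanMatrix.Relations

attribute [local instance] LieRing.ofAssociativeRing

/-- The images of the Chevalley generators. -/
noncomputable def genM : Generators (Fin 6) → Matrix (Fin 27) (Fin 27) ℂ
  | .E i => toM (rootS (sim i))
  | .F i => toM (tr (rootS (sim i)))
  | .H i => toM (corootS i)

lemma check_HH : ∀ i j, isZero (br (corootS i) (corootS j)) = true := by decide +kernel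

lemma check_EF : ∀ i j, i ≠ j → isZero (br (rootS (sim i)) (tr (rootS (sim j)))) = true := by
  decide +kernel

lemma check_HE : ∀ i j, eqv (br (corootS i) (rootS (sim j)))
    (smul (CartanMatrix.E₆ i j) (rootS (sim j))) = true := by decide +kernel

lemma check_HF : ∀ i j, eqv (br (corootS i) (tr (rootS (sim j))))
    (smul (-CartanMatrix.E₆ i j) (tr (rootS (sim j)))) = true := by decide +kernel

lemma check_adE : ∀ i j, isZero ((br (rootS (sim i)))^[(-CartanMatrix.E₆ i j).toNat]
    (br (rootS (sim i)) (rootS (sim j)))) = true := by decide +kernel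

lemma check_adF : ∀ i j, isZero ((br (tr (rootS (sim i))))^[(-CartanMatrix.E₆ i j).toNat]
    (br (tr (rootS (sim i))) (tr (rootS (sim j))))) = true := by decide +kernel

lemma toM_iterate_br (a b : Sparse (Fin 27)) (k : ℕ) :
    toM ((br a)^[k] b) = (LieAlgebra.ad ℂ (Matrix (Fin 27) (Fin 27) ℂ) (toM a) ^ k) (toM b) := by
  induction k with
  | zero => simp
  | succ k ih => rw [Function.iterate_succ_apply', toM_br, ih, pow_succ']; rfl

lemma lift_ad_pow {X L : Type*} [LieRing L] [LieAlgebra ℂ L]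
    (f : FreeLieAlgebra ℂ X →ₗ⁅ℂ⁆ L) (a b : FreeLieAlgebra ℂ X) (k : ℕ) :
    f ((LieAlgebra.ad ℂ (FreeLieAlgebra ℂ X) a ^ k) b) =
      (LieAlgebra.ad ℂ L (f a) ^ k) (f b) := by
  induction k with
  | zero => rfl
  | succ k ih => simp only [pow_succ', Module.End.mul_apply, LieAlgebra.ad_apply, LieHom.map_lie,
    ih]

/-- The representation of the free Lie algebra. -/
noncomputable def freeRep :
    FreeLieAlgebra ℂ (Generators (Fin 6)) →ₗ⁅ℂ⁆ Matrix (Fin 27) (Fin 27) ℂ :=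
  FreeLieAlgebra.lift ℂ genM

@[simp] lemma freeRep_of (s : Generators (Fin 6)) : freeRep (FreeLieAlgebra.of ℂ s) = genM s :=
  FreeLieAlgebra.lift_of_apply ..

lemma toIdeal_le_ker : toIdeal ℂ CartanMatrix.E₆ ≤ freeRep.ker := by
  refine LieSubmodule.lieSpan_le.mpr ?_
  rintro _ (((((⟨⟨i, j⟩, rfl⟩ | ⟨⟨i, j⟩, rfl⟩) | ⟨⟨i, j⟩, rfl⟩) | ⟨⟨i, j⟩, rfl⟩) | ⟨⟨i, j⟩, rfl⟩) |
    ⟨⟨i, j⟩, rfl⟩) <;> refine LieHom.mem_ker.mpr ?_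
  · simp only [HH, Function.uncurry_apply_pair, Function.comp_apply, LieHom.map_lie, freeRep_of,
      genM, ← toM_br]
    exact toM_eq_zero (check_HH i j)
  · by_cases h : i = j
    · subst h
      simp only [EF, Function.uncurry_apply_pair, Function.comp_apply, LieHom.map_lie, freeRep_of,
        genM, ← toM_br, if_true, map_sub, corootS, sub_self]
    · simp only [EF, Function.uncurry_apply_pair, Function.comp_apply, LieHom.map_lie, freeRep_of,
        genM, ← toM_br, if_neg h]
      exact toM_eq_zero (check_EF i j h)
  · simp only [HE, Function.uncurry_apply_pair, Function.comp_apply, LieHom.map_lie, freeRep_of,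
      genM, ← toM_br, map_sub, map_zsmul, toM_eq (check_HE i j), toM_smul,
      Int.cast_smul_eq_zsmul, sub_self]
  · simp only [HF, Function.uncurry_apply_pair, Function.comp_apply, LieHom.map_lie, freeRep_of,
      genM, ← toM_br, map_add, map_zsmul, toM_eq (check_HF i j), toM_smul,
      Int.cast_smul_eq_zsmul, neg_smul, neg_add_cancel]
  · simp only [adE, Function.uncurry_apply_pair, Function.comp_apply, lift_ad_pow, LieHom.map_lie,
      freeRep_of, genM, ← toM_br, ← toM_iterate_br]
    exact toM_eq_zero (check_adE i j)
  · simp only [adF, Function.uncurry_apply_pair, Function.comp_apply, lift_ad_pow, LieHom.map_lie,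
      freeRep_of, genM, ← toM_br, ← toM_iterate_br]
    exact toM_eq_zero (check_adF i j)

/-- The `27`-dimensional representation of `e₆`. -/
noncomputable def rep : LieAlgebra.e₆ ℂ →ₗ⁅ℂ⁆ Matrix (Fin 27) (Fin 27) ℂ :=
  { (toIdeal ℂ CartanMatrix.E₆).toSubmodule.liftQ
      (freeRep : FreeLieAlgebra ℂ (Generators (Fin 6)) →ₗ[ℂ] Matrix (Fin 27) (Fin 27) ℂ)
      toIdeal_le_ker with
    map_lie' := fun {x y} => by
      obtain ⟨x, rfl⟩ := mk_surjective x
      obtain ⟨y, rfl⟩ := mk_surjective y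
      exact freeRep.map_lie x y }

lemma rep_mk (x : FreeLieAlgebra ℂ (Generators (Fin 6))) : rep (mk x) = freeRep x := rfl

lemma rep_genE (i : Fin 6) : rep (genE i) = toM (rootS (sim i)) := by
  rw [genE, rep_mk, freeRep_of]; rfl

lemma rep_genF (i : Fin 6) : rep (genF i) = toM (tr (rootS (sim i))) := by
  rw [genF, rep_mk, freeRep_of]; rfl

lemma rep_genH (i : Fin 6) : rep (genH i) = toM (corootS i) := by
  rw [genH, rep_mk, freeRep_of]; rfl

lemma check_word : ∀ k j l, word k = j :: word l →
    eqv (br (rootS (sim j)) (rootS l)) (rootS k) = true := by decide +kernel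

lemma check_simple : ∀ k j, word k = [j] → k = sim j := by decide +kernel

lemma rep_wordE (k : Fin 36) : rep (wordLie genE (word k)) = toM (rootS k) := by
  induction k using WellFoundedLT.induction with | _ k ih
  rcases word_tail k with ⟨j, hj⟩ | ⟨j, l, hl, hw⟩
  · rw [hj, check_simple k j hj]; exact rep_genE j
  · rw [hw, wordLie_cons _ _ (word_ne_nil l), LieHom.map_lie, ih l hl, rep_genE, ← toM_br,
      toM_eq (check_word k j l hw)]

lemma toM_br_tr (a b : Sparse (Fin 27)) : ⁅toM (tr a), toM (tr b)⁆ = -(toM (tr (br a b))) := by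
  simp only [toM_tr, toM_br, Ring.lie_def, Matrix.transpose_sub, Matrix.transpose_mul, neg_sub]

lemma rep_wordF (k : Fin 36) :
    ∃ c : ℂ, c ≠ 0 ∧ rep (wordLie genF (word k)) = c • toM (tr (rootS k)) := by
  induction k using WellFoundedLT.induction with | _ k ih
  rcases word_tail k with ⟨j, hj⟩ | ⟨j, l, hl, hw⟩
  · refine ⟨1, one_ne_zero, ?_⟩
    rw [hj, check_simple k j hj, one_smul]; exact rep_genF j
  · obtain ⟨c, hc, h⟩ := ih l hl
    refine ⟨-c, neg_ne_zero.mpr hc, ?_⟩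
    rw [hw, wordLie_cons _ _ (word_ne_nil l), LieHom.map_lie, h, rep_genF, lie_smul, toM_br_tr,
      toM_tr, toM_eq (check_word k j l hw), toM_tr, smul_neg, neg_smul]

end Rep

end E6

namespace E6

attribute [local instance] LieRing.ofAssociativeRing

open Sparse Matrix

/-- The roots: positive ones and negative ones. -/
abbrev Root := Fin 36 ⊕ Fin 36

/-- The root vectors as sparse matrices. -/
def vecS : Root → Sparse (Fin 27) := Sum.elim rootS fun k => tr (rootS k)

/-- Coordinates of a root in terms of simple roots. -/
def rwt : Root → Fin 6 → ℤ :=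
  Sum.elim (fun k i => (word k).count i) fun k i => -((word k).count i : ℤ)

/-- Position of a nonzero entry of a root vector. -/
def piv (a : Root) : Fin 27 × Fin 27 := ((vecS a).head?.map fun s => (s.1, s.2.1)).getD (0, 0)

lemma vecS_wt : ∀ a, ∀ s ∈ vecS a, ∀ i, wt27 s.1 i - wt27 s.2.1 i = 3 * rwt a i := by
  decide +kernel

lemma rwt_injective' : ∀ a b, (∀ i, rwt a i = rwt b i) → a = b := by decide +kernel

lemma rwt_ne_zero : ∀ a, ∃ i, rwt a i ≠ 0 := by decide +kernel

lemma rwt_sim : ∀ i l, rwt (.inl (sim i)) l = if i = l then 1 else 0 := by decide +kernel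

lemma piv_spec : ∀ a, ((vecS a).map fun t =>
    if t.1 = (piv a).1 ∧ t.2.1 = (piv a).2 then t.2.2 else 0).sum ≠ 0 := by decide +kernel

lemma mem_of_toM_ne_zero {n : Type*} [DecidableEq n] {a : Sparse n} {r c : n}
    (h : toM a r c ≠ 0) : ∃ v, (r, c, v) ∈ a := by
  by_contra! hn
  refine h ?_
  rw [toM_apply, Int.cast_eq_zero]
  refine List.sum_eq_zero fun x hx => ?_
  obtain ⟨⟨r', c', v⟩, ht, rfl⟩ := List.mem_map.mp hx
  refine if_neg ?_
  rintro ⟨rfl, rfl⟩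
  exact hn v ht

/-- The root vectors. -/
noncomputable def vec (a : Root) : Matrix (Fin 27) (Fin 27) ℂ := toM (vecS a)

/-- Three times the fundamental coweights. -/
noncomputable def coweight (i : Fin 6) : Matrix (Fin 27) (Fin 27) ℂ :=
  diagonal fun c => (wt27 c i : ℂ)

/-- A matrix is homogeneous of weight `β` for the torus. -/
def Homog (x : Matrix (Fin 27) (Fin 27) ℂ) (β : Fin 6 → ℤ) : Prop :=
  ∀ r c, x r c ≠ 0 → ∀ i, wt27 r i - wt27 c i = 3 * β i

lemma homog_vec (a : Root) : Homog (vec a) (rwt a) := fun r c h i => by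
  obtain ⟨v, hv⟩ := mem_of_toM_ne_zero h
  exact vecS_wt a _ hv i

lemma vec_piv (a : Root) : vec a (piv a).1 (piv a).2 ≠ 0 := by
  rw [vec, toM_apply, Int.cast_ne_zero]; exact piv_spec a

lemma piv_wt (a : Root) (i : Fin 6) : wt27 (piv a).1 i - wt27 (piv a).2 i = 3 * rwt a i :=
  homog_vec a _ _ (vec_piv a) i

lemma Homog.apply_piv {x : Matrix (Fin 27) (Fin 27) ℂ} {β : Fin 6 → ℤ} (h : Homog x β) {a : Root}
    (hne : rwt a ≠ β) : x (piv a).1 (piv a).2 = 0 := by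
  by_contra hx
  refine hne (funext fun i => ?_)
  have h1 := h _ _ hx i
  have h2 := piv_wt a i
  omega

lemma homog_coweight (i : Fin 6) : Homog (coweight i) 0 := fun r c h l => by
  by_cases hrc : r = c
  · subst hrc; simp
  · exact absurd (diagonal_apply_ne _ hrc) h

/-- Index set of a weight basis. -/
abbrev Idx := Root ⊕ Fin 6

/-- A weight basis of the image of `e₆`. -/
noncomputable def bas : Idx → Matrix (Fin 27) (Fin 27) ℂ := Sum.elim vec coweight

/-- Weights of the basis. -/
def bwt : Idx → Fin 6 → ℤ := Sum.elim rwt 0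

lemma homog_bas (j : Idx) : Homog (bas j) (bwt j) := by
  rcases j with a | i
  exacts [homog_vec a, homog_coweight i]

/-- A functional detecting a basis element. -/
noncomputable def dual : Idx → Matrix (Fin 27) (Fin 27) ℂ →ₗ[ℂ] ℂ :=
  Sum.elim (fun a => Matrix.entryLinearMap ℂ ℂ (piv a).1 (piv a).2) fun i =>
    Matrix.entryLinearMap ℂ ℂ (piv (.inl (sim i))).1 (piv (.inl (sim i))).1 -
      Matrix.entryLinearMap ℂ ℂ (piv (.inl (sim i))).2 (piv (.inl (sim i))).2

lemma dual_bas_ne {j l : Idx} (h : j ≠ l) : dual j (bas l) = 0 := by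
  rcases j with a | i
  · refine (homog_bas l).apply_piv fun hw => h ?_
    rcases l with b | l
    · rw [rwt_injective' a b fun i => congrFun hw i]
    · obtain ⟨i, hi⟩ := rwt_ne_zero a
      exact absurd (congrFun hw i) hi
  · rcases l with b | l
    · have : ∀ r, vec b r r = 0 := fun r => by
        by_contra hr
        obtain ⟨i, hi⟩ := rwt_ne_zero b
        have := homog_vec b r r hr i
        omega
      change vec b _ _ - vec b _ _ = 0
      rw [this, this, sub_zero]
    · change coweight l _ _ - coweight l _ _ = 0
      rw [coweight, diagonal_apply_eq, diagonal_apply_eq, ← Int.cast_sub, piv_wt, rwt_sim,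
        if_neg fun h' => h (congrArg Sum.inr h')]
      simp

lemma dual_bas_self (j : Idx) : dual j (bas j) ≠ 0 := by
  rcases j with a | i
  · exact vec_piv a
  · change coweight i _ _ - coweight i _ _ ≠ 0
    rw [coweight, diagonal_apply_eq, diagonal_apply_eq, ← Int.cast_sub, piv_wt, rwt_sim, if_pos rfl]
    simp

lemma dual_sum (c : Idx → ℂ) (j : Idx) : dual j (∑ l, c l • bas l) = c j * dual j (bas j) := by
  rw [map_sum, Finset.sum_eq_single j]
  · rw [map_smul, smul_eq_mul]
  · intro l _ hl
    rw [map_smul, dual_bas_ne hl.symm, smul_zero]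
  · simp

lemma linearIndependent_bas : LinearIndependent ℂ bas := by
  refine Fintype.linearIndependent_iff.mpr fun c hc j => ?_
  have := dual_sum c j
  rw [hc, map_zero, eq_comm, mul_eq_zero] at this
  exact this.resolve_right (dual_bas_self j)

/-- The image of `e₆` in the `27`-dimensional representation. -/
noncomputable def gE6 : LieSubalgebra ℂ (Matrix (Fin 27) (Fin 27) ℂ) := rep.range

lemma corootS_diag : ∀ i, ∀ s ∈ corootS i, s.1 = s.2.1 := by decide +kernel

lemma check_coroot : ∀ i c, 3 * ((corootS i).map fun t => if t.1 = c ∧ t.2.1 =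
    c then t.2.2 else 0).sum =
    ∑ j, CartanMatrix.E₆ j i * wt27 c j := by decide +kernel

/-- Three times the inverse Cartan matrix. -/
def cartanInv (i j : Fin 6) : ℤ :=
  (([[4, 3, 5, 6, 4, 2], [3, 6, 6, 9, 6, 3], [5, 6, 10, 12, 8, 4], [6, 9, 12, 18, 12, 6],
    [4, 6, 8, 12, 10, 5], [2, 3, 4, 6, 5, 4]] : List (List ℤ)).getD i []).getD j 0

lemma cartanInv_mul : ∀ i j, ∑ l, cartanInv i l * CartanMatrix.E₆ j l = if i = j then 3 else 0 := by
  decide +kernel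

lemma toM_corootS (i : Fin 6) :
    (3 : ℂ) • toM (corootS i) = ∑ j, (CartanMatrix.E₆ j i : ℂ) • coweight j := by
  ext r c
  rw [Matrix.smul_apply, Matrix.sum_apply, smul_eq_mul]
  simp only [Matrix.smul_apply, coweight, diagonal_apply, smul_eq_mul]
  by_cases h : r = c
  · subst h
    simp only [if_true, toM_apply]
    exact_mod_cast check_coroot i r
  · simp only [if_neg h, mul_zero, Finset.sum_const_zero, mul_eq_zero]
    right
    by_contra hne
    obtain ⟨v, hv⟩ := mem_of_toM_ne_zero hne
    exact h (corootS_diag i _ hv)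

lemma toM_coroot_mem : ∀ i, toM (corootS i) ∈ gE6 := fun i => ⟨genH i, rep_genH i⟩

lemma coweight_mem (i : Fin 6) : coweight i ∈ gE6 := by
  have h : coweight i = ∑ l, (cartanInv i l : ℂ) • toM (corootS l) := by
    have h1 : (3 : ℂ) • coweight i = (3 : ℂ) • ∑ l, (cartanInv i l : ℂ) • toM (corootS l) := by
      rw [Finset.smul_sum]
      simp only [smul_comm (3 : ℂ), toM_corootS, Finset.smul_sum, smul_smul]
      rw [Finset.sum_comm]
      simp only [← Finset.sum_smul, ← Int.cast_mul, ← Int.cast_sum, cartanInv_mul]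
      rw [Finset.sum_eq_single i]
      · simp
      · intro b _ hb; simp [hb.symm]
      · simp
    exact smul_right_injective _ (three_ne_zero) h1
  rw [h]
  exact sum_mem fun l _ => gE6.smul_mem _ (toM_coroot_mem l)

lemma vec_mem (a : Root) : vec a ∈ gE6 := by
  rcases a with k | k
  · exact ⟨_, rep_wordE k⟩
  · obtain ⟨c, hc, h⟩ := rep_wordF k
    refine ⟨c⁻¹ • wordLie genF (word k), ?_⟩
    change rep (c⁻¹ • wordLie genF (word k)) = _
    rw [map_smul, h, smul_smul, inv_mul_cancel₀ hc, one_smul]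
    rfl

lemma bas_mem (j : Idx) : bas j ∈ gE6 := by
  rcases j with a | i
  exacts [vec_mem a, coweight_mem i]

lemma span_bas : Submodule.span ℂ (Set.range bas) = gE6.toSubmodule := by
  refine le_antisymm (Submodule.span_le.mpr ?_) ?_
  · rintro _ ⟨j, rfl⟩; exact bas_mem j
  · have hb : ∀ j, bas j ∈ Submodule.span ℂ (Set.range bas) := fun j =>
      Submodule.subset_span ⟨j, rfl⟩
    have hcr : ∀ i, toM (corootS i) ∈ Submodule.span ℂ (Set.range bas) := fun i => by
      refine (Submodule.smul_mem_iff _ (three_ne_zero (α := ℂ))).mp ?_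
      rw [toM_corootS]
      exact sum_mem fun j _ => Submodule.smul_mem _ _ (hb (.inr j))
    have h : (⊤ : Submodule ℂ (LieAlgebra.e₆ ℂ)) ≤ (Submodule.span ℂ (Set.range bas)).comap
        (rep : LieAlgebra.e₆ ℂ →ₗ[ℂ] Matrix (Fin 27) (Fin 27) ℂ) := by
      rw [← span_eq_top]
      refine sup_le (Submodule.span_le.mpr ?_) (Submodule.span_le.mpr ?_)
      · rintro _ (⟨i, rfl⟩ | ⟨k, rfl⟩)
        · change rep (genH i) ∈ Submodule.span ℂ (Set.range bas)
          rw [rep_genH]; exact hcr i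
        · obtain ⟨c, _, h⟩ := rep_wordF k
          change rep (wordLie genF (word k)) ∈ Submodule.span ℂ (Set.range bas)
          rw [h]; exact Submodule.smul_mem _ _ (hb (.inl (.inr k)))
      · rintro _ (⟨i, rfl⟩ | ⟨k, rfl⟩)
        · change rep (genH i) ∈ Submodule.span ℂ (Set.range bas)
          rw [rep_genH]; exact hcr i
        · change rep (wordLie genE (word k)) ∈ Submodule.span ℂ (Set.range bas)
          rw [rep_wordE]; exact hb (.inl (.inl k))
    rintro _ ⟨x, rfl⟩
    exact h (Submodule.mem_top (x := x))

lemma finrank_gE6 : Module.finrank ℂ gE6.toSubmodule = 78 := by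
  rw [← span_bas, finrank_span_eq_card linearIndependent_bas]; simp

lemma exists_eq_sum {x : Matrix (Fin 27) (Fin 27) ℂ} (hx : x ∈ gE6) :
    ∃ c : Idx → ℂ, x = ∑ j, c j • bas j := by
  have : x ∈ Submodule.span ℂ (Set.range bas) := span_bas ▸ hx
  obtain ⟨c, hc⟩ := (Submodule.mem_span_range_iff_exists_fun ℂ).mp this
  exact ⟨c, hc.symm⟩

instance : Module.Finite ℂ (LieAlgebra.e₆ ℂ) := by
  refine ⟨?_⟩
  rw [← span_eq_top]
  exact (Submodule.fg_span (Set.toFinite _)).sup (Submodule.fg_span (Set.toFinite _))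

lemma finrank_e6_le : Module.finrank ℂ (LieAlgebra.e₆ ℂ) ≤ 78 := by
  let v : (Fin 6 ⊕ Fin 36) ⊕ Fin 36 → LieAlgebra.e₆ ℂ :=
    Sum.elim (Sum.elim genH fun k => wordLie genF (word k)) fun k => wordLie genE (word k)
  have h : Submodule.span ℂ (Set.range v) = ⊤ := by
    rw [eq_top_iff, ← span_eq_top]
    refine sup_le (Submodule.span_mono ?_) (Submodule.span_mono ?_)
    · rintro _ (⟨i, rfl⟩ | ⟨k, rfl⟩)
      exacts [⟨.inl (.inl i), rfl⟩, ⟨.inl (.inr k), rfl⟩]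
    · rintro _ (⟨i, rfl⟩ | ⟨k, rfl⟩)
      exacts [⟨.inl (.inl i), rfl⟩, ⟨.inr k, rfl⟩]
  have h2 := finrank_range_le_card (R := ℂ) v
  rw [Set.finrank, h, finrank_top] at h2
  simpa using h2

/-- The `27`-dimensional representation is faithful. -/
theorem rep_injective : Function.Injective rep := by
  have h1 := LinearMap.finrank_range_add_finrank_ker (rep : LieAlgebra.e₆ ℂ →ₗ[ℂ] Matrix (Fin 27)
    (Fin 27) ℂ)
  have h2 : Module.finrank ℂ (LinearMap.range (rep : LieAlgebra.e₆ ℂ →ₗ[ℂ] Matrix (Fin 27) (Fin 27)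
    ℂ)) = 78 := finrank_gE6
  have h3 := finrank_e6_le
  have h4 : Module.finrank ℂ (LinearMap.ker (rep : LieAlgebra.e₆ ℂ →ₗ[ℂ] Matrix (Fin 27) (Fin 27)
    ℂ)) = 0 := by omega
  exact LinearMap.ker_eq_bot.mp (Submodule.finrank_eq_zero.mp h4)


lemma conjTranspose_bas_mem (j : Idx) : (bas j)ᴴ ∈ gE6 := by
  have h : ∀ a : Sparse (Fin 27), (toM a)ᴴ = toM (tr a) := fun a => by
    rw [toM_tr]
    ext r c
    rw [conjTranspose_apply, transpose_apply, toM_apply]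
    exact map_intCast (starRingEnd ℂ) _
  rcases j with (k | k) | i
  · change (toM (rootS k))ᴴ ∈ _
    rw [h]; exact vec_mem (.inr k)
  · change (toM (tr (rootS k)))ᴴ ∈ _
    rw [h, toM_tr, toM_tr, transpose_transpose]; exact vec_mem (.inl k)
  · change (coweight i)ᴴ ∈ _
    have : (star fun c => (wt27 c i : ℂ)) = fun c => (wt27 c i : ℂ) :=
      funext fun c => map_intCast (starRingEnd ℂ) _
    rw [coweight, diagonal_conjTranspose, this]
    exact coweight_mem i

lemma conjTranspose_mem : ∀ x ∈ gE6, xᴴ ∈ gE6 := fun x hx => by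
  obtain ⟨c, rfl⟩ := exists_eq_sum hx
  rw [conjTranspose_sum]
  refine sum_mem fun j _ => ?_
  rw [conjTranspose_smul]
  exact gE6.smul_mem _ (conjTranspose_bas_mem j)

end E6

namespace E6

attribute [local instance] LieRing.ofAssociativeRing

open Sparse Matrix MatLie

/-- The element of the diagonal torus on which the simple roots take the values `d`. -/
noncomputable def tor (d : Fin 6 → ℂ) : Matrix (Fin 27) (Fin 27) ℂ := ∑ i, (d i / 3) • coweight i

lemma tor_mem (d : Fin 6 → ℂ) : tor d ∈ gE6 :=
  sum_mem fun i _ => gE6.smul_mem _ (coweight_mem i)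

lemma tor_eq (d : Fin 6 → ℂ) : tor d = diagonal fun c => (∑ i, d i * wt27 c i) / 3 := by
  ext r c
  rw [tor, Matrix.sum_apply]
  simp only [Matrix.smul_apply, coweight, diagonal_apply, smul_eq_mul]
  by_cases h : r = c
  · simp only [h, if_true, Finset.sum_div]
    exact Finset.sum_congr rfl fun i _ => by ring
  · simp [h]

lemma Homog.lie_tor {x : Matrix (Fin 27) (Fin 27) ℂ} {β : Fin 6 → ℤ} (h : Homog x β)
    (d : Fin 6 → ℂ) : ⁅tor d, x⁆ = (∑ i, d i * β i) • x := by
  ext r c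
  rw [Ring.lie_def, Matrix.sub_apply, tor_eq, diagonal_mul, mul_diagonal, Matrix.smul_apply,
    smul_eq_mul]
  by_cases hx : x r c = 0
  · simp [hx]
  · have : ∀ i, (wt27 r i : ℂ) - wt27 c i = 3 * β i := fun i => by exact_mod_cast h r c hx i
    rw [mul_comm (x r c), ← sub_mul, ← sub_div, ← Finset.sum_sub_distrib]
    congr 1
    rw [div_eq_iff three_ne_zero, Finset.sum_mul]
    exact Finset.sum_congr rfl fun i _ => by rw [← mul_sub, this]; ring

lemma lie_tor_bas (d : Fin 6 → ℂ) (j : Idx) :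
    ⁅tor d, bas j⁆ = (∑ i, d i * bwt j i) • bas j := (homog_bas j).lie_tor d

lemma lie_tor_sum (d : Fin 6 → ℂ) (c : Idx → ℂ) :
    ⁅tor d, ∑ j, c j • bas j⁆ = ∑ j, (c j * ∑ i, d i * bwt j i) • bas j := by
  rw [lie_sum]
  exact Finset.sum_congr rfl fun j _ => by rw [lie_smul, lie_tor_bas, smul_smul]

lemma coeff_eq {c c' : Idx → ℂ} (h : ∑ j, c j • bas j = ∑ j, c' j • bas j) : c = c' := by
  refine funext fun j => sub_eq_zero.mp (Fintype.linearIndependent_iff.mp linearIndependent_bas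
    (fun j => c j - c' j) ?_ j)
  simp only [sub_smul, Finset.sum_sub_distrib, h, sub_self]

lemma coeff_of_lie_tor {d : Fin 6 → ℂ} {c : Idx → ℂ} {k : ℂ}
    (h : ⁅tor d, ∑ j, c j • bas j⁆ = k • ∑ j, c j • bas j) {j : Idx} (hj : c j ≠ 0) :
    ∑ i, d i * bwt j i = k := by
  rw [lie_tor_sum, Finset.smul_sum] at h
  simp only [smul_smul] at h
  have := congrFun (coeff_eq h) j
  rw [mul_comm] at this
  exact mul_right_cancel₀ hj this

lemma sum_rwt_ne_zero : ∀ a, ∑ i, rwt a i ≠ 0 := by decide +kernel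

lemma exists_eq_tor {x : Matrix (Fin 27) (Fin 27) ℂ} (hx : x ∈ gE6) (h : ⁅x, tor 1⁆ = 0) :
    ∃ d, x = tor d := by
  obtain ⟨c, rfl⟩ := exists_eq_sum hx
  have h1 : ⁅tor 1, ∑ j, c j • bas j⁆ = (0 : ℂ) • ∑ j, c j • bas j := by
    rw [← lie_skew, h, neg_zero, zero_smul]
  have h2 : ∀ a : Root, c (.inl a) = 0 := fun a => by
    by_contra hc
    have := coeff_of_lie_tor h1 hc
    simp only [Pi.one_apply, one_mul] at this
    exact sum_rwt_ne_zero a (by exact_mod_cast this)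
  refine ⟨fun i => 3 * c (.inr i), ?_⟩
  rw [Fintype.sum_sum_type, Finset.sum_eq_zero fun a _ => by rw [h2, zero_smul], zero_add]
  refine Finset.sum_congr rfl fun i _ => ?_
  rw [mul_div_cancel_left₀ _ three_ne_zero]
  rfl

/-- Integral torus elements. -/
noncomputable abbrev torZ (n : Fin 6 → ℤ) : Matrix (Fin 27) (Fin 27) ℂ := tor fun i => n i

/-- The value of the weight of a basis vector on an integral torus element. -/
def ht (n : Fin 6 → ℤ) (j : Idx) : ℤ := ∑ i, n i * bwt j i

lemma lie_torZ_bas (n : Fin 6 → ℤ) (j : Idx) : ⁅torZ n, bas j⁆ = (ht n j : ℂ) • bas j := by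
  rw [lie_tor_bas, ht]; push_cast; rfl

lemma bas_mem_gr (n : Fin 6 → ℤ) (j : Idx) : bas j ∈ gr gE6 (torZ n) (ht n j) :=
  ⟨bas_mem j, lie_torZ_bas n j⟩

lemma exists_of_mem_gr {n : Fin 6 → ℤ} {k : ℤ} {x : Matrix (Fin 27) (Fin 27) ℂ}
    (hx : x ∈ gr gE6 (torZ n) k) :
    ∃ c : Idx → ℂ, x = ∑ j, c j • bas j ∧ ∀ j, c j ≠ 0 → ht n j = k := by
  obtain ⟨c, rfl⟩ := exists_eq_sum hx.1
  refine ⟨c, rfl, fun j hj => ?_⟩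
  have := coeff_of_lie_tor hx.2 hj
  rw [ht]; exact_mod_cast this

lemma grSum_torZ (n : Fin 6 → ℤ) (P : ℤ → Prop) : grSum gE6 (torZ n) P =
    Submodule.span ℂ (Set.range fun j : {j // P (ht n j)} => bas j.1) := by
  refine le_antisymm (grSum_le_iff.mpr fun k hk x hx => ?_) (Submodule.span_le.mpr ?_)
  · obtain ⟨c, rfl, hc⟩ := exists_of_mem_gr hx
    refine sum_mem fun j _ => ?_
    by_cases hj : c j = 0
    · rw [hj, zero_smul]; exact zero_mem _
    · exact Submodule.smul_mem _ _ (Submodule.subset_span ⟨⟨j, by rwa [hc j hj]⟩, rfl⟩)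
  · rintro _ ⟨j, rfl⟩
    exact gr_le_grSum j.2 (bas_mem_gr n j)

lemma finrank_grSum (n : Fin 6 → ℤ) (P : ℤ → Prop) [DecidablePred P] :
    Module.finrank ℂ (grSum gE6 (torZ n) P) =
      (Finset.univ.filter fun j => P (ht n j)).card := by
  have h : LinearIndependent ℂ fun j : {j // P (ht n j)} => bas j.1 :=
    linearIndependent_bas.comp _ Subtype.val_injective
  rw [grSum_torZ, finrank_span_eq_card h, Fintype.card_subtype]

lemma finrank_gr (n : Fin 6 → ℤ) (k : ℤ) :
    Module.finrank ℂ (gr gE6 (torZ n) k) = (Finset.univ.filter fun j => ht n j = k).card := by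
  rw [← grSum_eq, finrank_grSum n (fun l => l = k)]

/-- The centralizer of a matrix in `gE6`. -/
noncomputable def cent (e : Matrix (Fin 27) (Fin 27) ℂ) : Submodule ℂ (Matrix (Fin 27) (Fin 27) ℂ)
    :=
  gE6.toSubmodule ⊓ LinearMap.ker (LieAlgebra.ad ℂ (Matrix (Fin 27) (Fin 27) ℂ) e)

lemma mem_cent {e x : Matrix (Fin 27) (Fin 27) ℂ} : x ∈ cent e ↔ x ∈ gE6 ∧ ⁅e, x⁆ = 0 := Iff.rfl

section

variable {n : Fin 6 → ℤ} {e f : Matrix (Fin 27) (Fin 27) ℂ}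

lemma exists_lie_e_eq_grSum (T : Triple gE6 e (torZ n) f) {z : Matrix (Fin 27) (Fin 27) ℂ}
    (hz : z ∈ grSum gE6 (torZ n) fun k => 2 ≤ k) :
    ∃ x ∈ grSum gE6 (torZ n) fun k => 0 ≤ k, ⁅e, x⁆ = z := by
  have h : grSum gE6 (torZ n) (fun k => 2 ≤ k) ≤ (grSum gE6 (torZ n) fun k => 0 ≤ k).map
      (LieAlgebra.ad ℂ (Matrix (Fin 27) (Fin 27) ℂ) e) := by
    refine grSum_le_iff.mpr fun k hk z hz => ?_
    obtain ⟨x, hx, rfl⟩ := T.exists_lie_e_eq conjTranspose_mem (k := k - 2) (by omega)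
      (z := z) (by rwa [sub_add_cancel])
    exact ⟨x, gr_le_grSum (P := fun k => 0 ≤ k) (by omega) hx, rfl⟩
  exact h hz

lemma finrank_cent (T : Triple gE6 e (torZ n) f) : Module.finrank ℂ (cent e) =
    (Finset.univ.filter fun j => ht n j = 0 ∨ ht n j = 1).card := by
  let G := grSum gE6 (torZ n) fun k => 0 ≤ k
  let φ := (LieAlgebra.ad ℂ (Matrix (Fin 27) (Fin 27) ℂ) e).comp G.subtype
  have hr : LinearMap.range φ = grSum gE6 (torZ n) fun k => 2 ≤ k := by
    refine le_antisymm ?_ fun z hz => ?_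
    · rintro _ ⟨x, rfl⟩
      have := lie_mem_grSum (P := fun k => k = 2) (Q := fun k => 0 ≤ k) (R := fun k => 2 ≤ k)
        (fun k l hk hl => by omega) (by rw [grSum_eq]; exact T.e_mem_gr) x.2
      exact this
    · obtain ⟨x, hx, h⟩ := exists_lie_e_eq_grSum T hz
      exact ⟨⟨x, hx⟩, h⟩
  have hk : (LinearMap.ker φ).map G.subtype = cent e := by
    ext x
    constructor
    · rintro ⟨y, hy, rfl⟩
      exact ⟨grSum_le _ y.2, hy⟩
    · rintro ⟨hx, hex⟩
      exact ⟨⟨x, T.mem_grSum_of_ker hx hex⟩, hex, rfl⟩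
  have h1 := LinearMap.finrank_range_add_finrank_ker φ
  rw [hr, finrank_grSum n (fun k => 2 ≤ k), finrank_grSum n (fun k => 0 ≤ k),
    ← Submodule.finrank_map_subtype_eq, hk] at h1
  rw [← add_right_inj, h1, ← Finset.card_union_of_disjoint]
  · congr 1
    ext j
    simp only [Finset.mem_union, Finset.mem_filter, Finset.mem_univ, true_and]
    omega
  · rw [Finset.disjoint_filter]
    omega

lemma card_le_of_triple (T : Triple gE6 e (torZ n) f) {k : ℤ} (hk : -1 ≤ k) :
    (Finset.univ.filter fun j => ht n j = k + 2).card ≤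
      (Finset.univ.filter fun j => ht n j = k).card := by
  rw [← finrank_gr, ← finrank_gr]
  have : gr gE6 (torZ n) (k + 2) ≤ (gr gE6 (torZ n) k).map
      (LieAlgebra.ad ℂ (Matrix (Fin 27) (Fin 27) ℂ) e) := fun z hz => by
    obtain ⟨x, hx, rfl⟩ := T.exists_lie_e_eq conjTranspose_mem hk hz
    exact ⟨x, hx, rfl⟩
  exact (Submodule.finrank_mono this).trans (Submodule.finrank_map_le _ _)

end

end E6

namespace MatLie

attribute [local instance] LieRing.ofAssociativeRing

open Matrix

variable {n : Type*} [Fintype n] [DecidableEq n] {g : LieSubalgebra ℂ (Matrix n n ℂ)}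

lemma one_add_conj_mem {E x : Matrix n n ℂ} (hE : E ∈ g) (hE2 : E * E = 0) (hx : x ∈ g) :
    (1 + E) * x * (1 - E) ∈ g := by
  have h2 : ⁅E, ⁅E, x⁆⁆ = (-2 : ℂ) • (E * x * E) := by
    have h3 : ⁅E, ⁅E, x⁆⁆ = E * E * x - E * x * E - (E * x * E - x * (E * E)) := by
      simp only [Ring.lie_def]; noncomm_ring
    rw [h3, hE2]
    simp only [zero_mul, mul_zero, zero_sub, sub_zero, neg_smul, two_smul]
    abel
  have h : (1 + E) * x * (1 - E) = x + ⁅E, x⁆ + (2⁻¹ : ℂ) • ⁅E, ⁅E, x⁆⁆ := by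
    rw [h2, smul_smul, show (2⁻¹ * -2 : ℂ) = -1 by norm_num, neg_one_smul, Ring.lie_def]
    noncomm_ring
  rw [h]
  exact g.add_mem (g.add_mem hx (g.lie_mem hE hx)) (g.smul_mem _ (g.lie_mem hE (g.lie_mem hE hx)))

lemma one_sub_conj_mem {E x : Matrix n n ℂ} (hE : E ∈ g) (hE2 : E * E = 0) (hx : x ∈ g) :
    (1 - E) * x * (1 + E) ∈ g := by
  have := one_add_conj_mem (g := g) (E := -E) (g.neg_mem hE) (by simpa using hE2) hx
  simpa [sub_eq_add_neg] using this

/-- The diagonal semisimple element of a triple has integer entries. -/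
lemma Triple.exists_int {e f : Matrix n n ℂ} {μ : n → ℂ} (T : Triple g e (diagonal μ) f) (c : n) :
    ∃ m : ℤ, μ c = m := by
  by_contra! hc
  have h : (⊤ : Submodule ℂ (n → ℂ)) ≤ LinearMap.ker (LinearMap.proj c : (n → ℂ) →ₗ[ℂ] ℂ) := by
    rw [← T.iSup_eigenspace_vec]
    refine iSup_le fun k v hv => ?_
    have h1 := congrFun (Module.End.mem_eigenspace_iff.mp hv) c
    rw [toLin'_apply, mulVec_diagonal, Pi.smul_apply, smul_eq_mul] at h1
    exact (mul_eq_mul_right_iff.mp h1).resolve_left (hc k)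
  have h2 : (Pi.single c 1 : n → ℂ) c = 0 := h (Submodule.mem_top (x := Pi.single c 1))
  simp at h2

end MatLie

namespace E6

attribute [local instance] LieRing.ofAssociativeRing

open Sparse Matrix MatLie

lemma check_simple_root : ∀ i, isZero (mul (rootS (sim i)) (rootS (sim i))) ∧
    eqv (mul (rootS (sim i)) (mul (tr (rootS (sim i))) (rootS (sim i)))) (rootS (sim i)) := by
  decide +kernel

lemma conjTranspose_toM (a : Sparse (Fin 27)) : (toM a)ᴴ = toM (tr a) := by
  rw [toM_tr]
  ext r c
  rw [conjTranspose_apply, transpose_apply, toM_apply]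
  exact map_intCast (starRingEnd ℂ) _

/-- Representatives of the simple reflections. -/
noncomputable def weyl (i : Fin 6) : Matrix (Fin 27) (Fin 27) ℂ :=
  (1 + vec (.inl (sim i))) * (1 - vec (.inr (sim i))) * (1 + vec (.inl (sim i)))

section

variable (i : Fin 6)

local notation "E" => vec (Sum.inl (sim i))
local notation "F" => vec (Sum.inr (sim i))
local notation "w" => weyl i

lemma E_mul_E : E * E = 0 := by
  rw [vec, ← toM_mul]; exact toM_eq_zero (check_simple_root i).1

lemma conjTranspose_E : Eᴴ = F := conjTranspose_toM _

lemma conjTranspose_F : Fᴴ = E := by rw [← conjTranspose_E, conjTranspose_conjTranspose]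

lemma F_mul_F : F * F = 0 := by
  rw [← conjTranspose_E, ← conjTranspose_mul, E_mul_E, conjTranspose_zero]

lemma lie_E_F : ⁅E, F⁆ = toM (corootS i) := (toM_br _ _).symm

lemma E_mul_E_mul (x : Matrix (Fin 27) (Fin 27) ℂ) : E * (E * x) = 0 := by
  rw [← mul_assoc, E_mul_E, zero_mul]

lemma F_mul_F_mul (x : Matrix (Fin 27) (Fin 27) ℂ) : F * (F * x) = 0 := by
  rw [← mul_assoc, F_mul_F, zero_mul]

lemma E_mul_F_mul_E : E * (F * E) = E := by
  change toM (rootS _) * (toM (tr (rootS _)) * toM (rootS _)) = toM (rootS _)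
  rw [← toM_mul, ← toM_mul]; exact toM_eq (check_simple_root i).2

lemma F_mul_E_mul_F : F * (E * F) = F := by
  have := congrArg conjTranspose (E_mul_F_mul_E i)
  rwa [conjTranspose_mul, conjTranspose_mul, conjTranspose_E, conjTranspose_F, mul_assoc] at this

lemma conjTranspose_weyl : wᴴ = (1 - E) * (1 + F) * (1 - E) := by
  have h : wᴴ = (1 + F) * ((1 - E) * (1 + F)) := by
    rw [weyl, conjTranspose_mul, conjTranspose_mul, conjTranspose_add, conjTranspose_sub,
      conjTranspose_one, conjTranspose_E, conjTranspose_F]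
  rw [h]
  simp only [mul_add, add_mul, mul_sub, sub_mul, mul_one, one_mul,
    mul_assoc, E_mul_E, F_mul_F, E_mul_F_mul_E, F_mul_E_mul_F]
  abel

lemma weyl_mem : w ∈ unitaryAut gE6 := by
  refine ⟨?_, fun x hx => ?_⟩
  · have h1 : (1 - E) * (1 + E) = 1 := by
      simp only [mul_add, sub_mul, mul_one, one_mul, E_mul_E]; abel
    have h2 : (1 + F) * (1 - F) = 1 := by
      simp only [mul_sub, add_mul, mul_one, one_mul, F_mul_F]; abel
    rw [conjTranspose_weyl, weyl]
    calc _ = (1 - E) * ((1 + F) * ((1 - E) * (1 + E)) * (1 - F)) * (1 + E) := by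
          simp only [mul_assoc]
      _ = 1 := by rw [h1, mul_one, h2, mul_one, h1]
  · have hE := E_mul_E i
    have hF := F_mul_F i
    have mE := vec_mem (Sum.inl (sim i))
    have mF := vec_mem (Sum.inr (sim i))
    constructor
    · have := one_add_conj_mem mE hE (one_sub_conj_mem mF hF (one_add_conj_mem mE hE hx))
      rw [conjTranspose_weyl, weyl]
      simpa only [mul_assoc] using this
    · have := one_sub_conj_mem mE hE (one_add_conj_mem mF hF (one_sub_conj_mem mE hE hx))
      rw [conjTranspose_weyl, weyl]
      simpa only [mul_assoc] using this

lemma weyl_mul_coroot : w * toM (corootS i) * wᴴ = -toM (corootS i) := by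
  have h : w * wᴴ = 1 := mul_eq_one_comm.mp (weyl_mem i).1
  have h2 : w * toM (corootS i) = -toM (corootS i) * w := by
    rw [← lie_E_F, Ring.lie_def]
    simp only [weyl, mul_add, add_mul, mul_sub, sub_mul, mul_one, one_mul, mul_assoc, E_mul_E,
      F_mul_F, E_mul_E_mul, F_mul_F_mul, E_mul_F_mul_E, F_mul_E_mul_F, neg_mul, mul_zero, zero_mul]
    abel
  rw [h2, mul_assoc, h, mul_one]

lemma lie_tor_E (d : Fin 6 → ℂ) : ⁅tor d, E⁆ = d i • E := by
  rw [(homog_vec _).lie_tor, Finset.sum_eq_single i]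
  · rw [rwt_sim, if_pos rfl, Int.cast_one, mul_one]
  · intro l _ hl; rw [rwt_sim, if_neg hl.symm, Int.cast_zero, mul_zero]
  · simp

lemma rwt_sim' (l : Fin 6) : rwt (.inr (sim i)) l = if i = l then -1 else 0 := by
  have : rwt (.inr (sim i)) l = - rwt (.inl (sim i)) l := rfl
  rw [this, rwt_sim]
  split_ifs <;> simp

lemma lie_tor_F (d : Fin 6 → ℂ) : ⁅tor d, F⁆ = -(d i • F) := by
  rw [(homog_vec _).lie_tor, Finset.sum_eq_single i, ← neg_smul]
  · rw [rwt_sim', if_pos rfl, Int.cast_neg, Int.cast_one, mul_neg_one]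
  · intro l _ hl; rw [rwt_sim', if_neg hl.symm, Int.cast_zero, mul_zero]
  · simp

lemma check_coroot_E : ∀ i, eqv (br (corootS i) (rootS (sim i))) (smul 2 (rootS (sim i))) := by
  decide +kernel

lemma lie_coroot_E : ⁅toM (corootS i), E⁆ = (2 : ℂ) • E := by
  rw [vec, ← toM_br, ← Int.cast_ofNat, ← toM_smul]; exact toM_eq (check_coroot_E i)

lemma conjTranspose_coroot : (toM (corootS i))ᴴ = toM (corootS i) := by
  rw [← lie_E_F, Ring.lie_def, conjTranspose_sub, conjTranspose_mul, conjTranspose_mul,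
    conjTranspose_E, conjTranspose_F]

lemma lie_coroot_F : ⁅toM (corootS i), F⁆ = -((2 : ℂ) • F) := by
  have := congrArg conjTranspose (lie_coroot_E i)
  rw [Ring.lie_def, conjTranspose_sub, conjTranspose_mul, conjTranspose_mul, conjTranspose_E,
    conjTranspose_coroot, conjTranspose_smul, conjTranspose_E] at this
  rw [Ring.lie_def, ← neg_sub, this]
  simp

lemma weyl_tor (d : Fin 6 → ℂ) : w * tor d * wᴴ = tor d - d i • toM (corootS i) := by
  set x := tor d - (d i / 2) • toM (corootS i) with hx
  have h1 : E * x = x * E := by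
    have : ⁅x, E⁆ = 0 := by
      rw [hx, sub_lie, smul_lie, lie_tor_E, lie_coroot_E, smul_smul, div_mul_cancel₀ _ two_ne_zero,
        sub_self]
    rw [Ring.lie_def, sub_eq_zero] at this
    exact this.symm
  have h2 : F * x = x * F := by
    have : ⁅x, F⁆ = 0 := by
      rw [hx, sub_lie, smul_lie, lie_tor_F, lie_coroot_F, smul_neg, smul_smul,
        div_mul_cancel₀ _ two_ne_zero, sub_self]
    rw [Ring.lie_def, sub_eq_zero] at this
    exact this.symm
  have c1 : Commute E x := h1
  have c2 : Commute F x := h2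
  have c : Commute w x := by
    rw [weyl]
    exact (((Commute.one_left x).add_left c1).mul_left ((Commute.one_left x).sub_left c2)).mul_left
      ((Commute.one_left x).add_left c1)
  have h : w * wᴴ = 1 := mul_eq_one_comm.mp (weyl_mem i).1
  have h3 : tor d = x + (d i / 2) • toM (corootS i) := by rw [hx, sub_add_cancel]
  rw [h3, mul_add, add_mul, c.eq, mul_assoc, h, mul_one, mul_smul_comm, smul_mul_assoc,
    weyl_mul_coroot, add_sub_assoc, ← sub_smul, smul_neg, ← neg_smul]
  congr 2
  ring

open scoped ComplexOrder in
lemma trace_coroot_mul_pos : 0 < ((toM (corootS i) * tor 1).trace).re := by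
  have h1 : (toM (corootS i) * tor 1).trace = (E * Eᴴ).trace := by
    rw [← lie_E_F, ← neg_neg ⁅E, F⁆, lie_skew, neg_mul, trace_neg, trace_lie_mul, neg_neg,
      conjTranspose_E]
    rw [← lie_skew, lie_tor_F, Pi.one_apply, one_smul, neg_neg]
  have h2 : (E * Eᴴ).trace ≠ 0 := fun h => vec_piv (Sum.inl (sim i)) (by
    rw [trace_mul_conjTranspose_self_eq_zero_iff] at h
    rw [h]; rfl)
  have h3 : 0 ≤ (E * Eᴴ).trace := (posSemidef_self_mul_conjTranspose E).trace_nonneg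
  rw [h1]
  exact (Complex.pos_iff.mp (lt_of_le_of_ne h3 h2.symm)).1

end

end E6

namespace E6

attribute [local instance] LieRing.ofAssociativeRing

open Sparse Matrix MatLie

lemma conjTranspose_tor_one : (tor 1).IsHermitian := by
  rw [tor_eq, IsHermitian, diagonal_conjTranspose]
  congr 1
  funext c
  simp

lemma rwt_inl_nonneg : ∀ k i, 0 ≤ rwt (.inl k) i := fun _ _ => Int.natCast_nonneg _

lemma rwt_inr_nonpos : ∀ k i, rwt (.inr k) i ≤ 0 := fun _ _ =>
  neg_nonpos.mpr (Int.natCast_nonneg _)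

lemma sum_wt27_mul_pos : ∀ i l, 0 < ∑ c, wt27 c l * wt27 c i := by decide +kernel

lemma trace_coweight_mul_tor (i : Fin 6) (d : Fin 6 → ℂ) :
    (coweight i * tor d).trace = (∑ l, d l * (∑ c, wt27 c l * wt27 c i : ℤ)) / 3 := by
  rw [tor_eq, coweight, diagonal_mul_diagonal, trace_diagonal]
  push_cast
  simp only [Finset.mul_sum, Finset.sum_div]
  rw [Finset.sum_comm]
  exact Finset.sum_congr rfl fun l _ => Finset.sum_congr rfl fun c _ => by ring

lemma trace_mul_tor_eq_zero {e f h z : Matrix (Fin 27) (Fin 27) ℂ} (T : Triple gE6 e h f)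
    (hz : ⁅z, e⁆ = 0) : (z * h).trace = 0 := by
  rw [← T.lie_ef, ← neg_neg (z * ⁅e, f⁆).trace, ← trace_lie_mul, ← lie_skew, hz]
  simp

lemma lie_eq_zero_of_support {n : Fin 6 → ℤ} {k : ℤ} {e : Matrix (Fin 27) (Fin 27) ℂ}
    (he : e ∈ gr gE6 (torZ n) k) {d : Fin 6 → ℂ}
    (hd : ∀ j, ht n j = k → ∑ i, d i * bwt j i = 0) : ⁅tor d, e⁆ = 0 := by
  obtain ⟨c, rfl, hc⟩ := exists_of_mem_gr he
  rw [lie_tor_sum]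
  refine Finset.sum_eq_zero fun j _ => ?_
  by_cases hj : c j = 0
  · rw [hj, zero_mul, zero_smul]
  · rw [hd j (hc j hj), mul_zero, zero_smul]

lemma le_two_of_triple {n : Fin 6 → ℤ} {e f : Matrix (Fin 27) (Fin 27) ℂ}
    (T : Triple gE6 e (torZ n) f) (hn : ∀ i, 0 ≤ n i) (i : Fin 6) : n i ≤ 2 := by
  by_contra! hi
  have hb : ∀ j, ht n j = 2 → bwt j i = 0 := fun j hj => by
    rcases j with (k | k) | l
    · have h1 : n i * rwt (.inl k) i ≤ ∑ l, n l * rwt (.inl k) l :=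
        Finset.single_le_sum (f := fun l => n l * rwt (.inl k) l)
          (fun l _ => mul_nonneg (hn l) (rwt_inl_nonneg k l)) (Finset.mem_univ i)
      have h2 : ∑ l, n l * rwt (.inl k) l = 2 := hj
      have h3 := rwt_inl_nonneg k i
      change rwt (.inl k) i = 0
      by_contra hne
      have h4 : 1 ≤ rwt (.inl k) i := by omega
      nlinarith
    · have h1 : ∑ l, n l * rwt (.inr k) l ≤ 0 :=
        Finset.sum_nonpos fun l _ => mul_nonpos_of_nonneg_of_nonpos (hn l) (rwt_inr_nonpos k l)
      have h2 : ∑ l, n l * rwt (.inr k) l = 2 := hj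
      omega
    · rfl
  have h1 : ⁅tor (Pi.single i 3), e⁆ = 0 := lie_eq_zero_of_support T.e_mem_gr fun j hj => by
    rw [Finset.sum_eq_single i]
    · rw [hb j hj]; simp
    · intro l _ hl; simp [hl]
    · simp
  have h2 : tor (Pi.single i 3) = coweight i := by
    rw [tor, Finset.sum_eq_single i]
    · simp
    · intro l _ hl; simp [hl]
    · simp
  rw [h2] at h1
  have h3 := trace_mul_tor_eq_zero T h1
  rw [trace_coweight_mul_tor, div_eq_zero_iff, or_iff_left three_ne_zero] at h3
  have h4 : ∑ l, n l * ∑ c, wt27 c l * wt27 c i = 0 := by exact_mod_cast h3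
  have h5 : n i * ∑ c, wt27 c i * wt27 c i ≤ ∑ l, n l * ∑ c, wt27 c l * wt27 c i :=
    Finset.single_le_sum (f := fun l => n l * ∑ c, wt27 c l * wt27 c i)
      (fun l _ => mul_nonneg (hn l) (sum_wt27_mul_pos i l).le) (Finset.mem_univ i)
  have h6 := sum_wt27_mul_pos i i
  nlinarith

/-- Every nilpotent element is conjugate to the nilpositive element of a triple whose
semisimple element is a dominant integral torus element with values in `{0, 1, 2}`. -/
theorem exists_standard {e : Matrix (Fin 27) (Fin 27) ℂ} (he : e ∈ gE6) (hnil : IsNilpotent e) :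
    ∃ u ∈ autGroup gE6, ∃ n : Fin 6 → ℤ, ∃ f, Triple gE6 (cj u e) (torZ n) f ∧
      (∀ i, 0 ≤ n i ∧ n i ≤ 2) ∧ ∀ c, (3 : ℤ) ∣ ∑ i, n i * wt27 c i := by
  obtain ⟨u, hu, h, f, T, hD, hmax⟩ := exists_triple_commute conjTranspose_mem he hnil
    (tor_mem 1) conjTranspose_tor_one
  obtain ⟨d, rfl⟩ := exists_eq_tor T.h_mem hD
  have h_int : ∀ c, ∃ m : ℤ, (∑ i, d i * wt27 c i) / 3 = m := by
    rw [tor_eq] at T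
    exact T.exists_int
  choose m hm using h_int
  let n : Fin 6 → ℤ := fun i => m (piv (.inl (sim i))).1 - m (piv (.inl (sim i))).2
  have hd : d = fun i => (n i : ℂ) := by
    funext i
    simp only [n]
    push_cast
    rw [← hm, ← hm, ← sub_div, ← Finset.sum_sub_distrib, eq_div_iff three_ne_zero]
    simp only [← mul_sub, ← Int.cast_sub, piv_wt, rwt_sim]
    simp
  subst hd
  have h0 : ∀ i, 0 ≤ n i := fun i => by
    have h1 := hmax _ (weyl_mem i)
    rw [weyl_tor, sub_mul, trace_sub, smul_mul_assoc, trace_smul, Complex.sub_re, smul_eq_mul,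
      ← Complex.ofReal_intCast, Complex.re_ofReal_mul] at h1
    have h2 := trace_coroot_mul_pos i
    have h3 : (0 : ℝ) ≤ n i := by
      by_contra! hneg
      nlinarith
    exact_mod_cast h3
  refine ⟨u, hu, n, f, T, fun i => ⟨h0 i, le_two_of_triple T h0 i⟩, fun c => ⟨m c, ?_⟩⟩
  have := hm c
  rw [div_eq_iff three_ne_zero] at this
  beta_reduce at this
  rw [mul_comm]
  exact_mod_cast this

end E6

namespace E6

attribute [local instance] LieRing.ofAssociativeRing

open Sparse Matrix MatLie

section Irreducible

lemma check_wt27 : ∀ c c', c ≠ c' → ∃ i, wt27 c i ≠ wt27 c' i := by decide +kernel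

/-- A subspace stable under the torus contains the coordinate vectors of its elements. -/
lemma single_mem {N : Submodule ℂ (Fin 27 → ℂ)} (hN : ∀ x ∈ gE6, ∀ v ∈ N, x *ᵥ v ∈ N)
    {v : Fin 27 → ℂ} (hv : v ∈ N) {c : Fin 27} (hc : v c ≠ 0) : Pi.single c 1 ∈ N := by
  have key : ∀ S : Finset (Fin 27), c ∉ S → ∃ w ∈ N, w c ≠ 0 ∧ ∀ c' ∈ S, w c' = 0 := by
    intro S
    induction S using Finset.induction_on with
    | empty => exact fun _ => ⟨v, hv, hc, by simp⟩
    | insert c' S hc' ih =>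
      intro hS
      rw [Finset.mem_insert, not_or] at hS
      obtain ⟨w, hw, hwc, h0⟩ := ih hS.2
      obtain ⟨i, hi⟩ := check_wt27 c c' hS.1
      have happ : ∀ r, (coweight i *ᵥ w - (wt27 c' i : ℂ) • w) r =
          ((wt27 r i : ℂ) - wt27 c' i) * w r := fun r => by
        rw [Pi.sub_apply, coweight, mulVec_diagonal, Pi.smul_apply, smul_eq_mul, sub_mul]
      refine ⟨coweight i *ᵥ w - (wt27 c' i : ℂ) • w,
        N.sub_mem (hN _ (coweight_mem i) _ hw) (N.smul_mem _ hw), ?_, fun r hr => ?_⟩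
      · rw [happ]
        exact mul_ne_zero (sub_ne_zero.mpr (by exact_mod_cast hi)) hwc
      · rw [happ]
        rcases Finset.mem_insert.mp hr with rfl | hr
        · rw [sub_self, zero_mul]
        · rw [h0 r hr, mul_zero]
  obtain ⟨w, hw, hwc, h0⟩ := key (Finset.univ.erase c) (by simp)
  have : Pi.single c 1 = (w c)⁻¹ • w := by
    funext r
    rw [Pi.smul_apply, smul_eq_mul]
    by_cases h : r = c
    · subst h; rw [Pi.single_eq_same, inv_mul_cancel₀ hwc]
    · rw [Pi.single_eq_of_ne h, h0 r (by simp [h]), mul_zero]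
  rw [this]
  exact N.smul_mem _ hw

lemma check_connected : ∀ c : Fin 27, c ≠ 0 → ∃ p < c, ∃ i, ((rootS (sim i)).map fun t =>
    if t.1 = p ∧ t.2.1 = c then t.2.2 else 0).sum ≠ 0 := by decide +kernel

/-- The `27`-dimensional representation is irreducible. -/
lemma eq_top_of_invariant {N : Submodule ℂ (Fin 27 → ℂ)}
    (hN : ∀ x ∈ gE6, ∀ v ∈ N, x *ᵥ v ∈ N) (h0 : N ≠ ⊥) : N = ⊤ := by
  have hadj : ∀ a r c, vec a r c ≠ 0 → (Pi.single c 1 : Fin 27 → ℂ) ∈ N → Pi.single r 1 ∈ N :=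
    fun a r c ha hc => single_mem hN (hN _ (vec_mem a) _ hc) (by
      rw [mulVec_single_one]; exact ha)
  have hpar : ∀ c : Fin 27, c ≠ 0 → ∃ p < c, ∃ a b, vec a p c ≠ 0 ∧ vec b c p ≠ 0 := fun c hc => by
    obtain ⟨p, hp, i, hi⟩ := check_connected c hc
    have h1 : vec (.inl (sim i)) p c ≠ 0 := by
      change toM (rootS (sim i)) p c ≠ 0
      rw [toM_apply]; exact_mod_cast hi
    refine ⟨p, hp, .inl (sim i), .inr (sim i), h1, ?_⟩
    rw [← conjTranspose_E, conjTranspose_apply]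
    exact star_ne_zero.mpr h1
  have hup : ∀ c : Fin 27, (Pi.single c 1 : Fin 27 → ℂ) ∈ N → (Pi.single 0 1 : Fin 27 → ℂ) ∈ N := by
    intro c
    induction c using WellFoundedLT.induction with | _ c ih
    intro hc
    by_cases h : c = 0
    · rwa [h] at hc
    · obtain ⟨p, hp, a, b, ha, hb⟩ := hpar c h
      exact ih p hp (hadj a p c ha hc)
  obtain ⟨v, hv, hv0⟩ := Submodule.exists_mem_ne_zero_of_ne_bot h0
  obtain ⟨c, hc⟩ := Function.ne_iff.mp hv0
  have hdown : ∀ c : Fin 27, (Pi.single c 1 : Fin 27 → ℂ) ∈ N := by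
    intro c'
    induction c' using WellFoundedLT.induction with | _ c' ih
    by_cases h : c' = 0
    · rw [h]; exact hup c (single_mem hN hv hc)
    · obtain ⟨p, hp, a, b, ha, hb⟩ := hpar c' h
      exact hadj b c' p hb (ih p hp)
  rw [eq_top_iff]
  intro w _
  rw [pi_eq_sum_univ' w]
  exact sum_mem fun i _ => N.smul_mem _ (by convert hdown i using 1)

lemma sum_wt27 : ∀ i, ∑ c, wt27 c i = 0 := by decide +kernel

lemma trace_eq_zero {x : Matrix (Fin 27) (Fin 27) ℂ} (hx : x ∈ gE6) : x.trace = 0 := by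
  obtain ⟨c, rfl⟩ := exists_eq_sum hx
  rw [trace_sum]
  refine Finset.sum_eq_zero fun j _ => ?_
  rw [trace_smul, smul_eq_zero]
  right
  rcases j with a | i
  · refine Finset.sum_eq_zero fun r _ => ?_
    by_contra h
    obtain ⟨i, hi⟩ := rwt_ne_zero a
    have := homog_vec a r r h i
    omega
  · change (coweight i).trace = 0
    rw [coweight, trace_diagonal]
    exact_mod_cast sum_wt27 i

end Irreducible

/-- Ad-nilpotent elements of `e₆` act nilpotently on the `27`-dimensional representation. -/
theorem isNilpotent_rep {e : LieAlgebra.e₆ ℂ}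
    (hnil : IsNilpotent (LieAlgebra.ad ℂ (LieAlgebra.e₆ ℂ) e)) : IsNilpotent (rep e) := by
  set x : Module.End ℂ (Fin 27 → ℂ) := toLin' (rep e) with hx
  obtain ⟨μ, hμ⟩ := Module.End.exists_eigenvalue x
  set N := x.maxGenEigenspace μ with hN
  have hadj : ∀ (k : ℕ) (y : LieAlgebra.e₆ ℂ),
      ((LieAlgebra.ad ℂ (Module.End ℂ (Fin 27 → ℂ)) x) ^ k) (toLin' (rep y)) =
        toLin' (rep (((LieAlgebra.ad ℂ (LieAlgebra.e₆ ℂ) e) ^ k) y)) := fun k y => by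
    induction k with
    | zero => rfl
    | succ k ih =>
      rw [pow_succ', pow_succ', Module.End.mul_apply, Module.End.mul_apply, ih,
        LieAlgebra.ad_apply, LieAlgebra.ad_apply, LieHom.map_lie, Ring.lie_def, Ring.lie_def,
        map_sub, toLin'_mul, toLin'_mul]
      rfl
  have hinv : ∀ y ∈ gE6, ∀ v ∈ N, y *ᵥ v ∈ N := by
    rintro _ ⟨y, rfl⟩ v hv
    have h1 : toLin' (rep y) ∈
        (LieModule.toEnd ℂ (Module.End ℂ (Fin 27 → ℂ)) (Module.End ℂ (Fin 27 →
          ℂ)) x).maxGenEigenspace 0 := by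
      rw [Module.End.mem_maxGenEigenspace]
      obtain ⟨k, hk⟩ := hnil
      refine ⟨k, ?_⟩
      have h0 : ∀ T : Module.End ℂ (Module.End ℂ (Fin 27 → ℂ)), T - (0 : ℂ) • 1 = T := fun T => by
        rw [zero_smul]; exact sub_zero T
      rw [h0]
      refine (hadj k y).trans ?_
      rw [hk, LinearMap.zero_apply, map_zero, map_zero]
    have h2 := LieModule.lie_mem_maxGenEigenspace_toEnd (M := Fin 27 → ℂ) h1 (χ₂ := μ) (m := v) (by
      rwa [LieModule.toEnd_module_end])
    rwa [zero_add, LieModule.toEnd_module_end] at h2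
  have hbot : N ≠ ⊥ := by
    intro h
    refine hμ (eq_bot_iff.mpr ?_)
    rw [← h]
    exact Module.End.genEigenspace_le_maximal x μ 1
  have htop := eq_top_of_invariant hinv hbot
  have hn : IsNilpotent (x - μ • (1 : Module.End ℂ (Fin 27 → ℂ))) := by
    rw [Module.End.isNilpotent_iff_of_finite]
    intro m
    exact (Module.End.mem_maxGenEigenspace x μ m).mp (by rw [← hN, htop]; trivial)
  have hμ0 : μ = 0 := by
    have h1 := (LinearMap.isNilpotent_trace_of_isNilpotent hn).eq_zero
    have h2 : LinearMap.trace ℂ (Fin 27 → ℂ) x = 0 := by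
      rw [hx, trace_toLin'_eq]; exact trace_eq_zero ⟨e, rfl⟩
    rw [map_sub, map_smul, h2, LinearMap.trace_one] at h1
    simpa using h1
  rw [hμ0, zero_smul, sub_zero] at hn
  obtain ⟨k, hk⟩ := hn
  exact ⟨k, by rwa [hx, ← toLin'_pow, LinearEquiv.map_eq_zero_iff] at hk⟩

/-- The span of the brackets of elements of the centralizer. -/
noncomputable def derivedM (e : Matrix (Fin 27) (Fin 27) ℂ) :
    Submodule ℂ (Matrix (Fin 27) (Fin 27) ℂ) :=
  Submodule.span ℂ {z | ∃ x ∈ cent e, ∃ y ∈ cent e, ⁅x, y⁆ = z}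

section Transport

variable (Φ : LieAlgebra.e₆ ℂ →ₗ[ℂ] Matrix (Fin 27) (Fin 27) ℂ) (hinj : Function.Injective Φ)
  (hlie : ∀ x y, Φ ⁅x, y⁆ = ⁅Φ x, Φ y⁆) (hrange : ∀ z, z ∈ gE6 ↔ ∃ x, Φ x = z)

include hinj hlie hrange

lemma map_centralizer (e : LieAlgebra.e₆ ℂ) : (centralizer e).map Φ = cent (Φ e) := by
  ext z
  rw [mem_cent, hrange, Submodule.mem_map]
  constructor
  · rintro ⟨x, hx, rfl⟩
    refine ⟨⟨x, rfl⟩, ?_⟩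
    have hx' : ⁅e, x⁆ = 0 := hx
    rw [← hlie, hx', map_zero]
  · rintro ⟨⟨x, rfl⟩, hx⟩
    rw [← hlie, ← map_zero Φ] at hx
    exact ⟨x, hinj hx, rfl⟩

lemma map_derived (e : LieAlgebra.e₆ ℂ) : (derived e).map Φ = derivedM (Φ e) := by
  rw [derived, Submodule.map_span, derivedM, ← map_centralizer Φ hinj hlie hrange]
  congr 1
  ext z
  constructor
  · rintro ⟨_, ⟨x, hx, y, hy, rfl⟩, rfl⟩
    exact ⟨Φ x, ⟨x, hx, rfl⟩, Φ y, ⟨y, hy, rfl⟩, (hlie x y).symm⟩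
  · rintro ⟨_, ⟨x, hx, rfl⟩, _, ⟨y, hy, rfl⟩, rfl⟩
    exact ⟨⁅x, y⁆, ⟨x, hx, y, hy, rfl⟩, hlie x y⟩

lemma derived_eq_iff (e : LieAlgebra.e₆ ℂ) :
    derived e = centralizer e ↔ derivedM (Φ e) = cent (Φ e) := by
  rw [← map_derived Φ hinj hlie hrange, ← map_centralizer Φ hinj hlie hrange]
  exact (Submodule.map_injective_of_injective hinj).eq_iff.symm

lemma finrank_centralizer (e : LieAlgebra.e₆ ℂ) :
    Module.finrank ℂ (centralizer e) = Module.finrank ℂ (cent (Φ e)) := by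
  rw [← map_centralizer Φ hinj hlie hrange]
  exact (Submodule.equivMapOfInjective Φ hinj (centralizer e)).finrank_eq

end Transport

/-- Conjugation composed with the representation. -/
noncomputable def conjRep (u : (Matrix (Fin 27) (Fin 27) ℂ)ˣ) :
    LieAlgebra.e₆ ℂ →ₗ[ℂ] Matrix (Fin 27) (Fin 27) ℂ where
  toFun x := cj u (rep x)
  map_add' x y := by rw [map_add, cj_add]
  map_smul' c x := by rw [map_smul, cj_smul]; rfl

lemma conjRep_injective (u : (Matrix (Fin 27) (Fin 27) ℂ)ˣ) : Function.Injective (conjRep u) :=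
  fun x y h => rep_injective (by
    have := congrArg (cj u⁻¹) (show cj u (rep x) = cj u (rep y) from h)
    rwa [cj_inv_cj, cj_inv_cj] at this)

lemma conjRep_lie (u : (Matrix (Fin 27) (Fin 27) ℂ)ˣ) (x y : LieAlgebra.e₆ ℂ) :
    conjRep u ⁅x, y⁆ = ⁅conjRep u x, conjRep u y⁆ := by
  change cj u (rep ⁅x, y⁆) = _
  rw [LieHom.map_lie, cj_lie]; rfl

lemma mem_gE6_iff {u : (Matrix (Fin 27) (Fin 27) ℂ)ˣ} (hu : u ∈ autGroup gE6)
    (z : Matrix (Fin 27) (Fin 27) ℂ) : z ∈ gE6 ↔ ∃ x, conjRep u x = z := by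
  constructor
  · intro hz
    obtain ⟨x, hx⟩ := (cj_mem (inv_mem hu)).mpr hz
    refine ⟨x, ?_⟩
    change cj u (rep x) = z
    rw [show rep x = cj u⁻¹ z from hx, cj_cj_inv]
  · rintro ⟨x, rfl⟩
    exact (cj_mem hu).mpr ⟨x, rfl⟩

end E6

namespace MatLie

attribute [local instance] LieRing.ofAssociativeRing

open Matrix

/-- If `μ` is not a natural number, the nilpositive element of a triple is injective on the
`μ`-eigenspace, which bounds numbers of coordinate vectors. -/
lemma card_le_of_weight {n : Type*} [Fintype n] [DecidableEq n] {e h f : Matrix n n ℂ}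
    (hhe : h * e - e * h = (2 : ℂ) • e) (hef : e * f - f * e = h) (hnil : IsNilpotent e) {μ : ℂ}
    (hμ : ∀ k : ℕ, μ ≠ k) (D R : Finset n) (hD : ∀ c ∈ D, ∀ r, h r c = if r = c then μ else 0)
    (hR : ∀ c ∈ D, ∀ r ∉ R, e r c = 0) : D.card ≤ R.card := by
  by_contra! hlt
  let ψ : (D → ℂ) →ₗ[ℂ] (R → ℂ) := toLin' (e.submatrix (fun r : R => r.1) fun c : D => c.1)
  obtain ⟨w, hw, hw0⟩ := Submodule.exists_mem_ne_zero_of_ne_bot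
    (LinearMap.ker_ne_bot_of_finrank_lt (f := ψ) (by simpa using hlt))
  let v : n → ℂ := fun c => if hc : c ∈ D then w ⟨c, hc⟩ else 0
  have hsum : ∀ g : n → ℂ, ∑ c, g c * v c = ∑ c : D, g c.1 * w c := fun g => by
    rw [← Finset.sum_subset (Finset.subset_univ D), ← Finset.sum_coe_sort D]
    · exact Finset.sum_congr rfl fun c _ => by simp [v]
    · intro c _ hc
      simp [v, hc]
  have hv0 : v ≠ 0 := by
    obtain ⟨c, hc⟩ := Function.ne_iff.mp hw0
    exact Function.ne_iff.mpr ⟨c.1, by simpa [v] using hc⟩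
  have hev : e *ᵥ v = 0 := by
    funext r
    rw [mulVec, dotProduct, hsum, Pi.zero_apply]
    by_cases hr : r ∈ R
    · exact congrFun hw ⟨r, hr⟩
    · exact Finset.sum_eq_zero fun c _ => by rw [hR c.1 c.2 r hr, zero_mul]
  have hhv : h *ᵥ v = μ • v := by
    funext r
    rw [mulVec, dotProduct, hsum, Pi.smul_apply, smul_eq_mul]
    by_cases hr : r ∈ D
    · rw [Finset.sum_eq_single ⟨r, hr⟩, hD r hr, if_pos rfl]
      · simp [v, hr]
      · intro c _ hc
        rw [hD c.1 c.2, if_neg fun h' => hc (Subtype.ext h'.symm), zero_mul]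
      · simp
    · rw [show v r = 0 by simp [v, hr], mul_zero]
      exact Finset.sum_eq_zero fun c _ => by
        rw [hD c.1 c.2, if_neg fun h' => hr (by rw [h']; exact c.2), zero_mul]
  obtain ⟨k, hk⟩ := Sl2Module.exists_nat_of_ker (V := n → ℂ) (h := toLin' h) (e := toLin' e)
    (f := toLin' f) (by
      rw [Module.End.mul_eq_comp, Module.End.mul_eq_comp, ← toLin'_mul, ← toLin'_mul, ← map_sub,
        hhe, map_smul, two_smul, two_mul])
    (by rw [Module.End.mul_eq_comp, Module.End.mul_eq_comp, ← toLin'_mul, ← toLin'_mul,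
        ← map_sub, hef])
    (by obtain ⟨k, hk⟩ := hnil; exact ⟨k, by rw [← toLin'_pow, hk, map_zero]⟩)
    (v := v) (by rw [toLin'_apply, hev]) hv0 (μ := μ) (by rw [toLin'_apply, hhv])
  exact hμ k hk

end MatLie

namespace E6

attribute [local instance] LieRing.ofAssociativeRing

open Sparse Matrix MatLie

/-- Integral torus elements have integral eigenvalues. -/
lemma torZ_apply {n : Fin 6 → ℤ} {c : Fin 27} {m : ℤ} (h : ∑ i, n i * wt27 c i = 3 * m)
    (r : Fin 27) : torZ n r c = if r = c then (m : ℂ) else 0 := by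
  rw [torZ, tor_eq, diagonal_apply]
  by_cases hrc : r = c
  · subst hrc
    rw [if_pos rfl, if_pos rfl, div_eq_iff three_ne_zero, mul_comm]
    exact_mod_cast h
  · rw [if_neg hrc, if_neg hrc]

lemma apply_eq_zero_of_mem_gr {n : Fin 6 → ℤ} {k : ℤ} {x : Matrix (Fin 27) (Fin 27) ℂ}
    (hx : x ∈ gr gE6 (torZ n) k) {r c : Fin 27}
    (h : ∀ j, ht n j = k → bas j r c = 0) : x r c = 0 := by
  obtain ⟨a, rfl, ha⟩ := exists_of_mem_gr hx
  rw [Matrix.sum_apply]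
  refine Finset.sum_eq_zero fun j _ => ?_
  by_cases hj : a j = 0
  · rw [hj, zero_smul, Matrix.zero_apply]
  · rw [Matrix.smul_apply, h j (ha j hj), smul_zero]

lemma lie_tor_tor (d d' : Fin 6 → ℂ) : ⁅tor d, tor d'⁆ = 0 := by
  rw [tor_eq, tor_eq, Ring.lie_def, diagonal_mul_diagonal, diagonal_mul_diagonal]
  simp only [mul_comm, sub_self]

lemma torZ_ne_zero {z : Fin 6 → ℤ} (hz : z ≠ 0) : torZ z ≠ 0 := by
  obtain ⟨i, hi⟩ := Function.ne_iff.mp hz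
  intro h
  have h1 := lie_torZ_bas z (.inl (.inl (sim i)))
  have h2 : ht z (.inl (.inl (sim i))) = z i := by
    change ∑ l, z l * rwt (.inl (sim i)) l = z i
    simp [rwt_sim]
  rw [h, zero_lie, h2, eq_comm, smul_eq_zero] at h1
  exact h1.elim (fun h => hi (by exact_mod_cast h)) (linearIndependent_bas.ne_zero _)

lemma trace_torZ_mul (z z' : Fin 6 → ℤ) : (torZ z * torZ z').trace =
    ((∑ c, (∑ i, z i * wt27 c i) * (∑ i, z' i * wt27 c i) : ℤ) : ℂ) / 9 := by
  rw [torZ, torZ, tor_eq, tor_eq, diagonal_mul_diagonal, trace_diagonal]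
  push_cast
  rw [Finset.sum_div]
  exact Finset.sum_congr rfl fun c _ => by ring

lemma trace_torZ_sq {z : Fin 6 → ℤ} (hz : z ≠ 0) : (torZ z * torZ z).trace ≠ 0 := by
  intro h
  refine torZ_ne_zero hz ?_
  rw [trace_torZ_mul, div_eq_zero_iff, or_iff_left (by norm_num), Int.cast_eq_zero,
    Finset.sum_eq_zero_iff_of_nonneg fun c _ => mul_self_nonneg _] at h
  rw [torZ, tor_eq, diagonal_eq_zero]
  funext c
  have h3 := mul_self_eq_zero.mp (h c (Finset.mem_univ c))
  rw [Pi.zero_apply, div_eq_zero_iff]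
  exact Or.inl (by exact_mod_cast h3)

lemma derivedM_ne {e w y : Matrix (Fin 27) (Fin 27) ℂ} (hy : y ∈ cent e)
    (hw : ∀ p ∈ cent e, ∀ q ∈ cent e, (⁅p, q⁆ * w).trace = 0) (hwy : (y * w).trace ≠ 0) :
    derivedM e ≠ cent e := by
  intro h
  rw [← h] at hy
  refine hwy ?_
  clear hwy
  induction hy using Submodule.span_induction with
  | mem x hx =>
    obtain ⟨p, hp, q, hq, rfl⟩ := hx
    exact hw p hp q hq
  | zero => rw [zero_mul, trace_zero]
  | add x y _ _ hx hy => rw [add_mul, trace_add, hx, hy, add_zero]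
  | smul a x _ hx => rw [smul_mul_assoc, trace_smul, hx, smul_zero]

section

variable {n : Fin 6 → ℤ} {e f : Matrix (Fin 27) (Fin 27) ℂ} (T : Triple gE6 e (torZ n) f)

include T

/-- A torus element commuting with `e` obstructs perfectness of the centralizer as soon as it
pairs nontrivially with a torus element commuting with the degree-zero part. -/
theorem derivedM_ne_of_tor {z z' : Fin 6 → ℤ} (hz : ⁅torZ z, e⁆ = 0)
    (hz' : ∀ j, ht n j = 0 → ht z' j = 0) (htr : (torZ z * torZ z').trace ≠ 0) :
    derivedM e ≠ cent e := by
  refine derivedM_ne (y := torZ z) (w := torZ z')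
    ⟨tor_mem _, (lie_skew _ _).symm.trans (neg_eq_zero.mpr hz)⟩ (fun p hp q hq => ?_) htr
  have hp' := T.mem_grSum_of_ker hp.1 hp.2
  have hq' := T.mem_grSum_of_ker hq.1 hq.2
  obtain ⟨a, ha, b, hb, rfl⟩ := exists_add_of_mem_grSum (Q := fun k => k = 0)
    (R := fun k => 1 ≤ k) (fun k hk => by omega) hp'
  rw [grSum_eq] at ha
  have ha0 : ⁅a, torZ z'⁆ = 0 := by
    rw [← lie_skew, lie_eq_zero_of_support ha fun j hj => ?_, neg_zero]
    exact_mod_cast hz' j hj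
  have hbz : ⁅b, torZ z'⁆ ∈ grSum gE6 (torZ n) fun k => 1 ≤ k := by
    refine lie_mem_grSum (P := fun k => 1 ≤ k) (Q := fun k => k = 0) (fun k l hk hl => by omega)
      hb ?_
    rw [grSum_eq]
    exact ⟨tor_mem _, by rw [lie_tor_tor]; simp⟩
  rw [trace_lie_mul, add_lie, ha0, zero_add,
    trace_grSum (P := fun k => 0 ≤ k) (Q := fun k => 1 ≤ k) (fun k l hk hl => by omega) hq' hbz,
    neg_zero]

lemma trace_e_mul_f (he : e ≠ 0) : (e * f).trace ≠ 0 := by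
  intro h
  have hn : n ≠ 0 := by
    rintro rfl
    have h1 := T.lie_he
    have h2 : torZ 0 = 0 := by simp [tor]
    rw [h2, zero_lie, eq_comm, smul_eq_zero] at h1
    exact h1.elim two_ne_zero he
  refine trace_torZ_sq hn ?_
  have h1 := trace_lie_mul e f (torZ n)
  rw [T.lie_ef, ← lie_skew, T.lie_he, mul_neg, trace_neg, neg_neg, mul_smul_comm, trace_smul,
    trace_mul_comm f e, h, smul_zero] at h1
  exact h1

/-- If `e` maps the degree-one part injectively to the degree-three part, its centralizer is not
perfect. -/
theorem derivedM_ne_of_card (he : e ≠ 0)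
    (hcard : (Finset.univ.filter fun j => ht n j = 1).card ≤
      (Finset.univ.filter fun j => ht n j = 3).card) : derivedM e ≠ cent e := by
  have hinj : ∀ x ∈ gr gE6 (torZ n) 1, ⁅e, x⁆ = 0 → x = 0 := by
    have hmap : (gr gE6 (torZ n) 3) ≤ (gr gE6 (torZ n) 1).map
        (LieAlgebra.ad ℂ (Matrix (Fin 27) (Fin 27) ℂ) e) := fun z hz => by
      obtain ⟨x, hx, rfl⟩ := T.exists_lie_e_eq conjTranspose_mem (k := 1) (by norm_num) hz
      exact ⟨x, hx, rfl⟩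
    let φ : gr gE6 (torZ n) 1 →ₗ[ℂ] Matrix (Fin 27) (Fin 27) ℂ :=
      (LieAlgebra.ad ℂ (Matrix (Fin 27) (Fin 27) ℂ) e).comp (gr gE6 (torZ n) 1).subtype
    have hφ : LinearMap.range φ = (gr gE6 (torZ n) 1).map
        (LieAlgebra.ad ℂ (Matrix (Fin 27) (Fin 27) ℂ) e) := by
      rw [LinearMap.range_comp, Submodule.range_subtype]
    have h1 := LinearMap.finrank_range_add_finrank_ker φ
    have h2 := Submodule.finrank_mono hmap
    rw [← finrank_gr, ← finrank_gr] at hcard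
    rw [hφ] at h1
    have h3 : LinearMap.ker φ = ⊥ := Submodule.finrank_eq_zero.mp (by omega)
    intro x hx hex
    exact congrArg Subtype.val (LinearMap.ker_eq_bot'.mp h3 ⟨x, hx⟩ hex)
  have hdec : ∀ p ∈ cent e, ∃ a ∈ gr gE6 (torZ n) 0, ⁅a, f⁆ = 0 ∧
      ∃ b ∈ grSum gE6 (torZ n) (fun k => 2 ≤ k), p = a + b := by
    intro p hp
    have he2 : e ∈ grSum gE6 (torZ n) fun k => k = 2 := by rw [grSum_eq]; exact T.e_mem_gr
    obtain ⟨a, ha, b, hb, rfl⟩ := exists_add_of_mem_grSum (Q := fun k => k = 0)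
      (R := fun k => 1 ≤ k) (fun k hk => by omega) (T.mem_grSum_of_ker hp.1 hp.2)
    rw [grSum_eq] at ha
    have h1 : ⁅e, a⁆ = -⁅e, b⁆ := by
      rw [eq_neg_iff_add_eq_zero, ← lie_add]; exact hp.2
    have h2 : ⁅e, a⁆ = 0 := by
      refine eq_zero_of_mem_gr_of_mem_grSum (P := fun k => 3 ≤ k) (k := 2 + 0) (by norm_num)
        (lie_mem_gr T.e_mem_gr ha) ?_
      rw [h1]
      exact Submodule.neg_mem _ (lie_mem_grSum (fun k l hk hl => by omega) he2 hb)
    obtain ⟨c, hc, d, hd, rfl⟩ := exists_add_of_mem_grSum (Q := fun k => k = 1)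
      (R := fun k => 2 ≤ k) (fun k hk => by omega) hb
    rw [grSum_eq] at hc
    have h3 : ⁅e, c⁆ = -⁅e, d⁆ := by
      rw [eq_neg_iff_add_eq_zero, ← lie_add, ← neg_eq_zero, ← h1, h2]
    have h4 : ⁅e, c⁆ = 0 := by
      refine eq_zero_of_mem_gr_of_mem_grSum (P := fun k => 4 ≤ k) (k := 2 + 1) (by norm_num)
        (lie_mem_gr T.e_mem_gr hc) ?_
      rw [h3]
      exact Submodule.neg_mem _ (lie_mem_grSum (fun k l hk hl => by omega) he2 hd)
    refine ⟨a, ha, ?_, d, hd, by rw [hinj c hc h4, zero_add]⟩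
    refine T.eq_zero_of_lie_e (k := 0 + -2) (by norm_num) (lie_mem_gr ha T.f_mem_gr) ?_
    rw [leibniz_lie, h2, T.lie_ef, zero_lie, zero_add, ← lie_skew, ha.2]
    simp
  refine derivedM_ne (y := e) (w := f) ⟨T.e_mem, lie_self e⟩ (fun p hp q hq => ?_)
    (trace_e_mul_f T he)
  obtain ⟨a, ha, haf, b, hb, rfl⟩ := hdec p hp
  obtain ⟨a', ha', haf', b', hb', rfl⟩ := hdec q hq
  have hf2 : f ∈ grSum gE6 (torZ n) fun k => k = -2 := by rw [grSum_eq]; exact T.f_mem_gr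
  have ha2 : a ∈ grSum gE6 (torZ n) fun k => k = 0 := by rwa [grSum_eq]
  have ha2' : a' ∈ grSum gE6 (torZ n) fun k => k = 0 := by rwa [grSum_eq]
  have h1 : ∀ y, (⁅a, y⁆ * f).trace = 0 := fun y => by
    rw [trace_lie_mul, haf, mul_zero, trace_zero, neg_zero]
  have h2 : (⁅b, a'⁆ * f).trace = 0 := by
    rw [← lie_skew, neg_mul, trace_neg, trace_lie_mul, haf', mul_zero, trace_zero, neg_zero,
      neg_zero]
  have h3 : (⁅b, b'⁆ * f).trace = 0 :=
    trace_grSum (P := fun k => 4 ≤ k) (fun k l hk hl => by omega)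
      (lie_mem_grSum (fun k l hk hl => by omega) hb hb') hf2
  rw [add_lie, lie_add b, add_mul, add_mul, trace_add, trace_add, h1, h2, h3, add_zero, add_zero]

/-- Columns supported in negative weights give an obstruction to the existence of a triple. -/
lemma card_le_of_columns {m : ℤ} (hm : m < 0) (D R : Finset (Fin 27))
    (hD : ∀ c ∈ D, ∑ i, n i * wt27 c i = 3 * m)
    (hR : ∀ j, ht n j = 2 → ∀ c ∈ D, ∀ r ∉ R, bas j r c = 0) : D.card ≤ R.card := by
  refine card_le_of_weight (e := e) (h := torZ n) (f := f) T.lie_he T.lie_ef T.nil (μ := m)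
    (fun k hk => ?_) D R (fun c hc r => torZ_apply (hD c hc) r) fun c hc r hr =>
      apply_eq_zero_of_mem_gr T.e_mem_gr fun j hj => hR j hj c hc r hr
  have : m = k := by exact_mod_cast hk
  omega

/-- Rows supported in positive weights give an obstruction to the existence of a triple. -/
lemma card_le_of_rows {m : ℤ} (hm : 0 < m) (D R : Finset (Fin 27))
    (hD : ∀ c ∈ D, ∑ i, n i * wt27 c i = 3 * m)
    (hR : ∀ j, ht n j = 2 → ∀ c ∈ D, ∀ r ∉ R, bas j c r = 0) : D.card ≤ R.card := by
  refine card_le_of_weight (e := eᵀ) (h := -(torZ n)ᵀ) (f := fᵀ) ?_ ?_ ?_ (μ := -m)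
    (fun k hk => ?_) D R (fun c hc r => ?_) fun c hc r hr =>
      apply_eq_zero_of_mem_gr T.e_mem_gr fun j hj => hR j hj c hc r hr
  · rw [neg_mul, mul_neg, ← transpose_mul, ← transpose_mul, sub_neg_eq_add, neg_add_eq_sub,
      ← transpose_sub, ← transpose_smul]
    exact congrArg transpose T.lie_he
  · rw [← transpose_mul, ← transpose_mul, ← neg_sub, ← transpose_sub]
    exact congrArg (fun x => -transpose x) T.lie_ef
  · obtain ⟨k, hk⟩ := T.nil
    exact ⟨k, by rw [← transpose_pow, hk, transpose_zero]⟩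
  · have : -m = k := by exact_mod_cast hk
    omega
  · have h1 : (torZ n)ᵀ = torZ n := by rw [torZ, tor_eq, diagonal_transpose]
    rw [h1, Matrix.neg_apply, torZ_apply (hD c hc)]
    split_ifs <;> simp

end

end E6

namespace E6

attribute [local instance] LieRing.ofAssociativeRing

open Sparse Matrix MatLie

/-- Root vectors indexed by integers: `k ≥ 0` gives the `k`-th positive root and `-k - 1` its
negative. -/
def rootZ : ℤ → Sparse (Fin 27)
  | .ofNat k => rootS (Fin.ofNat 36 k)
  | .negSucc k => tr (rootS (Fin.ofNat 36 k))

/-- Weights of the vectors `rootZ k`. -/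
def idxZ : ℤ → Idx
  | .ofNat k => .inl (.inl (Fin.ofNat 36 k))
  | .negSucc k => .inl (.inr (Fin.ofNat 36 k))

lemma toM_rootZ (k : ℤ) : toM (rootZ k) = bas (idxZ k) := by
  cases k <;> rfl

/-- Integer combinations of root vectors. -/
def elt (l : List (ℤ × ℤ)) : Sparse (Fin 27) := l.flatMap fun s => smul s.1 (rootZ s.2)

lemma toM_elt (l : List (ℤ × ℤ)) :
    toM (elt l) = (l.map fun s => (s.1 : ℂ) • bas (idxZ s.2)).sum := by
  induction l with
  | nil => rfl
  | cons s l ih =>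
    rw [List.map_cons, List.sum_cons, ← ih, ← toM_rootZ, ← toM_smul, ← toM_append]
    rfl

lemma elt_mem_gr {n : Fin 6 → ℤ} {k : ℤ} {l : List (ℤ × ℤ)} (h : ∀ s ∈ l, ht n (idxZ s.2) = k) :
    toM (elt l) ∈ gr gE6 (torZ n) k := by
  rw [toM_elt]
  refine list_sum_mem fun x hx => ?_
  obtain ⟨s, hs, rfl⟩ := List.mem_map.mp hx
  refine Submodule.smul_mem _ _ ?_
  rw [← h s hs]
  exact bas_mem_gr n _

lemma elt_mem (l : List (ℤ × ℤ)) : toM (elt l) ∈ gE6 := by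
  rw [toM_elt]
  refine list_sum_mem fun x hx => ?_
  obtain ⟨s, hs, rfl⟩ := List.mem_map.mp hx
  exact gE6.smul_mem _ (bas_mem _)

/-- Integral torus elements as sparse matrices. -/
def torS (n : Fin 6 → ℤ) : Sparse (Fin 27) :=
  (List.finRange 27).map fun c => (c, c, (∑ i, n i * wt27 c i) / 3)

lemma toM_torS {n : Fin 6 → ℤ} (h : ∀ c, (3 : ℤ) ∣ ∑ i, n i * wt27 c i) :
    toM (torS n) = torZ n := by
  ext r c
  rw [torZ_apply (Int.mul_ediv_cancel' (h c)).symm, toM, torS, List.map_map, ← List.ofFn_eq_map,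
    List.sum_ofFn, Matrix.sum_apply, Finset.sum_eq_single c]
  · simp [Matrix.single_apply, eq_comm]
  · intro b _ hb
    simp [hb]
  · simp

/-- The nilpositive element attached to a list of roots. -/
def posS (l : List (ℤ × ℤ)) : List (ℤ × ℤ) := l.map fun s => (1, s.2)

/-- The nilnegative element attached to a list of weighted roots. -/
def negS (l : List (ℤ × ℤ)) : List (ℤ × ℤ) := l.map fun s => (s.1, -s.2 - 1)

lemma triple_of_list {n : Fin 6 → ℤ} {l : List (ℤ × ℤ)}
    (hn : ∀ c, (3 : ℤ) ∣ ∑ i, n i * wt27 c i)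
    (hp : ∀ s ∈ posS l, ht n (idxZ s.2) = 2) (hm : ∀ s ∈ negS l, ht n (idxZ s.2) = -2)
    (hef : eqv (br (elt (posS l)) (elt (negS l))) (torS n) = true)
    (hnil : mul (mul (mul (elt (posS l)) (elt (posS l))) (mul (elt (posS l)) (elt (posS l))))
      (mul (mul (elt (posS l)) (elt (posS l))) (mul (elt (posS l)) (elt (posS l)))) = []) :
    Triple gE6 (toM (elt (posS l))) (torZ n) (toM (elt (negS l))) where
  e_mem := elt_mem _
  h_mem := tor_mem _
  f_mem := elt_mem _
  nil := ⟨8, by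
    have := congrArg toM hnil
    simp only [toM_mul, toM_nil] at this
    rw [← this]
    noncomm_ring⟩
  lie_he := by
    have := (elt_mem_gr hp).2
    exact_mod_cast this
  lie_hf := by
    rw [(elt_mem_gr hm).2]; simp
  lie_ef := by rw [← toM_br, toM_eq hef, toM_torS hn]

end E6

namespace E6

attribute [local instance] LieRing.ofAssociativeRing

open Sparse Matrix MatLie

/-- An entry of a sparse matrix. -/
def entry (a : Sparse (Fin 27)) (p : Fin 27 × Fin 27) : ℤ :=
  (a.map fun t => if t.1 = p.1 ∧ t.2.1 = p.2 then t.2.2 else 0).sum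

/-- Whether a list of sparse matrices with marked entries is triangular. -/
def triangular : List (Sparse (Fin 27) × Fin 27 × Fin 27) → Bool
  | [] => true
  | s :: l => entry s.1 s.2 != 0 && (l.all fun t => entry t.1 s.2 == 0) && triangular l

lemma length_le_finrank : ∀ (l : List (Sparse (Fin 27) × Fin 27 × Fin 27))
    (N : Submodule ℂ (Matrix (Fin 27) (Fin 27) ℂ)), triangular l = true →
    (∀ s ∈ l, toM s.1 ∈ N) → l.length ≤ Module.finrank ℂ N
  | [], _, _, _ => Nat.zero_le _
  | s :: l, N, hl, hN => by
    simp only [triangular, Bool.and_eq_true, bne_iff_ne, List.all_eq_true, beq_iff_eq] at hl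
    obtain ⟨⟨h1, h2⟩, h3⟩ := hl
    let K := N ⊓ LinearMap.ker (Matrix.entryLinearMap ℂ ℂ s.2.1 s.2.2)
    have hK : ∀ t ∈ l, toM t.1 ∈ K := fun t ht => ⟨hN t (List.mem_cons_of_mem _ ht), by
      change toM t.1 s.2.1 s.2.2 = 0
      rw [toM_apply, Int.cast_eq_zero]
      exact h2 t ht⟩
    have hlt : K < N := by
      refine lt_of_le_of_ne inf_le_left fun h => h1 ?_
      have : toM s.1 ∈ K := by rw [h]; exact hN s List.mem_cons_self
      have h4 : toM s.1 s.2.1 s.2.2 = 0 := this.2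
      rw [toM_apply, Int.cast_eq_zero] at h4
      exact h4
    have := length_le_finrank l K h3 hK
    have := Submodule.finrank_lt_finrank_of_lt hlt
    rw [List.length_cons]
    omega

/-- Elements of a centralizer: combinations of root vectors, and the bracket of the first two. -/
def centS (B : List (List (ℤ × ℤ))) : List (Sparse (Fin 27)) :=
  B.map elt ++ [br (elt (B.getD 0 [])) (elt (B.getD 1 []))]

lemma centS_mem {e : Sparse (Fin 27)} {B : List (List (ℤ × ℤ))}
    (hB : ∀ b ∈ B, isZero (br e (elt b)) = true) : ∀ a ∈ centS B, toM a ∈ cent (toM e) := by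
  have h1 : ∀ b ∈ B, toM (elt b) ∈ cent (toM e) := fun b hb =>
    ⟨elt_mem b, by
      change ⁅toM e, toM (elt b)⁆ = 0
      rw [← toM_br, toM_eq_zero (hB b hb)]⟩
  have h2 : ∀ i, toM (elt (B.getD i [])) ∈ cent (toM e) := fun i => by
    rw [List.getD_eq_getElem?_getD]
    rcases h : B[i]? with _ | b
    · exact zero_mem _
    · exact h1 b (List.mem_of_getElem? h)
  intro a ha
  rcases List.mem_append.mp ha with h | h
  · obtain ⟨b, hb, rfl⟩ := List.mem_map.mp h
    exact h1 b hb
  · rw [List.mem_singleton.mp h, toM_br]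
    refine ⟨gE6.lie_mem (h2 0).1 (h2 1).1, ?_⟩
    change ⁅toM e, _⁆ = 0
    rw [leibniz_lie, (mem_cent.mp (h2 0)).2, (mem_cent.mp (h2 1)).2, zero_lie, lie_zero, add_zero]

lemma derivedM_le (e : Matrix (Fin 27) (Fin 27) ℂ) : derivedM e ≤ cent e := by
  refine Submodule.span_le.mpr ?_
  rintro _ ⟨x, hx, y, hy, rfl⟩
  refine ⟨gE6.lie_mem hx.1 hy.1, ?_⟩
  change ⁅e, _⁆ = 0
  rw [leibniz_lie, (mem_cent.mp hx).2, (mem_cent.mp hy).2, zero_lie, lie_zero, add_zero]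

/-- Brackets of listed elements with marked entries. -/
def brackets (B : List (Sparse (Fin 27))) (P : List (ℕ × ℕ × Fin 27 × Fin 27)) :
    List (Sparse (Fin 27) × Fin 27 × Fin 27) :=
  P.map fun p => (br (B.getD p.1 []) (B.getD p.2.1 []), p.2.2)

/-- A centralizer is perfect if it contains enough independent brackets. -/
theorem derivedM_eq_of_brackets {e : Sparse (Fin 27)} {B : List (List (ℤ × ℤ))}
    {P : List (ℕ × ℕ × Fin 27 × Fin 27)} (hB : ∀ b ∈ B, isZero (br e (elt b)) = true)
    (hP : triangular (brackets (centS B) P) = true)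
    (hcard : Module.finrank ℂ (cent (toM e)) ≤ P.length) : derivedM (toM e) = cent (toM e) := by
  refine Submodule.eq_of_le_of_finrank_le (derivedM_le _) (hcard.trans ?_)
  have h := length_le_finrank _ (derivedM (toM e)) hP fun s hs => ?_
  · rwa [brackets, List.length_map] at h
  · obtain ⟨p, _, rfl⟩ := List.mem_map.mp hs
    have h1 : ∀ i, toM ((centS B).getD i []) ∈ cent (toM e) := fun i => by
      rw [List.getD_eq_getElem?_getD]
      rcases h : (centS B)[i]? with _ | b
      · exact zero_mem _
      · exact centS_mem hB b (List.mem_of_getElem? h)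
    rw [toM_br]
    exact Submodule.subset_span ⟨_, h1 _, _, h1 _, rfl⟩

end E6

namespace E6

attribute [local instance] LieRing.ofAssociativeRing

open Sparse Matrix MatLie

/-- The equivalence of perfectness of the centralizer with the condition on its dimension. -/
def PerfectIff (e : Matrix (Fin 27) (Fin 27) ℂ) : Prop :=
  derivedM e = cent e ↔ Module.finrank ℂ (cent e) ∈ ({56, 38, 24} : Set ℕ)

/-- The dimension of the centralizer of the nilpositive element of a triple. -/
def centDim (n : Fin 6 → ℤ) : ℕ := (Finset.univ.filter fun j => ht n j = 0 ∨ ht n j = 1).card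

section

variable {n : Fin 6 → ℤ} {e f : Matrix (Fin 27) (Fin 27) ℂ} {l : List (ℤ × ℤ)}

/-- Decidable conditions for a list of weighted roots to give a triple. -/
def IsTripleList (n : Fin 6 → ℤ) (l : List (ℤ × ℤ)) : Prop :=
  (∀ c, (3 : ℤ) ∣ ∑ i, n i * wt27 c i) ∧ (∀ s ∈ posS l, ht n (idxZ s.2) = 2) ∧
  (∀ s ∈ negS l, ht n (idxZ s.2) = -2) ∧
  eqv (br (elt (posS l)) (elt (negS l))) (torS n) = true ∧
  mul (mul (mul (elt (posS l)) (elt (posS l))) (mul (elt (posS l)) (elt (posS l))))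
    (mul (mul (elt (posS l)) (elt (posS l))) (mul (elt (posS l)) (elt (posS l)))) = []

instance (n : Fin 6 → ℤ) (l : List (ℤ × ℤ)) : Decidable (IsTripleList n l) := by
  unfold IsTripleList; infer_instance

lemma IsTripleList.triple (h : IsTripleList n l) :
    Triple gE6 (toM (elt (posS l))) (torZ n) (toM (elt (negS l))) :=
  triple_of_list h.1 h.2.1 h.2.2.1 h.2.2.2.1 h.2.2.2.2

lemma perfectIff_of_brackets {B : List (List (ℤ × ℤ))} {P : List (ℕ × ℕ × Fin 27 × Fin 27)}
    (hl : IsTripleList n l) (hB : ∀ b ∈ B, isZero (br (elt (posS l)) (elt b)) = true)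
    (hP : triangular (brackets (centS B) P) = true) (hcard : centDim n = P.length)
    (hd : P.length = 56 ∨ P.length = 38 ∨ P.length = 24) (T : Triple gE6 e (torZ n) f) :
    ∃ u ∈ autGroup gE6, PerfectIff (cj u e) := by
  obtain ⟨u, hu, h⟩ := MatLie.exists_conj_of_triple T hl.triple conjTranspose_mem
  have hc := (finrank_cent hl.triple).trans hcard
  refine ⟨u, hu, ?_⟩
  rw [h]
  refine iff_of_true (derivedM_eq_of_brackets hB hP hc.le) ?_
  rw [hc]
  exact hd

lemma perfectIff_of_tor {z z' : Fin 6 → ℤ} (hl : IsTripleList n l)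
    (hz : ∀ s ∈ posS l, ht z (idxZ s.2) = 0) (hz' : ∀ j, ht n j = 0 → ht z' j = 0)
    (htr : ∑ c, (∑ i, z i * wt27 c i) * (∑ i, z' i * wt27 c i) ≠ 0)
    (hd : ¬ (centDim n = 56 ∨ centDim n = 38 ∨ centDim n = 24)) (T : Triple gE6 e (torZ n) f) :
    ∃ u ∈ autGroup gE6, PerfectIff (cj u e) := by
  obtain ⟨u, hu, h⟩ := MatLie.exists_conj_of_triple T hl.triple conjTranspose_mem
  refine ⟨u, hu, ?_⟩
  rw [h]
  refine iff_of_false (derivedM_ne_of_tor hl.triple (z := z) (z' := z') ?_ hz' ?_) ?_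
  · rw [(elt_mem_gr hz).2, Int.cast_zero, zero_smul]
  · rw [trace_torZ_mul]
    exact div_ne_zero (Int.cast_ne_zero.mpr htr) (by norm_num)
  · rw [finrank_cent hl.triple]
    exact hd

end

/-- Root vector combinations centralizing the representative. -/
def basis56 : List (List (ℤ × ℤ)) := List.map (fun k => [(1, k)])
    [0, 2, 3, 4, 5, 6, 8, 9, 10, 11, 14, 15, 17, 20, 22, -1, -3, -4, -5, -6, -7, -9, -10, -11,
    -12, -15, -16, -18, -21, -23, 1, 7, 12, 13, 16, 18, 19, 21, 23, 24, 25, 26, 27, 28, 29, 30,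
    31, 32, 33, 34, 35]

/-- Pairs of elements with independent brackets. -/
def pairs56 : List (ℕ × ℕ × Fin 27 × Fin 27) :=
  [(0, 1, 0, 2), (0, 6, 0, 3), (0, 10, 0, 5), (0, 13, 0, 7), (0, 15, 0, 0), (1, 16, 1, 1), (2, 17,
  2, 2), (3, 18, 3, 3), (4, 19, 5, 5), (0, 20, 2, 1), (0, 24, 3, 1), (0, 27, 5, 1), (0, 29, 7, 1),
  (0, 32, 0, 4), (0, 35, 0, 6), (0, 38, 0, 8), (0, 39, 0, 9), (0, 42, 0, 11), (0, 45, 0, 14), (1,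
  2, 1, 3), (1, 7, 1, 5), (1, 11, 1, 7), (1, 20, 1, 0), (1, 21, 3, 2), (1, 25, 5, 2), (1, 28, 7,
  2), (1, 31, 1, 4), (1, 33, 1, 6), (1, 36, 1, 9), (1, 40, 0, 10), (1, 44, 0, 13), (1, 47, 0, 16),
  (2, 3, 2, 5), (2, 8, 2, 7), (2, 22, 5, 3), (2, 24, 2, 0), (2, 26, 7, 3), (2, 30, 2, 4), (2, 35,
  1, 8), (2, 39, 1, 11), (2, 48, 0, 18), (3, 4, 3, 7), (3, 23, 7, 5), (3, 27, 3, 0), (3, 31, 2,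
  6), (3, 42, 1, 14), (4, 29, 5, 0), (4, 33, 2, 9), (5, 15, 1, 2), (5, 16, 0, 1), (6, 16, 2, 3),
  (7, 17, 3, 5), (8, 18, 5, 7), (15, 28, 7, 0), (17, 31, 3, 4), (30, 49, 0, 20)]

/-- Root vector combinations centralizing the representative. -/
def basis38 : List (List (ℤ × ℤ)) := 
  [[(1, 1)], [(1, -2)], [(1, 0), (1, -6)], [(-1, 2), (1, -5)], [(-1, 4), (1, -3)], [(1, 5), (1,
  -1)], [(-1, 6), (1, -11)], [(-1, 10), (1, -7)], [(1, 8)], [(1, 9)], [(1, 11)], [(1, 12)], [(1,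
  13)], [(1, 15)], [(1, 16)], [(1, 17)], [(1, 19)], [(1, 20)], [(1, 21)], [(1, 24)], [(1, 3), (1,
  14)], [(1, 3), (1, 22)], [(1, 7), (1, 18)], [(1, 7), (1, 26)], [(1, 23)], [(1, 29)], [(1, 33)],
  [(1, 25)], [(1, 27)], [(1, 28)], [(1, 30)], [(1, 31)], [(1, 32)], [(1, 34)], [(1, 35)]]

/-- Pairs of elements with independent brackets. -/
def pairs38 : List (ℕ × ℕ × Fin 27 × Fin 27) :=
  [(2, 5, 0, 0), (0, 1, 7, 7), (3, 4, 1, 1), (0, 8, 1, 4), (0, 9, 2, 6), (0, 10, 0, 4), (0, 13, 2,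
  9), (0, 15, 0, 6), (0, 17, 1, 9), (0, 20, 1, 6), (0, 21, 0, 9), (0, 33, 0, 20), (0, 35, 3, 4),
  (1, 11, 1, 3), (1, 12, 2, 5), (1, 14, 0, 3), (1, 16, 2, 7), (1, 18, 0, 5), (1, 19, 1, 7), (1,
  22, 1, 5), (1, 23, 0, 7), (1, 34, 0, 18), (1, 35, 4, 3), (2, 3, 0, 2), (2, 7, 2, 1), (9, 14, 0,
  8), (8, 12, 1, 8), (10, 16, 0, 11), (15, 19, 0, 16), (13, 18, 0, 14), (8, 18, 0, 10), (3, 7, 1,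
  0), (10, 19, 0, 13), (8, 16, 1, 11), (4, 5, 2, 0), (4, 6, 0, 1), (9, 19, 1, 14), (5, 6, 1, 2)]

/-- Root vector combinations centralizing the representative. -/
def basis24 : List (List (ℤ × ℤ)) := 
  [[(1, 1), (-1, 2), (1, -5)], [(-1, 4), (-1, -2), (1, -3)], [(1, 9)], [(1, 12)], [(1, 0), (-2,
  3), (1, 10), (1, 13)], [(1, 0), (-1, 3), (1, 10), (1, 14)], [(1, 5), (1, 6), (-2, 7), (1, 8)],
  [(1, 5), (1, 6), (-1, 7), (1, 18)], [(1, 23)], [(1, 11), (1, 19)], [(1, 20), (1, 21)], [(-1,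
  15), (1, 17)], [(-1, 16), (1, 24)], [(-1, 22), (1, 25)], [(-1, 22), (1, 30)], [(-1, 26), (1,
  27)], [(1, 26), (1, 28)], [(1, 29)], [(1, 33)], [(1, 31)], [(1, 32)], [(1, 34)], [(1, 35)]]

/-- Pairs of elements with independent brackets. -/
def pairs24 : List (ℕ × ℕ × Fin 27 × Fin 27) :=
  [(0, 1, 1, 1), (0, 2, 1, 5), (4, 23, 0, 1), (1, 3, 1, 3), (0, 5, 0, 2), (3, 23, 1, 4), (3, 4, 0,
  4), (0, 11, 0, 6), (4, 7, 0, 3), (2, 3, 1, 8), (3, 11, 0, 10), (0, 14, 0, 9), (3, 13, 0, 13),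
  (0, 20, 0, 16), (4, 15, 0, 11), (3, 20, 0, 20), (0, 23, 1, 2), (2, 23, 2, 5), (2, 6, 0, 5), (2,
  12, 0, 8), (1, 15, 0, 7), (2, 15, 0, 14), (2, 19, 0, 18), (1, 23, 2, 1)]

section

variable {e f : Matrix (Fin 27) (Fin 27) ℂ}

set_option maxRecDepth 100000

lemma perfectIff_min (T : Triple gE6 e (torZ ![0, 1, 0, 0, 0, 0]) f) :
    ∃ u ∈ autGroup gE6, PerfectIff (cj u e) :=
  perfectIff_of_brackets (l := [(1, 35)]) (B := basis56) (P := pairs56) (by decide +kernel)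
    (by decide +kernel) (by decide +kernel) (by decide +kernel) (by decide +kernel) T

lemma perfectIff_three_A1 (T : Triple gE6 e (torZ ![0, 0, 0, 1, 0, 0]) f) :
    ∃ u ∈ autGroup gE6, PerfectIff (cj u e) :=
  perfectIff_of_brackets (l := [(1, 23), (1, 29), (1, 33)]) (B := basis38) (P := pairs38)
    (by decide +kernel) (by decide +kernel) (by decide +kernel) (by decide +kernel)
    (by decide +kernel) T

lemma perfectIff_two_A2_A1 (T : Triple gE6 e (torZ ![1, 0, 0, 1, 0, 1]) f) :
    ∃ u ∈ autGroup gE6, PerfectIff (cj u e) :=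
  perfectIff_of_brackets (l := [(2, 11), (2, 19), (2, 20), (2, 21), (1, 23)]) (B := basis24)
    (P := pairs24) (by decide +kernel) (by decide +kernel) (by decide +kernel) (by decide +kernel)
    (by decide +kernel) T

lemma perfectIff_dim22 (T : Triple gE6 e (torZ ![0, 1, 1, 0, 1, 0]) f) :
    ∃ u ∈ autGroup gE6, PerfectIff (cj u e) :=
  perfectIff_of_tor (l := [(3, 12), (4, 17), (3, 19), (1, 20)]) (z := ![1, 1, 1, -2, 0, 1])
    (z' := ![0, 0, 1, 0, 0, 0]) (by decide +kernel) (by decide +kernel) (by decide +kernel)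
    (by decide +kernel) (by decide +kernel) T

lemma perfectIff_dim32 (T : Triple gE6 e (torZ ![1, 1, 0, 0, 0, 1]) f) :
    ∃ u ∈ autGroup gE6, PerfectIff (cj u e) :=
  perfectIff_of_tor (l := [(2, 16), (2, 30), (1, 22)]) (z := ![1, 1, -2, 0, 0, 1])
    (z' := ![1, 0, 0, 0, 0, 0]) (by decide +kernel) (by decide +kernel) (by decide +kernel)
    (by decide +kernel) (by decide +kernel) T

lemma perfectIff_dim16 (T : Triple gE6 e (torZ ![1, 1, 1, 0, 1, 1]) f) :
    ∃ u ∈ autGroup gE6, PerfectIff (cj u e) :=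
  perfectIff_of_tor (l := [(4, 12), (6, 10), (6, 11), (4, 13), (1, 14)])
    (z := ![-1, -1, -1, 2, -1, 1]) (z' := ![1, 0, 0, 0, 0, 0]) (by decide +kernel)
    (by decide +kernel) (by decide +kernel) (by decide +kernel) (by decide +kernel) T

end

end E6

namespace E6

attribute [local instance] LieRing.ofAssociativeRing

open Sparse Matrix MatLie

/-- The positive roots in terms of simple roots. -/
def coords : List (List ℕ) := [
    [1, 0, 0, 0, 0, 0], [0, 1, 0, 0, 0, 0], [0, 0, 1, 0, 0, 0], [0, 0, 0, 1, 0, 0], [0, 0, 0,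
    0, 1, 0], [0, 0, 0, 0, 0, 1], [1, 0, 1, 0, 0, 0], [0, 1, 0, 1, 0, 0], [0, 0, 1, 1, 0, 0],
    [0, 0, 0, 1, 1, 0], [0, 0, 0, 0, 1, 1], [1, 0, 1, 1, 0, 0], [0, 1, 1, 1, 0, 0], [0, 1, 0,
    1, 1, 0], [0, 0, 1, 1, 1, 0], [0, 0, 0, 1, 1, 1], [1, 1, 1, 1, 0, 0], [1, 0, 1, 1, 1, 0],
    [0, 1, 1, 1, 1, 0], [0, 1, 0, 1, 1, 1], [0, 0, 1, 1, 1, 1], [1, 1, 1, 1, 1, 0], [1, 0, 1,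
    1, 1, 1], [0, 1, 1, 2, 1, 0], [0, 1, 1, 1, 1, 1], [1, 1, 1, 2, 1, 0], [1, 1, 1, 1, 1, 1],
    [0, 1, 1, 2, 1, 1], [1, 1, 2, 2, 1, 0], [1, 1, 1, 2, 1, 1], [0, 1, 1, 2, 2, 1], [1, 1, 2,
    2, 1, 1], [1, 1, 1, 2, 2, 1], [1, 1, 2, 2, 2, 1], [1, 1, 2, 3, 2, 1], [1, 2, 2, 3, 2, 1]]

/-- The weighted diagram with a given list of labels. -/
def diag (m : List ℕ) : Fin 6 → ℤ := fun i => (m.getD i 0 : ℕ)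

/-- The pairing of two lists of natural numbers. -/
def dot : List ℕ → List ℕ → ℕ
  | a :: l, b :: m => a * b + dot l m
  | _, _ => 0

/-- The pairing of a list of integers with a list of natural numbers. -/
def dotZ : List ℤ → List ℕ → ℤ
  | a :: l, b :: m => a * b + dotZ l m
  | _, _ => 0

lemma dotZ_cast : ∀ l m, dotZ (l.map Nat.cast) m = dot l m
  | [], _ => rfl
  | _ :: _, [] => rfl
  | a :: l, b :: m => by
    rw [List.map_cons, dotZ, dot, dotZ_cast l m]
    push_cast
    rfl

lemma dotZ_eq_sum {l : List ℤ} {m : List ℕ} (hl : l.length = 6) (hm : m.length = 6) :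
    dotZ l m = ∑ i : Fin 6, l.getD i 0 * (m.getD i 0 : ℕ) := by
  match l, m, hl, hm with
  | [a, b, c, d, e, f], [a', b', c', d', e', f'], _, _ =>
    simp [dotZ, Fin.sum_univ_succ]

lemma check_coords : ∀ k : Fin 36, (coords.getD k []).length = 6 ∧
    ∀ i : Fin 6, rwt (.inl k) i = ((coords.getD k []).getD i 0 : ℕ) := by decide +kernel

lemma coords_mem (k : Fin 36) : coords.getD k [] ∈ coords := by
  rw [List.getD_eq_getElem _ _ (show k.1 < coords.length from k.2)]
  exact List.getElem_mem _

lemma ht_pos {z : Fin 6 → ℤ} {l : List ℤ} (hl : l.length = 6) (hz : ∀ i : Fin 6, z i = l.getD i 0)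
    (k : Fin 36) : ht z (.inl (.inl k)) = dotZ l (coords.getD k []) := by
  rw [dotZ_eq_sum hl (check_coords k).1]
  exact Finset.sum_congr rfl fun i _ => by rw [← (check_coords k).2, hz]; rfl

lemma ht_neg (z : Fin 6 → ℤ) (k : Fin 36) :
    ht z (.inl (.inr k)) = -ht z (.inl (.inl k)) := by
  rw [ht, ht, ← Finset.sum_neg_distrib]
  exact Finset.sum_congr rfl fun i _ => by rw [← mul_neg]; rfl

lemma ht_zero (z : Fin 6 → ℤ) (i : Fin 6) : ht z (.inr i) = 0 :=
  Finset.sum_eq_zero fun _ _ => mul_zero _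

lemma ht_diag {m : List ℕ} (hm : m.length = 6) (k : Fin 36) :
    ht (diag m) (.inl (.inl k)) = dot m (coords.getD k []) := by
  rw [← dotZ_cast]
  refine ht_pos (by simpa using hm) (fun i => ?_) k
  simp [diag, List.getD_eq_getElem?_getD, List.getElem?_map]
  cases m[i.1]? <;> simp

/-- The number of positive roots of a given height. -/
def mult (m : List ℕ) (k : ℕ) : ℕ :=
  (coords.map fun r => if dot m r = k then 1 else 0).sum

lemma sum_coords (F : List ℕ → ℕ) : (coords.map F).sum = ∑ k : Fin 36, F (coords.getD k []) := by
  rw [show coords = List.ofFn fun k : Fin 36 => coords.getD k [] from by decide +kernel,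
    List.map_ofFn, List.sum_ofFn]
  rfl

lemma card_ht_pos {m : List ℕ} (hm : m.length = 6) {k : ℕ} (hk : 0 < k) :
    (Finset.univ.filter fun j => ht (diag m) j = k).card = mult m k := by
  rw [Finset.card_filter, Fintype.sum_sum_type, Fintype.sum_sum_type, mult, sum_coords]
  simp only [ht_neg, ht_zero, ht_diag hm]
  rw [Finset.sum_eq_zero
      (f := fun x : Fin 36 => if -(dot m (coords.getD x []) : ℤ) = k then 1 else 0),
    Finset.sum_eq_zero (f := fun _ : Fin 6 => if (0 : ℤ) = k then 1 else 0)]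
  · simp only [add_zero, Nat.cast_inj]
  · intro i _
    rw [if_neg (by omega)]
  · intro i _
    rw [if_neg (by omega)]

lemma card_ht_zero {m : List ℕ} (hm : m.length = 6) :
    (Finset.univ.filter fun j => ht (diag m) j = 0).card = 2 * mult m 0 + 6 := by
  rw [Finset.card_filter, Fintype.sum_sum_type, Fintype.sum_sum_type, mult, sum_coords]
  simp only [ht_neg, ht_zero, ht_diag hm, neg_eq_zero, Nat.cast_eq_zero, if_true]
  rw [two_mul]
  simp

lemma centDim_diag {m : List ℕ} (hm : m.length = 6) :
    centDim (diag m) = 2 * mult m 0 + mult m 1 + 6 := by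
  have h := card_ht_pos hm one_pos
  rw [centDim, Finset.filter_or, Finset.card_union_of_disjoint, card_ht_zero hm]
  · rw [Nat.cast_one] at h
    rw [h]
    omega
  · rw [Finset.disjoint_filter]
    omega

/-- Weighted diagrams with integral torus elements orthogonal to the roots of heights `0` and
`2`. -/
def torTable : List (List ℕ × List ℤ) := [
    ([0, 0, 0, 0, 1, 1], [0, 0, 0, 0, -1, 1]), ([0, 0, 1, 0, 1, 0], [0, 0, -1, 0, 1, 0]),
    ([0, 0, 1, 1, 0, 2], [0, 0, -1, 1, 0, 0]), ([0, 1, 0, 0, 1, 1], [0, 1, 0, 0, -1, 1]),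
    ([0, 1, 0, 1, 0, 0], [0, -1, 0, 1, 0, 0]), ([0, 1, 1, 0, 0, 2], [0, -1, 1, 0, 0, 0]),
    ([1, 0, 0, 0, 0, 1], [-1, 0, 0, 0, 0, 1]), ([1, 0, 0, 0, 1, 2], [-1, 0, 0, 0, 1, 0]),
    ([1, 0, 0, 1, 1, 2], [1, 0, 0, -1, 1, 0]), ([1, 0, 1, 0, 0, 0], [-1, 0, 1, 0, 0, 0]),
    ([1, 0, 1, 0, 1, 1], [-1, 0, 1, 0, -1, 1]), ([1, 1, 0, 1, 0, 1], [1, 1, 0, -1, 0, 1]),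
    ([1, 1, 0, 1, 1, 2], [1, 1, 0, -1, 1, 0]), ([1, 1, 1, 0, 0, 0], [-1, -1, 1, 0, 0, 0]),
    ([1, 1, 1, 1, 1, 1], [1, -1, -1, 1, -1, 1]), ([1, 1, 1, 1, 2, 2], [1, -1, -1, 1, 0, 0]),
    ([1, 2, 0, 1, 0, 1], [1, 0, 0, -1, 0, 1]), ([1, 2, 0, 1, 1, 2], [1, 0, 0, -1, 1, 0]),
    ([1, 2, 1, 0, 1, 1], [-1, 0, 1, 0, -1, 1]), ([1, 2, 1, 1, 1, 1], [1, 0, -1, 1, -1, 1]),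
    ([2, 0, 0, 1, 1, 0], [0, 0, 0, -1, 1, 0]), ([2, 0, 1, 0, 0, 1], [0, 0, -1, 0, 0, 1]),
    ([2, 0, 1, 1, 0, 1], [0, 0, 1, -1, 0, 1]), ([2, 1, 0, 0, 1, 0], [0, -1, 0, 0, 1, 0]),
    ([2, 1, 1, 1, 0, 1], [0, 1, 1, -1, 0, 1]), ([2, 1, 2, 1, 1, 1], [0, -1, 0, 1, -1, 1]),
    ([2, 2, 1, 1, 0, 1], [0, 0, 1, -1, 0, 1])]

/-- Weighted diagrams treated separately. -/
def special : List (List ℕ) := [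
    [0, 1, 0, 0, 0, 0], [0, 0, 0, 1, 0, 0], [1, 0, 0, 1, 0, 1], [0, 1, 1, 0, 1, 0],
    [1, 1, 0, 0, 0, 1], [1, 1, 1, 0, 1, 1], [0, 0, 1, 0, 0, 2], [1, 1, 0, 0, 1, 2],
    [2, 0, 0, 0, 1, 0], [2, 1, 1, 0, 0, 1]]

/-- Whether a number is the dimension of the centralizer of a rigid element. -/
def IsRigidDim (d : ℕ) : Prop := d = 56 ∨ d = 38 ∨ d = 24

instance (d : ℕ) : Decidable (IsRigidDim d) := by unfold IsRigidDim; infer_instance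

/-- The alternatives for a weighted diagram. -/
def Alternatives (m : List ℕ) : Prop :=
  ¬ 3 ∣ dot m [4, 3, 5, 6, 4, 2] ∨ m ∈ [[0, 0, 0, 0, 0, 0]] ∨
  2 * mult m 0 + 6 < mult m 2 ∨ (∃ k ∈ List.range 16, mult m (k + 1) < mult m (k + 3)) ∨
  (¬ IsRigidDim (2 * mult m 0 + mult m 1 + 6) ∧ mult m 1 ≤ mult m 3) ∨
  (∃ p ∈ torTable, m = p.1) ∨ m ∈ special

instance (m : List ℕ) : Decidable (Alternatives m) := by unfold Alternatives; infer_instance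

set_option maxRecDepth 100000 in
lemma check_alternatives : ∀ a b c d e f : Fin 3,
    Alternatives [a.1, b.1, c.1, d.1, e.1, f.1] := by decide +kernel

lemma check_torTable : ∀ p ∈ torTable, p.1.length = 6 ∧ p.2.length = 6 ∧
    (∃ i : Fin 6, p.2.getD i 0 ≠ 0) ∧
    ¬ IsRigidDim (2 * mult p.1 0 + mult p.1 1 + 6) ∧
    ∀ r ∈ coords, dot p.1 r = 0 ∨ dot p.1 r = 2 → dotZ p.2 r = 0 := by decide +kernel

end E6

namespace E6

attribute [local instance] LieRing.ofAssociativeRing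

open Sparse Matrix MatLie

section

variable {n : Fin 6 → ℤ} {m : List ℕ} {e f : Matrix (Fin 27) (Fin 27) ℂ}

lemma perfectIff_of_ne (T : Triple gE6 e (torZ n) f) (hd : ¬ IsRigidDim (centDim n))
    (h : derivedM e ≠ cent e) : PerfectIff e := by
  refine iff_of_false h ?_
  rw [finrank_cent T]
  exact hd

lemma perfectIff_of_torTable {p : List ℕ × List ℤ} (hp : p ∈ torTable)
    (T : Triple gE6 e (torZ (diag p.1)) f) : PerfectIff e := by
  obtain ⟨h1, h2, ⟨i, hi⟩, hd, hr⟩ := check_torTable p hp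
  rw [← centDim_diag h1] at hd
  let z : Fin 6 → ℤ := fun i => p.2.getD i 0
  have hz : ∀ j, ht (diag p.1) j = 0 ∨ ht (diag p.1) j = 2 → ht z j = 0 := by
    rintro ((k | k) | i) hj
    · rw [ht_diag h1] at hj
      rw [ht_pos h2 fun _ => rfl]
      exact hr _ (coords_mem k) (by omega)
    · rw [ht_neg, ht_diag h1] at hj
      rw [ht_neg, ht_pos h2 fun _ => rfl, neg_eq_zero]
      exact hr _ (coords_mem k) (by omega)
    · exact ht_zero z i
  refine perfectIff_of_ne T hd (derivedM_ne_of_tor T (z := z) (z' := z) ?_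
    (fun j hj => hz j (.inl hj)) (trace_torZ_sq fun h => hi (congrFun h i)))
  refine lie_eq_zero_of_support T.e_mem_gr fun j hj => ?_
  exact_mod_cast hz j (.inr hj)

lemma bas_apply_eq_zero {P : Fin 27 → Fin 27 → Prop}
    (h : ∀ a : Root, ht n (.inl a) = 2 → ∀ t ∈ vecS a, P t.1 t.2.1) {j : Idx} (hj : ht n j = 2)
    {r c : Fin 27} (hP : ¬ P r c) : bas j r c = 0 := by
  rcases j with a | i
  · by_contra hne
    obtain ⟨v, hv⟩ := mem_of_toM_ne_zero (a := vecS a) hne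
    exact hP (h a hj _ hv)
  · rw [ht_zero] at hj
    omega

/-- Columns of negative weight obstructing the existence of a triple. -/
lemma not_triple_of_columns {k : ℤ} (D R : Finset (Fin 27))
    (h : k < 0 ∧ (∀ c ∈ D, ∑ i, n i * wt27 c i = 3 * k) ∧
      (∀ a : Root, ht n (.inl a) = 2 → ∀ t ∈ vecS a, t.2.1 ∈ D → t.1 ∈ R) ∧ R.card < D.card)
    (T : Triple gE6 e (torZ n) f) : False := by
  refine h.2.2.2.not_ge (card_le_of_columns T h.1 D R h.2.1 fun j hj c hc r hr => ?_)
  exact bas_apply_eq_zero (P := fun r c => c ∈ D → r ∈ R) h.2.2.1 hj fun h' => hr (h' hc)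

/-- Rows of positive weight obstructing the existence of a triple. -/
lemma not_triple_of_rows {k : ℤ} (D R : Finset (Fin 27))
    (h : 0 < k ∧ (∀ c ∈ D, ∑ i, n i * wt27 c i = 3 * k) ∧
      (∀ a : Root, ht n (.inl a) = 2 → ∀ t ∈ vecS a, t.1 ∈ D → t.2.1 ∈ R) ∧ R.card < D.card)
    (T : Triple gE6 e (torZ n) f) : False := by
  refine h.2.2.2.not_ge (card_le_of_rows T h.1 D R h.2.1 fun j hj c hc r hr => ?_)
  exact bas_apply_eq_zero (P := fun c r => c ∈ D → r ∈ R) h.2.2.1 hj fun h' => hr (h' hc)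

lemma eq_zero_of_triple_zero (T : Triple gE6 e (torZ 0) f) : e = 0 := by
  have h1 : torZ 0 * e - e * torZ 0 = (2 : ℂ) • e := T.lie_he
  have h2 : torZ 0 = 0 := by simp [tor]
  rw [h2, zero_mul, mul_zero, sub_zero, eq_comm, smul_eq_zero] at h1
  exact h1.resolve_left two_ne_zero

lemma perfectIff_of_special (hm : m ∈ special) (T : Triple gE6 e (torZ (diag m)) f) :
    ∃ u ∈ autGroup gE6, PerfectIff (cj u e) := by
  simp only [special, List.mem_cons, List.not_mem_nil, or_false] at hm
  have hdiag : ∀ a b c d e f : ℕ, diag [a, b, c, d, e, f] =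
      ![(a : ℤ), (b : ℤ), (c : ℤ), (d : ℤ), (e : ℤ), (f : ℤ)] := fun a b c d e f => by
    funext i
    fin_cases i <;> rfl
  rcases hm with rfl | rfl | rfl | rfl | rfl | rfl | rfl | rfl | rfl | rfl <;>
    rw [hdiag] at T
  · exact perfectIff_min T
  · exact perfectIff_three_A1 T
  · exact perfectIff_two_A2_A1 T
  · exact perfectIff_dim22 T
  · exact perfectIff_dim32 T
  · exact perfectIff_dim16 T
  · exact (not_triple_of_columns (k := -1) {13, 16, 18, 20} {10} (by decide +kernel) T).elim
  · exact (not_triple_of_columns (k := -1) {14, 15, 16, 18} {7, 12} (by decide +kernel) T).elim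
  · exact (not_triple_of_columns (k := -2) {17, 19, 21, 22, 23, 24} {14, 16, 18, 20}
      (by decide +kernel) T).elim
  · exact (not_triple_of_rows (k := 2) {4, 6, 7, 8} {13, 16, 18} (by decide +kernel) T).elim

lemma perfectIff_of_alternatives (hm : m.length = 6) (h : Alternatives m) (he : e ≠ 0)
    (h3 : 3 ∣ dot m [4, 3, 5, 6, 4, 2]) (T : Triple gE6 e (torZ (diag m)) f) :
    ∃ u ∈ autGroup gE6, PerfectIff (cj u e) := by
  rcases h with h | h | h | ⟨k, -, h⟩ | ⟨hd, h⟩ | ⟨p, hp, rfl⟩ | h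
  · exact absurd h3 h
  · rw [List.mem_singleton] at h
    subst h
    refine absurd (eq_zero_of_triple_zero (e := e) (f := f) ?_) he
    convert T using 2
    decide
  · have := card_le_of_triple T (k := 0) (by norm_num)
    have h2 := card_ht_pos hm two_pos
    rw [card_ht_zero hm, zero_add] at this
    rw [Nat.cast_ofNat] at h2
    omega
  · have := card_le_of_triple T (k := (k + 1 : ℕ)) (by omega)
    have h2 := card_ht_pos hm (k := k + 3) (by omega)
    rw [card_ht_pos hm (by omega), show ((k + 1 : ℕ) : ℤ) + 2 = (k + 3 : ℕ) by push_cast; ring,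
      h2] at this
    omega
  · rw [← centDim_diag hm] at hd
    have h1 := card_ht_pos hm one_pos
    have h2 := card_ht_pos hm three_pos
    rw [← h1, ← h2, Nat.cast_one, Nat.cast_ofNat] at h
    refine ⟨1, one_mem _, ?_⟩
    rw [cj_one]
    exact perfectIff_of_ne T hd (derivedM_ne_of_card T he h)
  · refine ⟨1, one_mem _, ?_⟩
    rw [cj_one]
    exact perfectIff_of_torTable hp T
  · exact perfectIff_of_special h T

end

theorem exists_perfectIff {e : Matrix (Fin 27) (Fin 27) ℂ} (he : e ∈ gE6) (h0 : e ≠ 0)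
    (hnil : IsNilpotent e) : ∃ u ∈ autGroup gE6, PerfectIff (cj u e) := by
  obtain ⟨u, hu, n, f, T, hn, h3⟩ := exists_standard he hnil
  obtain ⟨a, ha⟩ : ∃ a : Fin 6 → Fin 3, ∀ i, n i = (a i).1 :=
    ⟨fun i => ⟨(n i).toNat, by have := hn i; omega⟩, fun i => by have := hn i; simp; omega⟩
  have hdiag : n = diag [(a 0).1, (a 1).1, (a 2).1, (a 3).1, (a 4).1, (a 5).1] := by
    funext i
    rw [ha]
    fin_cases i <;> rfl
  have h0' : cj u e ≠ 0 := fun h => h0 (by rw [← cj_inv_cj u e, h, cj_zero])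
  have h3' : (3 : ℤ) ∣ dot [(a 0).1, (a 1).1, (a 2).1, (a 3).1, (a 4).1, (a 5).1]
      [4, 3, 5, 6, 4, 2] := by
    have h4 := h3 0
    have h5 : ∀ i, wt27 0 i = ![4, 3, 5, 6, 4, 2] i := by decide
    simp only [h5, ha] at h4
    simpa [dot, Fin.sum_univ_succ] using h4
  rw [hdiag] at T
  obtain ⟨v, hv, h⟩ := perfectIff_of_alternatives rfl
    (check_alternatives (a 0) (a 1) (a 2) (a 3) (a 4) (a 5)) h0' (by exact_mod_cast h3') T
  exact ⟨v * u, mul_mem hv hu, by rwa [cj_mul_cj]⟩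

end E6

/-- In type E₆, a nonzero nilpotent `e` is strongly reachable iff `dim g_e ∈ {56,38,24}`. -/
theorem strongly_reachable_iff_dim_E6 (e : LieAlgebra.e₆ ℂ) (he : e ≠ 0)
    (hnil : IsNilpotent (LieAlgebra.ad ℂ (LieAlgebra.e₆ ℂ) e)) :
    derived e = centralizer e ↔
      Module.finrank ℂ ↥(centralizer e) ∈ ({56, 38, 24} : Set ℕ) := by
  obtain ⟨u, hu, h⟩ := E6.exists_perfectIff (e := E6.rep e) ⟨e, rfl⟩
    (fun h => he (E6.rep_injective (by rw [h, map_zero]))) (E6.isNilpotent_rep hnil)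
  have hΦ := E6.mem_gE6_iff hu
  rw [E6.derived_eq_iff _ (E6.conjRep_injective u) (E6.conjRep_lie u) hΦ,
    E6.finrank_centralizer _ (E6.conjRep_injective u) (E6.conjRep_lie u) hΦ]
  exact h
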